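/- Let G be a finite group with |G| = |L₃(83)| = 2⁴·3·7·19·41²·83³·367 and degree pattern D(G) = D(L₃(83)) = (4,3,3,1,4,2,1), i.e., deg_G(2)=4, deg_G(3)=3, deg_G(7)=3, deg_G(19)=1, deg_G(41)=4, deg_G(83)=2, deg_G(367)=1. Then G is isomorphic to L₃(83). -/

import Mathlib

open scoped MatrixGroups

/-- Two distinct primes `p` and `q` dividing `|G|` are adjacent in the prime graph `Γ(G)`
of a finite group `G` iff `G` has an element of order `p * q`. -/
def primeGraphAdj (G : Type*) [Group G] (p q : ℕ) : Prop :=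
  p ≠ q ∧ p.Prime ∧ q.Prime ∧ p ∣ Nat.card G ∧ q ∣ Nat.card G ∧ ∃ g : G, orderOf g = p * q

open scoped Classical in
/-- The degree of a vertex `p` in the prime graph of `G`: the number of primes dividing `|G|`
that are adjacent to `p`. -/
noncomputable def primeGraphDeg (G : Type*) [Group G] (p : ℕ) : ℕ :=
  ((Nat.card G).primeFactors.filter (fun r => primeGraphAdj G p r)).card


set_option linter.all false

namespace OD
section
variable {G : Type*} [Group G]

/-- conjugation action on subgroups -/
instance cjAction (G : Type*) [Group G] : MulAction G (Subgroup G) where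
  smul g S := S.map (MulAut.conj g).toMonoidHom
  one_smul S := by
    change S.map _ = S
    ext x; simp [Subgroup.mem_map]
  mul_smul g h S := by
    change S.map _ = (S.map _).map _
    rw [Subgroup.map_map]; congr 1; ext x; simp [mul_assoc]

theorem mem_cj {g x : G} {S : Subgroup G} : x ∈ g • S ↔ g⁻¹ * x * g ∈ S := by
  change x ∈ S.map _ ↔ _
  rw [Subgroup.mem_map]
  constructor
  · rintro ⟨y, hy, rfl⟩; simpa [mul_assoc] using hy
  · intro h; exact ⟨_, h, by simp [mul_assoc]⟩

theorem conj_mem_cj {g x : G} {S : Subgroup G} (h : x ∈ S) : g * x * g⁻¹ ∈ g • S := by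
  rw [mem_cj]; simpa [mul_assoc] using h

theorem card_cj (g : G) (S : Subgroup G) : Nat.card ↥(g • S) = Nat.card S := by
  change Nat.card (S.map _) = _
  exact Nat.card_congr (S.equivMapOfInjective _ (MulAut.conj g).injective).symm.toEquiv

theorem cj_mono {g : G} {S T : Subgroup G} (h : S ≤ T) : g • S ≤ g • T := by
  intro x; rw [mem_cj, mem_cj]; exact fun a => h a

theorem cj_le_iff {g : G} {S T : Subgroup G} : g • S ≤ T ↔ S ≤ g⁻¹ • T := by
  constructor
  · intro h; have := cj_mono (g := g⁻¹) h; rwa [inv_smul_smul] at this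
  · intro h; have := cj_mono (g := g) h; rwa [smul_inv_smul] at this

theorem cj_inf (g : G) (S T : Subgroup G) : g • (S ⊓ T) = g • S ⊓ g • T := by
  ext x; simp only [Subgroup.mem_inf, mem_cj]

/-- normalizer of a subgroup -/
abbrev Nm (S : Subgroup G) : Subgroup G := Subgroup.normalizer (S : Set G)
/-- centralizer of a subgroup -/
abbrev Ce (S : Subgroup G) : Subgroup G := Subgroup.centralizer (S : Set G)

theorem mem_Nm {g : G} {S : Subgroup G} : g ∈ Nm S ↔ g • S = S := by
  rw [Subgroup.mem_normalizer_iff]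
  constructor
  · intro h; ext x; rw [mem_cj]
    have := h (g⁻¹ * x * g)
    rw [this]; simp [mul_assoc]
  · intro h x
    conv_rhs => rw [← h]
    rw [mem_cj]; simp [mul_assoc]

theorem mem_Nm_conj {g : G} {S : Subgroup G} (h : g ∈ Nm S) {x : G} (hx : x ∈ S) :
    g * x * g⁻¹ ∈ S := by
  rw [mem_Nm] at h; rw [← h]; exact conj_mem_cj hx

theorem mem_Ce {g : G} {S : Subgroup G} : g ∈ Ce S ↔ ∀ x ∈ S, x * g = g * x := by
  rw [Subgroup.mem_centralizer_iff]; rfl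

theorem cj_eq_of_mem {g : G} {S : Subgroup G} (h : g ∈ S) : g • S = S := by
  rw [← mem_Nm]; exact Subgroup.le_normalizer h

theorem Ce_le_Nm (S : Subgroup G) : Ce S ≤ Nm S := by
  intro g hg; rw [mem_Nm]; ext x; rw [mem_cj]
  rw [mem_Ce] at hg
  constructor
  · intro h
    have h1 := hg _ h
    have : x = g⁻¹ * x * g := by
      have : g * (g⁻¹ * x * g) = x * g := by simp [mul_assoc]
      rw [this] at h1
      exact (mul_right_cancel h1).symm
    rwa [this]
  · intro h
    have : g⁻¹ * x * g = x := by rw [mul_assoc, hg x h]; simp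
    rwa [this]

theorem Nm_cj (g : G) (S : Subgroup G) : Nm (g • S) = g • Nm S := by
  ext x; rw [mem_cj, mem_Nm, mem_Nm, mul_smul, mul_smul, inv_smul_eq_iff]

theorem Ce_cj (g : G) (S : Subgroup G) : Ce (g • S) = g • Ce S := by
  ext x; rw [mem_cj, mem_Ce, mem_Ce]
  constructor
  · intro h y hy
    have := h _ (conj_mem_cj (g := g) hy)
    calc y * (g⁻¹ * x * g) = g⁻¹ * ((g * y * g⁻¹) * x) * g := by simp [mul_assoc]
      _ = _ := by rw [this]; simp [mul_assoc]
  · intro h y hy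
    rw [mem_cj] at hy
    have := h _ hy
    calc y * x = g * ((g⁻¹ * y * g) * (g⁻¹ * x * g)) * g⁻¹ := by simp [mul_assoc]
      _ = _ := by rw [this]; simp [mul_assoc]

theorem Ce_anti {S T : Subgroup G} (h : S ≤ T) : Ce T ≤ Ce S :=
  Subgroup.centralizer_le h

theorem Ce_symm {S T : Subgroup G} : S ≤ Ce T ↔ T ≤ Ce S := by
  rw [Subgroup.le_centralizer_iff]

theorem cj_le_of_le_Nm {H K : Subgroup G} (h : H ≤ Nm K) {g : G} (hg : g ∈ H) : g • K = K :=
  mem_Nm.1 (h hg)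

theorem Nm_le_Nm_Ce (S : Subgroup G) : Nm S ≤ Nm (Ce S) := by
  intro g hg; rw [mem_Nm] at *; rw [← Ce_cj, hg]

theorem stab_eq (S : Subgroup G) : MulAction.stabilizer G S = Nm S := by
  ext g; rw [MulAction.mem_stabilizer_iff, mem_Nm]

/-- `S` is a Sylow `p`-subgroup of the subgroup `H`. -/
def IsSyl (p : ℕ) (S H : Subgroup G) : Prop :=
  S ≤ H ∧ Nat.card S = p ^ (Nat.card H).factorization p

variable [Finite G] {p : ℕ} [hp : Fact p.Prime]

theorem IsSyl.pg {S H : Subgroup G} (h : IsSyl p S H) : IsPGroup p S := IsPGroup.of_card h.2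

theorem IsSyl.exists_le {Q H : Subgroup G} (hQ : Q ≤ H) (h : IsPGroup p Q) :
    ∃ S, IsSyl p S H ∧ Q ≤ S := by
  have h' : IsPGroup p (Q.subgroupOf H) := h.of_equiv (Subgroup.subgroupOfEquivOfLe hQ).symm
  obtain ⟨S, hS⟩ := h'.exists_le_sylow
  refine ⟨(S : Subgroup H).map H.subtype, ⟨Subgroup.map_subtype_le _, ?_⟩, ?_⟩
  · rw [Subgroup.card_subtype, S.card_eq_multiplicity]
  · have := Subgroup.map_mono (f := H.subtype) hS
    rwa [Subgroup.map_subgroupOf_eq_of_le hQ] at this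

theorem IsSyl.exists (p : ℕ) [Fact p.Prime] (H : Subgroup G) : ∃ S, IsSyl p S H := by
  obtain ⟨S, h, -⟩ := IsSyl.exists_le (p := p) (bot_le : ⊥ ≤ H) IsPGroup.of_bot
  exact ⟨S, h⟩

/-- the associated bundled Sylow subgroup -/
noncomputable def IsSyl.toSylow {S H : Subgroup G} (h : IsSyl p S H) : Sylow p H :=
  Sylow.ofCard (S.subgroupOf H) (by
    rw [Nat.card_congr (Subgroup.subgroupOfEquivOfLe h.1).toEquiv, h.2])

theorem IsSyl.coe_toSylow {S H : Subgroup G} (h : IsSyl p S H) :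
    (h.toSylow : Subgroup H) = S.subgroupOf H := rfl

theorem IsSyl.conj {S T H : Subgroup G} (hS : IsSyl p S H) (hT : IsSyl p T H) :
    ∃ h ∈ H, h • S = T := by
  obtain ⟨g, hg⟩ := MulAction.exists_smul_eq H hS.toSylow hT.toSylow
  refine ⟨g, g.2, ?_⟩
  have h1 : ∀ x : H, x ∈ T.subgroupOf H ↔ g⁻¹ * x * g ∈ S.subgroupOf H := by
    intro x
    rw [← hT.coe_toSylow, ← hg, ← hS.coe_toSylow]
    change x ∈ ((g • hS.toSylow : Sylow p H) : Subgroup H) ↔ _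
    rw [Sylow.smul_def, Sylow.pointwise_smul_def, Subgroup.mem_pointwise_smul_iff_inv_smul_mem]
    simp [MulAut.smul_def, ← map_inv]
  ext x
  rw [mem_cj]
  constructor
  · intro h
    have hx : x ∈ H := by
      have := H.mul_mem (H.mul_mem g.2 (hS.1 h)) (H.inv_mem g.2)
      simpa [mul_assoc] using this
    have := (h1 ⟨x, hx⟩).2 (by simpa [Subgroup.mem_subgroupOf] using h)
    simpa [Subgroup.mem_subgroupOf] using this
  · intro h
    have := (h1 ⟨x, hT.1 h⟩).1 (by simpa [Subgroup.mem_subgroupOf] using h)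
    simpa [Subgroup.mem_subgroupOf] using this

theorem IsSyl.cj {S H : Subgroup G} (hS : IsSyl p S H) (g : G) : IsSyl p (g • S) (g • H) :=
  ⟨cj_mono hS.1, by rw [card_cj, card_cj, hS.2]⟩

theorem IsSyl.cj_mem {S H : Subgroup G} (hS : IsSyl p S H) {g : G} (hg : g ∈ H) :
    IsSyl p (g • S) H := by
  have := hS.cj g; rwa [cj_eq_of_mem hg] at this

theorem IsSyl.mono {S H K : Subgroup G} (hS : IsSyl p S H) (h : S ≤ K) (hK : K ≤ H) :
    IsSyl p S K := by
  refine ⟨h, ?_⟩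
  have h1 : Nat.card S ∣ Nat.card K := Subgroup.card_dvd_of_le h
  have h2 : Nat.card K ∣ Nat.card H := Subgroup.card_dvd_of_le hK
  rw [hS.2] at *
  congr 1
  apply le_antisymm
  · exact (hp.out.pow_dvd_iff_le_factorization Nat.card_pos.ne').1 h1
  · exact (Nat.factorization_le_iff_dvd Nat.card_pos.ne' Nat.card_pos.ne').2 h2 p

/-- the set of Sylow `p`-subgroups of `H` -/
def Syls (p : ℕ) (H : Subgroup G) : Set (Subgroup G) := {S | IsSyl p S H}

theorem orbit_eq_Syls {S H : Subgroup G} (hS : IsSyl p S H) : MulAction.orbit H S = Syls p H := by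
  ext T; constructor
  · rintro ⟨g, rfl⟩
    exact hS.cj_mem g.2
  · intro hT
    obtain ⟨g, hg, h⟩ := hS.conj hT
    exact ⟨⟨g, hg⟩, h⟩

/-- orbit stabilizer for subgroups acting -/
theorem orb_stab {α : Type*} [MulAction G α] (H : Subgroup G) (a : α) :
    Nat.card H = (MulAction.orbit H a).ncard * Nat.card ↥(H ⊓ MulAction.stabilizer G a) := by
  have h1 := Nat.card_congr (MulAction.orbitProdStabilizerEquivGroup H a)
  rw [Nat.card_prod] at h1
  rw [← h1]
  congr 1
  apply Nat.card_congr
  refine ⟨fun x => ⟨x.1.1, x.1.2, x.2⟩, fun x => ⟨⟨x.1, x.2.1⟩, x.2.2⟩, fun x => rfl, fun x => rfl⟩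

theorem Syls_count {S H : Subgroup G} (hS : IsSyl p S H) :
    Nat.card H = (Syls p H).ncard * Nat.card ↥(H ⊓ Nm S) := by
  rw [← orbit_eq_Syls hS, orb_stab H S, stab_eq]

theorem Syls_equiv (H : Subgroup G) : (Syls p H).ncard = Nat.card (Sylow p H) := by
  apply Nat.card_congr
  refine ⟨fun S => IsSyl.toSylow (S := S.1) S.2, fun S => ⟨(S : Subgroup H).map H.subtype, ⟨Subgroup.map_subtype_le _, ?_⟩⟩, ?_, ?_⟩
  · rw [Subgroup.card_subtype, S.card_eq_multiplicity]
  · intro S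
    apply Subtype.ext
    change (Subgroup.map H.subtype (S.1.subgroupOf H)) = _
    exact Subgroup.map_subgroupOf_eq_of_le S.2.1
  · intro S
    apply Sylow.ext
    change ((S : Subgroup H).map H.subtype).subgroupOf H = _
    exact Subgroup.comap_map_eq_self_of_injective H.subtype_injective _

theorem Syls_mod (p : ℕ) [hp : Fact p.Prime] (H : Subgroup G) : (Syls p H).ncard % p = 1 := by
  rw [Syls_equiv]
  have := card_sylow_modEq_one p H
  unfold Nat.ModEq at this
  rwa [Nat.mod_eq_of_lt hp.out.one_lt] at this

/-- Frattini -/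
theorem frattini {S K H : Subgroup G} (hS : IsSyl p S K) (hK : K ≤ H) (hn : H ≤ Nm K) :
    Nat.card H * Nat.card ↥(K ⊓ Nm S) = Nat.card K * Nat.card ↥(H ⊓ Nm S) := by
  have h1 : MulAction.orbit H S = MulAction.orbit K S := by
    apply le_antisymm
    · rw [orbit_eq_Syls hS]
      rintro _ ⟨g, rfl⟩
      have := hS.cj g.1
      rw [mem_Nm.1 (hn g.2)] at this
      exact this
    · rintro _ ⟨g, rfl⟩
      exact ⟨⟨g.1, hK g.2⟩, rfl⟩
  have h2 := orb_stab H S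
  have h3 := orb_stab K S
  rw [stab_eq] at h2 h3
  rw [h2, h3, h1]; ring

theorem frattini_dvd {S K H : Subgroup G} (hS : IsSyl p S K) (hK : K ≤ H) (hn : H ≤ Nm K) :
    Nat.card H ∣ Nat.card K * Nat.card ↥(H ⊓ Nm S) := ⟨_, (frattini hS hK hn).symm⟩

/-- unique Sylow -/
theorem IsSyl.le_of_normal {S Q H : Subgroup G} (hS : IsSyl p S H) (hn : H ≤ Nm S)
    (hQ : Q ≤ H) (h : IsPGroup p Q) : Q ≤ S := by
  obtain ⟨T, hT, hQT⟩ := IsSyl.exists_le hQ h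
  obtain ⟨g, hg, rfl⟩ := hS.conj hT
  rwa [mem_Nm.1 (hn hg)] at hQT

theorem normal_of_Syls_one {S H : Subgroup G} (hS : IsSyl p S H) (h : (Syls p H).ncard = 1) :
    H ≤ Nm S := by
  have h1 := Syls_count hS
  rw [h, one_mul] at h1
  have : H ⊓ Nm S = H := Subgroup.eq_of_le_of_card_ge inf_le_left h1.le
  rw [← this]; exact inf_le_right

/-- fixed points of a p-group acting on a subgroup by conjugation -/
theorem fix_mod {R K : Subgroup G} (hR : IsPGroup p R) (h : R ≤ Nm K) :
    Nat.card K ≡ Nat.card ↥(K ⊓ Ce R) [MOD p] := by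
  letI : MulAction R K :=
    { smul := fun r k => ⟨r * k * (r : G)⁻¹, mem_Nm_conj (h r.2) k.2⟩
      one_smul := fun k => by apply Subtype.ext; change (1:G) * k * (1:G)⁻¹ = k; simp
      mul_smul := fun r s k => by
        apply Subtype.ext
        change (r * s : G) * k * (r * s : G)⁻¹ = r * (s * k * (s : G)⁻¹) * (r : G)⁻¹
        simp [mul_assoc] }
  have := hR.card_modEq_card_fixedPoints K
  refine this.trans ?_
  apply Eq.symm ∘ congrArg (· % p)
  symm
  apply Nat.card_congr
  refine ⟨fun k => ⟨k.1.1, k.1.2, ?_⟩, fun k => ⟨⟨k.1, k.2.1⟩, ?_⟩, fun x => rfl, fun x => rfl⟩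
  · have hk := k.2
    refine mem_Ce.2 ?_
    intro r hr
    have h1 := congrArg Subtype.val (hk ⟨r, hr⟩)
    change r * k.1.1 * r⁻¹ = k.1.1 at h1
    exact mul_inv_eq_iff_eq_mul.1 h1
  · intro r
    apply Subtype.ext
    change (r : G) * k.1 * (r : G)⁻¹ = k.1
    rw [mul_inv_eq_iff_eq_mul]
    exact mem_Ce.1 k.2.2 r r.2

theorem exists_sub_card {H : Subgroup G} {n : ℕ} (h : p ^ n ∣ Nat.card H) :
    ∃ S ≤ H, Nat.card S = p ^ n := by
  obtain ⟨K, hK⟩ := Sylow.exists_subgroup_card_pow_prime p h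
  exact ⟨K.map H.subtype, Subgroup.map_subtype_le _, by rw [Subgroup.card_subtype, hK]⟩

theorem exists_sub_card1 (p : ℕ) [Fact p.Prime] {H : Subgroup G} (h : p ∣ Nat.card H) :
    ∃ S ≤ H, Nat.card S = p := by
  obtain ⟨K, h1, hK⟩ := exists_sub_card (p := p) (n := 1) (by simpa using h)
  exact ⟨K, h1, by simpa using hK⟩

theorem pg_of_card {S : Subgroup G} (h : Nat.card S = p) : IsPGroup p S :=
  IsPGroup.of_card (n := 1) (by simpa using h)

/-- N/C for groups of prime order -/
theorem NC {P : Subgroup G} (h : Nat.card P = p) :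
    ∃ e, e ∣ p - 1 ∧ Nat.card ↥(Nm P) = Nat.card ↥(Ce P) * e := by
  have hc : IsCyclic P := isCyclic_of_prime_card h
  have h1 := Subgroup.normalizerMonoidHom_ker P
  have h2 := Subgroup.card_mul_index (Subgroup.normalizerMonoidHom P).ker
  rw [Subgroup.index_ker] at h2
  refine ⟨Nat.card (Subgroup.normalizerMonoidHom P).range, ?_, h2.symm.trans ?_⟩
  · have h3 := Subgroup.card_subgroup_dvd_card (Subgroup.normalizerMonoidHom P).range
    rw [IsCyclic.card_mulAut, h, Nat.totient_prime hp.out] at h3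
    exact h3
  · congr 1
    rw [h1]
    exact Nat.card_congr (Subgroup.subgroupOfEquivOfLe (Ce_le_Nm P)).toEquiv

end
end OD

set_option linter.all false

namespace OD
section
instance f7 : Fact (Nat.Prime 7) := ⟨by norm_num⟩
instance f19 : Fact (Nat.Prime 19) := ⟨by norm_num⟩
instance f41 : Fact (Nat.Prime 41) := ⟨by norm_num⟩
instance f83 : Fact (Nat.Prime 83) := ⟨by norm_num⟩
instance f367 : Fact (Nat.Prime 367) := ⟨by norm_num⟩

variable {G : Type*} [Group G] [Finite G] {p : ℕ} [hp : Fact p.Prime]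

/-- Burnside normal complement inside a subgroup -/
theorem burnside {P H : Subgroup G} (hP : IsSyl p P H) (h : H ⊓ Nm P ≤ Ce P) :
    ∃ M ≤ H, H ≤ Nm M ∧ Nat.card M * Nat.card P = Nat.card H := by
  have h' : Subgroup.normalizer ((hP.toSylow : Subgroup H) : Set H) ≤
      Subgroup.centralizer ((hP.toSylow : Subgroup H) : Set H) := by
    intro x hx
    have h1 : (x : G) ∈ Ce P := by
      apply h
      refine ⟨x.2, ?_⟩
      rw [Subgroup.mem_normalizer_iff] at hx
      refine Subgroup.mem_normalizer_iff.2 ?_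
      intro y
      constructor
      · intro hy
        exact ((hx ⟨y, hP.1 hy⟩).1 hy)
      · intro hy
        have hyH : y ∈ H := by
          have := H.mul_mem (H.mul_mem (H.inv_mem x.2) (hP.1 hy)) x.2
          simpa [mul_assoc] using this
        exact ((hx ⟨y, hyH⟩).2 hy)
    rw [mem_Ce] at h1
    rw [Subgroup.mem_centralizer_iff]
    intro y hy
    exact Subtype.ext (h1 y hy)
  have hc := MonoidHom.ker_transferSylow_isComplement' hP.toSylow h'
  have h2 := hc.card_mul_card
  refine ⟨((MonoidHom.transferSylow hP.toSylow h').ker).map H.subtype, Subgroup.map_subtype_le _, ?_, ?_⟩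
  · intro g hg
    rw [mem_Nm]
    have key : ∀ g ∈ H, ∀ x, x ∈ ((MonoidHom.transferSylow hP.toSylow h').ker).map H.subtype →
        g * x * g⁻¹ ∈ ((MonoidHom.transferSylow hP.toSylow h').ker).map H.subtype := by
      rintro g hg _ ⟨y, hy, rfl⟩
      refine ⟨⟨g, hg⟩ * y * ⟨g, hg⟩⁻¹, ?_, rfl⟩
      exact (MonoidHom.normal_ker _).conj_mem _ hy _
    ext x
    rw [mem_cj]
    constructor
    · intro hx
      have := key g hg _ hx
      simpa [mul_assoc] using this
    · intro hx
      have := key g⁻¹ (H.inv_mem hg) _ hx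
      simpa [mul_assoc] using this
  · rw [Subgroup.card_subtype]
    have h3 : Nat.card P = Nat.card (hP.toSylow : Subgroup H) :=
      (Nat.card_congr (Subgroup.subgroupOfEquivOfLe hP.1).toEquiv).symm
    rw [h3]; exact h2

/-- edge of the prime graph, elementwise -/
def Ad (G : Type*) [Group G] (p q : ℕ) : Prop := ∃ g : G, orderOf g = p * q

theorem ad_of_comm {p q : ℕ} [hp : Fact p.Prime] [hq : Fact q.Prime] (hpq : p ≠ q)
    {A B : Subgroup G} (hA : p ∣ Nat.card A) (hB : q ∣ Nat.card B) (h : B ≤ Ce A) : Ad G p q := by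
  obtain ⟨a, ha⟩ := exists_prime_orderOf_dvd_card' p hA
  obtain ⟨b, hb⟩ := exists_prime_orderOf_dvd_card' q hB
  refine ⟨a * b, ?_⟩
  have hc : Commute (a : G) b := mem_Ce.1 (h b.2) a a.2
  rw [← Subgroup.orderOf_coe] at ha hb
  rw [hc.orderOf_mul_eq_mul_orderOf_of_coprime, ha, hb]
  rw [ha, hb]
  exact (Nat.coprime_primes hp.out hq.out).2 hpq

theorem ad_exists {p q : ℕ} [hp : Fact p.Prime] [hq : Fact q.Prime] (h : Ad G p q) :
    ∃ A : Subgroup G, Nat.card A = p ∧ q ∣ Nat.card ↥(Ce A) := by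
  obtain ⟨g, hg⟩ := h
  have h1 : orderOf (g ^ q) = p := by
    rw [orderOf_pow' g hq.out.ne_zero, hg, Nat.gcd_mul_left_left, Nat.mul_div_cancel _ hq.out.pos]
  have h2 : orderOf (g ^ p) = q := by
    rw [orderOf_pow' g hp.out.ne_zero, hg, Nat.gcd_mul_right_left, Nat.mul_div_cancel_left _ hp.out.pos]
  refine ⟨Subgroup.zpowers (g ^ q), by rw [Nat.card_zpowers, h1], ?_⟩
  have h3 : g ^ p ∈ Ce (Subgroup.zpowers (g ^ q)) := by
    rw [mem_Ce]
    rintro _ ⟨k, rfl⟩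
    exact (((Commute.refl g).pow_pow q p).zpow_left k)
  have := orderOf_dvd_natCard (⟨g ^ p, h3⟩ : ↥(Ce (Subgroup.zpowers (g ^ q))))
  rwa [← Subgroup.orderOf_coe, h2] at this

theorem ad_symm {p q : ℕ} (h : Ad G p q) : Ad G q p := by
  obtain ⟨g, hg⟩ := h; exact ⟨g, by rw [hg, mul_comm]⟩

theorem dvd_form {n : ℕ} (h : n ∣ 2 ^ 4 * 3 * 7 * 19 * 41 ^ 2 * 83 ^ 3 * 367) :
    ∃ a b c d e f g, a ≤ 4 ∧ b ≤ 1 ∧ c ≤ 1 ∧ d ≤ 1 ∧ e ≤ 2 ∧ f ≤ 3 ∧ g ≤ 1 ∧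
    n = 2 ^ a * 3 ^ b * 7 ^ c * 19 ^ d * 41 ^ e * 83 ^ f * 367 ^ g := by
  obtain ⟨n0, x, hn0, hx, rfl⟩ := Nat.dvd_mul.1 h
  obtain ⟨n1, y, hn1, hy, rfl⟩ := Nat.dvd_mul.1 hn0
  obtain ⟨n2, z, hn2, hz, rfl⟩ := Nat.dvd_mul.1 hn1
  obtain ⟨n3, u, hn3, hu, rfl⟩ := Nat.dvd_mul.1 hn2
  obtain ⟨n4, v, hn4, hv, rfl⟩ := Nat.dvd_mul.1 hn3
  obtain ⟨n5, w, hn5, hw, rfl⟩ := Nat.dvd_mul.1 hn4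
  obtain ⟨a, ha, rfl⟩ := (Nat.dvd_prime_pow Nat.prime_two).1 hn5
  obtain ⟨b, hb, rfl⟩ := (Nat.dvd_prime_pow (m := 1) Nat.prime_three).1 (by simpa using hw)
  obtain ⟨c, hc, rfl⟩ := (Nat.dvd_prime_pow (m := 1) f7.out).1 (by simpa using hv)
  obtain ⟨d, hd, rfl⟩ := (Nat.dvd_prime_pow (m := 1) f19.out).1 (by simpa using hu)
  obtain ⟨e, he, rfl⟩ := (Nat.dvd_prime_pow f41.out).1 hz
  obtain ⟨f, hf, rfl⟩ := (Nat.dvd_prime_pow f83.out).1 hy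
  obtain ⟨g, hg, rfl⟩ := (Nat.dvd_prime_pow (m := 1) f367.out).1 (by simpa using hx)
  exact ⟨a, b, c, d, e, f, g, ha, hb, hc, hd, he, hf, hg, rfl⟩

/-- the order -/
abbrev NN : ℕ := 2 ^ 4 * 3 * 7 * 19 * 41 ^ 2 * 83 ^ 3 * 367

theorem exp_zero {p a m n : ℕ} (hn : n = p ^ a * m) (h : ¬ p ∣ n) : a = 0 := by
  by_contra ha
  exact h (hn ▸ (dvd_pow_self p ha).mul_right m)

theorem exp_pos {p a m n : ℕ} (hp : p.Prime) (hn : n = p ^ a * m) (h : p ∣ n) (hm : ¬ p ∣ m) : 1 ≤ a := by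
  by_contra ha
  have : a = 0 := by omega
  subst this
  simp at hn; subst hn; exact hm h

theorem dvd_form' {n : ℕ} (h : n ∣ NN) :
    ∃ a b c d e f g, a ≤ 4 ∧ b ≤ 1 ∧ c ≤ 1 ∧ d ≤ 1 ∧ e ≤ 2 ∧ f ≤ 3 ∧ g ≤ 1 ∧
    n = 2 ^ a * 3 ^ b * 7 ^ c * 19 ^ d * 41 ^ e * 83 ^ f * 367 ^ g ∧
    (¬ 2 ∣ n → a = 0) ∧ (¬ 3 ∣ n → b = 0) ∧ (¬ 7 ∣ n → c = 0) ∧ (¬ 19 ∣ n → d = 0) ∧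
    (¬ 41 ∣ n → e = 0) ∧ (¬ 83 ∣ n → f = 0) ∧ (¬ 367 ∣ n → g = 0) := by
  obtain ⟨a, b, c, d, e, f, g, ha, hb, hc, hd, he, hf, hg, rfl⟩ := dvd_form h
  refine ⟨a, b, c, d, e, f, g, ha, hb, hc, hd, he, hf, hg, rfl, ?_, ?_, ?_, ?_, ?_, ?_, ?_⟩
  · exact exp_zero (m := 3 ^ b * 7 ^ c * 19 ^ d * 41 ^ e * 83 ^ f * 367 ^ g) (by ring)
  · exact exp_zero (m := 2 ^ a * 7 ^ c * 19 ^ d * 41 ^ e * 83 ^ f * 367 ^ g) (by ring)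
  · exact exp_zero (m := 2 ^ a * 3 ^ b * 19 ^ d * 41 ^ e * 83 ^ f * 367 ^ g) (by ring)
  · exact exp_zero (m := 2 ^ a * 3 ^ b * 7 ^ c * 41 ^ e * 83 ^ f * 367 ^ g) (by ring)
  · exact exp_zero (m := 2 ^ a * 3 ^ b * 7 ^ c * 19 ^ d * 83 ^ f * 367 ^ g) (by ring)
  · exact exp_zero (m := 2 ^ a * 3 ^ b * 7 ^ c * 19 ^ d * 41 ^ e * 367 ^ g) (by ring)
  · exact exp_zero (m := 2 ^ a * 3 ^ b * 7 ^ c * 19 ^ d * 41 ^ e * 83 ^ f) (by ring)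

theorem div366 {e : ℕ} (h : e ∣ 366) : e = 1 ∨ e = 2 ∨ e = 3 ∨ e = 6 ∨ e = 61 ∨ e = 122 ∨ e = 183 ∨ e = 366 := by
  have : e ∈ Nat.divisors 366 := by simpa using h
  have h2 : Nat.divisors 366 = {1,2,3,6,61,122,183,366} := by decide +kernel
  rw [h2] at this
  simpa using this

open scoped Classical in
/-- indicator of an edge -/
noncomputable def ind (G : Type*) [Group G] (p q : ℕ) : ℕ := if Ad G p q then 1 else 0

theorem ind_symm (p q : ℕ) : ind G p q = ind G q p := by
  unfold ind
  have : Ad G p q ↔ Ad G q p := ⟨ad_symm, ad_symm⟩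
  by_cases h : Ad G p q
  · rw [if_pos h, if_pos (this.1 h)]
  · rw [if_neg h, if_neg (fun h' => h (this.2 h'))]

theorem ind_le (p q : ℕ) : ind G p q ≤ 1 := by unfold ind; split <;> omega
theorem ind_one {p q : ℕ} : ind G p q = 1 ↔ Ad G p q := by unfold ind; split <;> simp_all

theorem deg_ind (hcard : Nat.card G = NN) {p : ℕ} (hp : p ∈ ({2,3,7,19,41,83,367} : Finset ℕ)) :
    primeGraphDeg G p = ∑ q ∈ ({2,3,7,19,41,83,367} : Finset ℕ), if p = q then 0 else ind G p q := by
  have hf : (Nat.card G).primeFactors = {2,3,7,19,41,83,367} := by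
    rw [hcard]
    ext q
    rw [Nat.mem_primeFactors]
    constructor
    · rintro ⟨h1, h2, -⟩
      have := h1
      simp only [NN, h1.dvd_mul] at h2
      have e : ∀ r k, r.Prime → q ∣ r ^ k → q = r := fun r k hr h =>
        (Nat.prime_dvd_prime_iff_eq h1 hr).1 (h1.dvd_of_dvd_pow h)
      have e1 : ∀ r, r.Prime → q ∣ r → q = r := fun r hr h => (Nat.prime_dvd_prime_iff_eq h1 hr).1 h
      simp only [Finset.mem_insert, Finset.mem_singleton]
      rcases h2 with (((((h | h) | h) | h) | h) | h) | h
      · have := e 2 4 (by norm_num) h; omega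
      · have := e1 3 (by norm_num) h; omega
      · have := e1 7 (by norm_num) h; omega
      · have := e1 19 (by norm_num) h; omega
      · have := e 41 2 (by norm_num) h; omega
      · have := e 83 3 (by norm_num) h; omega
      · have := e1 367 (by norm_num) h; omega
    · intro h
      simp only [Finset.mem_insert, Finset.mem_singleton] at h
      rcases h with rfl | rfl | rfl | rfl | rfl | rfl | rfl <;> norm_num [NN]
  unfold primeGraphDeg
  rw [Finset.card_filter, hf]
  apply Finset.sum_congr rfl
  intro q hq
  rw [← hf, Nat.mem_primeFactors] at hq hp
  by_cases hpq : p = q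
  · simp [primeGraphAdj, hpq]
  · rw [if_neg hpq]
    unfold ind
    by_cases h : Ad G p q
    · rw [if_pos h, if_pos ⟨hpq, hp.1, hq.1, hp.2.1, hq.2.1, h⟩]
    · rw [if_neg h, if_neg (fun h' => h h'.2.2.2.2.2)]

theorem sub_dvd (hcard : Nat.card G = NN) (H : Subgroup G) : Nat.card H ∣ NN := by
  rw [← hcard]; exact Subgroup.card_subgroup_dvd_card H

theorem card_top' : Nat.card (⊤ : Subgroup G) = Nat.card G := Subgroup.card_top

theorem pick {i2 i3 i7 i19 i41 i83 a b c' d e' f : ℕ} (h : i2 + i3 + i7 + i19 + i41 + i83 = 1)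
   (r2 : i2 = 1 ∨ a = 0) (r3 : i3 = 1 ∨ b = 0) (r7 : i7 = 1 ∨ c' = 0) (r19 : i19 = 1 ∨ d = 0) (r41 : i41 = 1 ∨ e' = 0) (r83 : i83 = 1 ∨ f = 0) :
    (b = 0 ∧ c' = 0 ∧ d = 0 ∧ e' = 0 ∧ f = 0) ∨ (a = 0 ∧ c' = 0 ∧ d = 0 ∧ e' = 0 ∧ f = 0) ∨
     (a = 0 ∧ b = 0 ∧ d = 0 ∧ e' = 0 ∧ f = 0) ∨ (a = 0 ∧ b = 0 ∧ c' = 0 ∧ e' = 0 ∧ f = 0) ∨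
     (a = 0 ∧ b = 0 ∧ c' = 0 ∧ d = 0 ∧ f = 0) ∨ (a = 0 ∧ b = 0 ∧ c' = 0 ∧ d = 0 ∧ e' = 0) := by
  by_cases t2 : i2 = 1
  · exact Or.inl ⟨r3.resolve_left (by clear r2 r3 r7 r19 r41 r83; omega), r7.resolve_left (by clear r2 r3 r7 r19 r41 r83; omega), r19.resolve_left (by clear r2 r3 r7 r19 r41 r83; omega), r41.resolve_left (by clear r2 r3 r7 r19 r41 r83; omega), r83.resolve_left (by clear r2 r3 r7 r19 r41 r83; omega)⟩
  by_cases t3 : i3 = 1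
  · exact Or.inr (Or.inl ⟨r2.resolve_left (by clear r2 r3 r7 r19 r41 r83; omega), r7.resolve_left (by clear r2 r3 r7 r19 r41 r83; omega), r19.resolve_left (by clear r2 r3 r7 r19 r41 r83; omega), r41.resolve_left (by clear r2 r3 r7 r19 r41 r83; omega), r83.resolve_left (by clear r2 r3 r7 r19 r41 r83; omega)⟩)
  by_cases t7 : i7 = 1
  · exact Or.inr (Or.inr (Or.inl ⟨r2.resolve_left (by clear r2 r3 r7 r19 r41 r83; omega), r3.resolve_left (by clear r2 r3 r7 r19 r41 r83; omega), r19.resolve_left (by clear r2 r3 r7 r19 r41 r83; omega), r41.resolve_left (by clear r2 r3 r7 r19 r41 r83; omega), r83.resolve_left (by clear r2 r3 r7 r19 r41 r83; omega)⟩))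
  by_cases t19 : i19 = 1
  · exact Or.inr (Or.inr (Or.inr (Or.inl ⟨r2.resolve_left (by clear r2 r3 r7 r19 r41 r83; omega), r3.resolve_left (by clear r2 r3 r7 r19 r41 r83; omega), r7.resolve_left (by clear r2 r3 r7 r19 r41 r83; omega), r41.resolve_left (by clear r2 r3 r7 r19 r41 r83; omega), r83.resolve_left (by clear r2 r3 r7 r19 r41 r83; omega)⟩)))
  by_cases t41 : i41 = 1
  · exact Or.inr (Or.inr (Or.inr (Or.inr (Or.inl ⟨r2.resolve_left (by clear r2 r3 r7 r19 r41 r83; omega), r3.resolve_left (by clear r2 r3 r7 r19 r41 r83; omega), r7.resolve_left (by clear r2 r3 r7 r19 r41 r83; omega), r19.resolve_left (by clear r2 r3 r7 r19 r41 r83; omega), r83.resolve_left (by clear r2 r3 r7 r19 r41 r83; omega)⟩))))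
  exact Or.inr (Or.inr (Or.inr (Or.inr (Or.inr (⟨r2.resolve_left (by clear r2 r3 r7 r19 r41 r83; omega), r3.resolve_left (by clear r2 r3 r7 r19 r41 r83; omega), r7.resolve_left (by clear r2 r3 r7 r19 r41 r83; omega), r19.resolve_left (by clear r2 r3 r7 r19 r41 r83; omega), r41.resolve_left (by clear r2 r3 r7 r19 r41 r83; omega)⟩)))))

theorem s2_arith {n c e a b c' d e' f : ℕ} (h2 : NN = n * (c * e)) (h3 : n % 367 = 1)
   (ha : a ≤ 4) (hb : b ≤ 1) (hc : c' ≤ 1) (hd : d ≤ 1) (he' : e' ≤ 2) (hf : f ≤ 3)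
   (hcc : c = 2 ^ a * 3 ^ b * 7 ^ c' * 19 ^ d * 41 ^ e' * 83 ^ f * 367 ^ 1) (he : e ∣ 366)
   (main : (b = 0 ∧ c' = 0 ∧ d = 0 ∧ e' = 0 ∧ f = 0) ∨ (a = 0 ∧ c' = 0 ∧ d = 0 ∧ e' = 0 ∧ f = 0) ∨
     (a = 0 ∧ b = 0 ∧ d = 0 ∧ e' = 0 ∧ f = 0) ∨ (a = 0 ∧ b = 0 ∧ c' = 0 ∧ e' = 0 ∧ f = 0) ∨
     (a = 0 ∧ b = 0 ∧ c' = 0 ∧ d = 0 ∧ f = 0) ∨ (a = 0 ∧ b = 0 ∧ c' = 0 ∧ d = 0 ∧ e' = 0)) : c = 19 * 367 ∧ c * e = 3 * 19 * 367 := by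
  have he := div366 he
  norm_num [NN] at h2
  have key : ∀ k, c = k → (k = 367 ∨ k = 2 * 367 ∨ k = 4 * 367 ∨ k = 8 * 367 ∨ k = 16 * 367 ∨ k = 3 * 367 ∨ 
    k = 7 * 367 ∨ k = 19 * 367 ∨ k = 41 * 367 ∨ k = 1681 * 367 ∨ k = 83 * 367 ∨ k = 83 ^ 2 * 367 ∨ k = 83 ^ 3 * 367) := by
    rintro k rfl
    clear h2 h3 he
    rcases main with ⟨rfl, rfl, rfl, rfl, rfl⟩ | ⟨rfl, rfl, rfl, rfl, rfl⟩ | ⟨rfl, rfl, rfl, rfl, rfl⟩ |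
      ⟨rfl, rfl, rfl, rfl, rfl⟩ | ⟨rfl, rfl, rfl, rfl, rfl⟩ | ⟨rfl, rfl, rfl, rfl, rfl⟩
    · interval_cases a <;> subst hcc <;> norm_num
    · interval_cases b <;> subst hcc <;> norm_num
    · interval_cases c' <;> subst hcc <;> norm_num
    · interval_cases d <;> subst hcc <;> norm_num
    · interval_cases e' <;> subst hcc <;> norm_num
    · interval_cases f <;> subst hcc <;> norm_num
  have key := key c rfl
  clear hcc ha hb hc hd he' hf main
  rcases key with rfl | rfl | rfl | rfl | rfl | rfl | rfl | rfl | rfl | rfl | rfl | rfl | rfl <;>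
    (rcases he with rfl | rfl | rfl | rfl | rfl | rfl | rfl | rfl <;> norm_num at h2 ⊢ <;> omega)

/-- S2 -/
theorem S2 (hcard : Nat.card G = NN)
    (h1 : ind G 367 2 + ind G 367 3 + ind G 367 7 + ind G 367 19 + ind G 367 41 + ind G 367 83 = 1)
    {P : Subgroup G} (hP : Nat.card P = 367) :
    Nat.card ↥(Ce P) = 19 * 367 ∧ Nat.card ↥(Nm P) = 3 * 19 * 367 := by
  obtain ⟨e, he, hN⟩ := NC hP
  have hS : IsSyl 367 P ⊤ := by
    refine ⟨le_top, ?_⟩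
    rw [hP, card_top', hcard]
    have : Nat.factorization NN 367 = 1 := by
      have : NN = 367 ^ 1 * (2 ^ 4 * 3 * 7 * 19 * 41 ^ 2 * 83 ^ 3) := by norm_num [NN]
      rw [this, Nat.factorization_mul (by norm_num) (by norm_num), f367.out.factorization_pow]
      simp
      apply Nat.factorization_eq_zero_of_not_dvd
      norm_num
    rw [this]; norm_num
  have h2 := Syls_count hS
  have h3 := Syls_mod 367 (⊤ : Subgroup G)
  rw [top_inf_eq, card_top', hcard, hN] at h2
  generalize (Syls 367 (⊤ : Subgroup G)).ncard = n at h2 h3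
  have h4 : 367 ∣ Nat.card ↥(Ce P) := by
    rw [← hP]
    apply Subgroup.card_dvd_of_le
    haveI : IsCyclic P := isCyclic_of_prime_card hP
    exact Subgroup.le_centralizer P
  have key : ∀ r, r.Prime → r ≠ 367 → r ∣ Nat.card ↥(Ce P) → ind G 367 r = 1 := by
    intro r hr h h'
    haveI : Fact r.Prime := ⟨hr⟩
    rw [ind_one]
    exact ad_of_comm h.symm (A := P) (by rw [hP]) h' le_rfl
  have k2 := key 2 (by norm_num) (by norm_num)
  have k3 := key 3 (by norm_num) (by norm_num)
  have k7 := key 7 (by norm_num) (by norm_num)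
  have k19 := key 19 (by norm_num) (by norm_num)
  have k41 := key 41 (by norm_num) (by norm_num)
  have k83 := key 83 (by norm_num) (by norm_num)
  have hcN : Nat.card ↥(Ce P) ∣ NN := sub_dvd hcard _
  rw [hN]
  clear hN key hS
  generalize Nat.card ↥(Ce P) = c at *
  obtain ⟨a, b, c', d, e', f, g, ha, hb, hc, hd, he', hf, hg, hcc, z2, z3, z7, z19, z41, z83, z367⟩ := dvd_form' hcN
  have hg1 : g = 1 := by
    have := exp_pos (p := 367) (a := g) (m := 2 ^ a * 3 ^ b * 7 ^ c' * 19 ^ d * 41 ^ e' * 83 ^ f) (by norm_num)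
      (hcc.trans (by ring)) h4 (by
        clear k2 k3 k7 k19 k41 k83 z2 z3 z7 z19 z41 z83 z367 hcc h2 h3
        intro h
        simp only [f367.out.dvd_mul] at h
        have e : ∀ r k, r.Prime → 367 ∣ r ^ k → 367 = r := fun r k hr h =>
          (Nat.prime_dvd_prime_iff_eq f367.out hr).1 (f367.out.dvd_of_dvd_pow h)
        rcases h with ((((h | h) | h) | h) | h) | h
        · have := e 2 _ (by norm_num) h; omega
        · have := e 3 _ (by norm_num) h; omega
        · have := e 7 _ (by norm_num) h; omega
        · have := e 19 _ (by norm_num) h; omega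
        · have := e 41 _ (by norm_num) h; omega
        · have := e 83 _ (by norm_num) h; omega)
    exact le_antisymm hg this
  subst hg1
  have r2 : ind G 367 2 = 1 ∨ a = 0 := (Classical.em _).imp k2 z2
  have r3 : ind G 367 3 = 1 ∨ b = 0 := (Classical.em _).imp k3 z3
  have r7 : ind G 367 7 = 1 ∨ c' = 0 := (Classical.em _).imp k7 z7
  have r19 : ind G 367 19 = 1 ∨ d = 0 := (Classical.em _).imp k19 z19
  have r41 : ind G 367 41 = 1 ∨ e' = 0 := (Classical.em _).imp k41 z41
  have r83 : ind G 367 83 = 1 ∨ f = 0 := (Classical.em _).imp k83 z83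
  exact s2_arith h2 h3 ha hb hc hd he' hf hcc he (pick h1 r2 r3 r7 r19 r41 r83)

/-- Consequences of the hypotheses. -/
structure Hyp (G : Type*) [Group G] : Prop where
  card : Nat.card G = NN
  C367 : ∀ P : Subgroup G, Nat.card P = 367 → Nat.card ↥(Ce P) = 19 * 367 ∧ Nat.card ↥(Nm P) = 3 * 19 * 367
  na19 : ∀ r, r = 2 ∨ r = 3 ∨ r = 7 ∨ r = 41 ∨ r = 83 → ¬ Ad G 19 r
  na367 : ∀ r, r = 2 ∨ r = 3 ∨ r = 7 ∨ r = 41 ∨ r = 83 → ¬ Ad G 367 r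
  na3 : ¬ Ad G 3 83
  na7 : ¬ Ad G 7 83
  a72 : Ad G 7 2
  a73 : Ad G 7 3
  a741 : Ad G 7 41
  a4183 : Ad G 41 83

theorem hyp_arith {x2_3 x2_7 x2_19 x2_41 x2_83 x2_367 x3_7 x3_19 x3_41 x3_83 x3_367 x7_19 x7_41 x7_83 x7_367 x19_41 x19_83 x19_367 x41_83 x41_367 x83_367 : ℕ}
    (h2 : x2_3 + x2_7 + x2_19 + x2_41 + x2_83 + x2_367 = 4)
    (h3 : x2_3 + x3_7 + x3_19 + x3_41 + x3_83 + x3_367 = 3)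
    (h7 : x2_7 + x3_7 + x7_19 + x7_41 + x7_83 + x7_367 = 3)
    (h19 : x2_19 + x3_19 + x7_19 + x19_41 + x19_83 + x19_367 = 1)
    (h41 : x2_41 + x3_41 + x7_41 + x19_41 + x41_83 + x41_367 = 4)
    (h83 : x2_83 + x3_83 + x7_83 + x19_83 + x41_83 + x83_367 = 2)
    (h367 : x2_367 + x3_367 + x7_367 + x19_367 + x41_367 + x83_367 = 1)
    (e : x19_367 = 1)
    (l2_3 : x2_3 ≤ 1) (l2_7 : x2_7 ≤ 1) (l2_41 : x2_41 ≤ 1) (l2_83 : x2_83 ≤ 1) (l3_41 : x3_41 ≤ 1) (l7_41 : x7_41 ≤ 1) (l41_83 : x41_83 ≤ 1) (l3_7 : x3_7 ≤ 1) :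
    x2_19 = 0 ∧ x3_19 = 0 ∧ x7_19 = 0 ∧ x19_41 = 0 ∧ x19_83 = 0 ∧ x2_367 = 0 ∧ x3_367 = 0 ∧ x7_367 = 0 ∧ x41_367 = 0 ∧ x83_367 = 0 ∧ x3_83 = 0 ∧ x7_83 = 0 ∧ x2_7 = 1 ∧ x3_7 = 1 ∧ x7_41 = 1 ∧ x41_83 = 1 := by
  have z : ∀ a b c d e : ℕ, a + b + c + d + e + 1 = 1 → a = 0 ∧ b = 0 ∧ c = 0 ∧ d = 0 ∧ e = 0 := by
    clear * -
    intro a b c d e h; omega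
  have o : ∀ a b c d : ℕ, a + b + c + d = 4 → a ≤ 1 → b ≤ 1 → c ≤ 1 → d ≤ 1 → a = 1 ∧ b = 1 ∧ c = 1 ∧ d = 1 := by
    clear * -
    intro a b c d; omega
  subst e
  obtain ⟨rfl, rfl, rfl, rfl, rfl⟩ := z _ _ _ _ _ h19
  obtain ⟨rfl, rfl, rfl, rfl, rfl⟩ := z x2_367 x3_367 x7_367 x41_367 x83_367 (by clear h2 h3 h7 h41 h83 h19 z o; omega)
  simp only [add_zero] at h2 h3 h7 h41 h83
  obtain ⟨rfl, rfl, rfl, rfl⟩ := o _ _ _ _ h2 l2_3 l2_7 l2_41 l2_83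
  obtain ⟨-, rfl, rfl, rfl⟩ := o _ _ _ _ h41 le_rfl l3_41 l7_41 l41_83
  clear h2 h41 h19 h367 l2_3 l2_7 l2_41 l2_83 l3_41 l7_41 l41_83
  have a1 : x3_83 = 0 := by clear h7 h3; omega
  have a2 : x7_83 = 0 := by clear h7 h3; omega
  subst a1 a2
  have a3 : x3_7 = 1 := by clear h83; omega
  subst a3
  simp

theorem mkHyp
    (hcard : Nat.card G = 2 ^ 4 * 3 * 7 * 19 * 41 ^ 2 * 83 ^ 3 * 367)
    (hdeg2 : primeGraphDeg G 2 = 4)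
    (hdeg3 : primeGraphDeg G 3 = 3)
    (hdeg7 : primeGraphDeg G 7 = 3)
    (hdeg19 : primeGraphDeg G 19 = 1)
    (hdeg41 : primeGraphDeg G 41 = 4)
    (hdeg83 : primeGraphDeg G 83 = 2)
    (hdeg367 : primeGraphDeg G 367 = 1) : Hyp G := by
  have h2 : ind G 2 3 + ind G 2 7 + ind G 2 19 + ind G 2 41 + ind G 2 83 + ind G 2 367 = 4 := by
    refine Eq.trans ?_ hdeg2
    rw [deg_ind hcard (p := 2) (by decide)]
    simp only [Finset.sum_insert, Finset.mem_insert, Finset.mem_singleton, Finset.sum_singleton, reduceIte, Nat.reduceEqDiff, or_self, not_false_eq_true, zero_add, add_zero]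
    try ring
  have h3 : ind G 2 3 + ind G 3 7 + ind G 3 19 + ind G 3 41 + ind G 3 83 + ind G 3 367 = 3 := by
    refine Eq.trans ?_ hdeg3
    rw [deg_ind hcard (p := 3) (by decide)]
    simp only [Finset.sum_insert, Finset.mem_insert, Finset.mem_singleton, Finset.sum_singleton, reduceIte, Nat.reduceEqDiff, or_self, not_false_eq_true, zero_add, add_zero]
    rw [ind_symm 3 2]
    try ring
  have h7 : ind G 2 7 + ind G 3 7 + ind G 7 19 + ind G 7 41 + ind G 7 83 + ind G 7 367 = 3 := by
    refine Eq.trans ?_ hdeg7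
    rw [deg_ind hcard (p := 7) (by decide)]
    simp only [Finset.sum_insert, Finset.mem_insert, Finset.mem_singleton, Finset.sum_singleton, reduceIte, Nat.reduceEqDiff, or_self, not_false_eq_true, zero_add, add_zero]
    rw [ind_symm 7 2, ind_symm 7 3]
    try ring
  have h19 : ind G 2 19 + ind G 3 19 + ind G 7 19 + ind G 19 41 + ind G 19 83 + ind G 19 367 = 1 := by
    refine Eq.trans ?_ hdeg19
    rw [deg_ind hcard (p := 19) (by decide)]
    simp only [Finset.sum_insert, Finset.mem_insert, Finset.mem_singleton, Finset.sum_singleton, reduceIte, Nat.reduceEqDiff, or_self, not_false_eq_true, zero_add, add_zero]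
    rw [ind_symm 19 2, ind_symm 19 3, ind_symm 19 7]
    try ring
  have h41 : ind G 2 41 + ind G 3 41 + ind G 7 41 + ind G 19 41 + ind G 41 83 + ind G 41 367 = 4 := by
    refine Eq.trans ?_ hdeg41
    rw [deg_ind hcard (p := 41) (by decide)]
    simp only [Finset.sum_insert, Finset.mem_insert, Finset.mem_singleton, Finset.sum_singleton, reduceIte, Nat.reduceEqDiff, or_self, not_false_eq_true, zero_add, add_zero]
    rw [ind_symm 41 2, ind_symm 41 3, ind_symm 41 7, ind_symm 41 19]
    try ring
  have h83 : ind G 2 83 + ind G 3 83 + ind G 7 83 + ind G 19 83 + ind G 41 83 + ind G 83 367 = 2 := by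
    refine Eq.trans ?_ hdeg83
    rw [deg_ind hcard (p := 83) (by decide)]
    simp only [Finset.sum_insert, Finset.mem_insert, Finset.mem_singleton, Finset.sum_singleton, reduceIte, Nat.reduceEqDiff, or_self, not_false_eq_true, zero_add, add_zero]
    rw [ind_symm 83 2, ind_symm 83 3, ind_symm 83 7, ind_symm 83 19, ind_symm 83 41]
    try ring
  have h367 : ind G 2 367 + ind G 3 367 + ind G 7 367 + ind G 19 367 + ind G 41 367 + ind G 83 367 = 1 := by
    refine Eq.trans ?_ hdeg367
    rw [deg_ind hcard (p := 367) (by decide)]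
    simp only [Finset.sum_insert, Finset.mem_insert, Finset.mem_singleton, Finset.sum_singleton, reduceIte, Nat.reduceEqDiff, or_self, not_false_eq_true, zero_add, add_zero]
    rw [ind_symm 367 2, ind_symm 367 3, ind_symm 367 7, ind_symm 367 19, ind_symm 367 41, ind_symm 367 83]
    try ring
  have s2 := fun P => S2 (P := P) hcard (by
    rw [ind_symm 367 2, ind_symm 367 3, ind_symm 367 7, ind_symm 367 19, ind_symm 367 41, ind_symm 367 83]; exact h367)
  have e1 : ind G 19 367 = 1 := by
    obtain ⟨P, -, hP⟩ := exists_sub_card1 (G := G) 367 (H := ⊤) (by rw [card_top', hcard]; norm_num)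
    rw [ind_symm, ind_one]
    exact ad_of_comm (by norm_num) (A := P) (by rw [hP]) (by rw [(s2 P hP).1]; norm_num) (le_refl (Ce P))
  obtain ⟨q0, q1, q2, q3, q4, q5, q6, q7, q8, q9, q10, q11, q12, q13, q14, q15⟩ := hyp_arith h2 h3 h7 h19 h41 h83 h367 e1 (ind_le _ _) (ind_le _ _) (ind_le _ _) (ind_le _ _) (ind_le _ _) (ind_le _ _) (ind_le _ _) (ind_le _ _)
  have na : ∀ p q, ind G p q = 0 → ¬ Ad G p q := fun p q h h' => by
    rw [ind_one.2 h'] at h; exact one_ne_zero h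
  have na' : ∀ p q, ind G p q = 0 → ¬ Ad G q p := fun p q h h' => na p q h (ad_symm h')
  refine ⟨hcard, s2, ?_, ?_, na _ _ q10, na _ _ q11, ad_symm (ind_one.1 q12), ad_symm (ind_one.1 q13), ind_one.1 q14, ind_one.1 q15⟩
  · rintro r (rfl | rfl | rfl | rfl | rfl)
    exacts [na' _ _ q0, na' _ _ q1, na' _ _ q2, na _ _ q3, na _ _ q4]
  · rintro r (rfl | rfl | rfl | rfl | rfl)
    exacts [na' _ _ q5, na' _ _ q6, na' _ _ q7, na' _ _ q8, na' _ _ q9]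

end
end OD

set_option linter.all false
namespace OD
section
variable {G : Type*} [Group G] [Finite G] {p : ℕ} [hp : Fact p.Prime]

theorem pow_dvd_le {p i k m : ℕ} (hp : p.Prime) (h : p ^ i ∣ p ^ k * m) (hm : ¬ p ∣ m) : i ≤ k := by
  have h1 : Nat.Coprime (p ^ i) m := Nat.Coprime.pow_left _ ((Nat.Prime.coprime_iff_not_dvd hp).2 hm)
  exact (Nat.pow_dvd_pow_iff_le_right hp.one_lt).1 (h1.dvd_of_dvd_mul_right h)

theorem fact_eq {p k m : ℕ} (hp : p.Prime) (hm : ¬ p ∣ m) : (p ^ k * m).factorization p = k := by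
  have hm0 : m ≠ 0 := by rintro rfl; simp at hm
  rw [Nat.factorization_mul (pow_ne_zero _ hp.ne_zero) hm0, hp.factorization_pow]
  simp [Nat.factorization_eq_zero_of_not_dvd hm]

theorem IsSyl.card_eq {S H : Subgroup G} (hS : IsSyl p S H) {k m : ℕ} (h : Nat.card H = p ^ k * m)
    (hm : ¬ p ∣ m) : Nat.card S = p ^ k := by
  rw [hS.2, h, fact_eq hp.out hm]

theorem IsSyl.of_card {S H : Subgroup G} (hS : S ≤ H) {k m : ℕ} (h : Nat.card H = p ^ k * m)
    (hm : ¬ p ∣ m) (hc : Nat.card S = p ^ k) : IsSyl p S H :=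
  ⟨hS, by rw [hc, h, fact_eq hp.out hm]⟩

theorem IsSyl.pow_dvd {S H : Subgroup G} (hS : IsSyl p S H) {k : ℕ} (h : p ^ k ∣ Nat.card H) :
    p ^ k ∣ Nat.card S := by
  rw [hS.2]
  exact Nat.pow_dvd_pow _ ((hp.out.pow_dvd_iff_le_factorization Nat.card_pos.ne').1 h)

theorem IsSyl.dvd {S H : Subgroup G} (hS : IsSyl p S H) (h : p ∣ Nat.card H) : p ∣ Nat.card S := by
  simpa using hS.pow_dvd (k := 1) (by simpa using h)

theorem IsSyl.index {S H : Subgroup G} (hS : IsSyl p S H) : ∃ m, Nat.card H = Nat.card S * m ∧ ¬ p ∣ m := by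
  rw [hS.2]
  refine ⟨_, (Nat.ordProj_mul_ordCompl_eq_self _ p).symm, Nat.not_dvd_ordCompl hp.out Nat.card_pos.ne'⟩

theorem exists_pow_card {S : Subgroup G} (h : IsPGroup p S) : ∃ k, Nat.card S = p ^ k := h.exists_card_eq

/-- relative N/C -/
theorem NC' {P : Subgroup G} (H : Subgroup G) (h : Nat.card P = p) :
    ∃ e, e ∣ p - 1 ∧ Nat.card ↥(H ⊓ Nm P) = Nat.card ↥(H ⊓ Ce P) * e := by
  have hc : IsCyclic P := isCyclic_of_prime_card h
  let f := (Subgroup.normalizerMonoidHom P).comp (Subgroup.inclusion (inf_le_right : H ⊓ Nm P ≤ Nm P))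
  have h2 := Subgroup.card_mul_index f.ker
  rw [Subgroup.index_ker] at h2
  refine ⟨Nat.card f.range, ?_, h2.symm.trans ?_⟩
  · have h3 := Subgroup.card_subgroup_dvd_card f.range
    rw [IsCyclic.card_mulAut, h, Nat.totient_prime hp.out] at h3
    exact h3
  · congr 1
    have h1 := Subgroup.normalizerMonoidHom_ker P
    have h4 : f.ker = (H ⊓ Ce P).subgroupOf (H ⊓ Nm P) := by
      ext x
      have : x ∈ f.ker ↔ Subgroup.inclusion (inf_le_right : H ⊓ Nm P ≤ Nm P) x ∈ (Subgroup.normalizerMonoidHom P).ker := by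
        rw [MonoidHom.mem_ker, MonoidHom.mem_ker]; rfl
      rw [this, h1, Subgroup.mem_subgroupOf, Subgroup.mem_subgroupOf, Subgroup.mem_inf]
      simp only [Subgroup.coe_inclusion]
      exact ⟨fun h => ⟨x.2.1, h⟩, fun h => h.2⟩
    rw [h4]
    exact Nat.card_congr (Subgroup.subgroupOfEquivOfLe (inf_le_inf_left H (Ce_le_Nm P))).toEquiv

/-- coprime action without commuting elements -/
theorem lemA {l r : ℕ} [hl : Fact l.Prime] [hr : Fact r.Prime] (hlr : l ≠ r) (na : ¬ Ad G l r)
    {S P : Subgroup G} (hS : IsPGroup r S) (hP : Nat.card P = l) (h : P ≤ Nm S) :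
    Nat.card S % l = 1 := by
  have h1 := fix_mod (pg_of_card hP) h
  have h2 : Nat.card ↥(S ⊓ Ce P) = 1 := by
    obtain ⟨k, hk⟩ := (hS.to_le (inf_le_left : S ⊓ Ce P ≤ S)).exists_card_eq
    rcases k with _ | k
    · simpa using hk
    · exact absurd (ad_of_comm hlr (A := P) (B := S ⊓ Ce P) (by rw [hP])
        (by rw [hk]; exact dvd_pow_self _ (by omega)) inf_le_right) na
  rw [h2] at h1
  rw [h1, Nat.mod_eq_of_lt hl.out.one_lt]

theorem syl_exp (hG : Hyp G) {S : Subgroup G} {k : ℕ} (hS : IsPGroup p S) {m : ℕ} (hN : NN = p ^ k * m)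
    (hm : ¬ p ∣ m) : ∃ i ≤ k, Nat.card S = p ^ i := by
  obtain ⟨i, hi⟩ := hS.exists_card_eq
  refine ⟨i, ?_, hi⟩
  have := sub_dvd hG.card S
  rw [hi, hN] at this
  exact pow_dvd_le hp.out this hm

theorem top_of_card (hG : Hyp G) {K : Subgroup G} (h : Nat.card K = NN) : K = ⊤ :=
  Subgroup.eq_top_of_card_eq K (h.trans hG.card.symm)

theorem frat_top (hG : Hyp G) {S K : Subgroup G} (hS : IsSyl p S K) (hK : Nm K = ⊤) :
    NN ∣ Nat.card K * Nat.card ↥(Nm S) := by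
  have := frattini_dvd hS (le_top) (hK.ge)
  rwa [top_inf_eq, card_top', hG.card] at this

theorem cop_dvd {l a b n : ℕ} (hl : l.Prime) (h : n ∣ a * b) (hn : l ∣ n) (ha : ¬ l ∣ a) : l ∣ b :=
  (hl.dvd_mul.1 (hn.trans h)).resolve_left ha

theorem S3 (hG : Hyp G) {K : Subgroup G} (hK : Nm K = ⊤) : K = ⊥ ∨ K = ⊤ := by
  by_cases h367 : 367 ∣ Nat.card K
  · right
    obtain ⟨P, hPK, hP⟩ := exists_sub_card1 367 h367
    obtain ⟨m, hm⟩ := sub_dvd hG.card K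
    have h367' : ¬ 367 ∣ Nat.card K / 367 := by
      intro h
      have h1 : 367 * 367 ∣ Nat.card K := by
        obtain ⟨a, ha⟩ := h367
        rw [ha] at h ⊢
        rw [Nat.mul_div_cancel_left _ (by norm_num)] at h
        exact Nat.mul_dvd_mul_left _ h
      have := h1.trans (sub_dvd hG.card K)
      norm_num [NN] at this
    have hPS : IsSyl 367 P K := IsSyl.of_card (k := 1) hPK (m := Nat.card K / 367)
      (by rw [pow_one, Nat.mul_div_cancel' h367]) h367' (by simpa using hP)
    have h1 := frattini hPS le_top hK.ge
    rw [top_inf_eq, card_top', hG.card, (hG.C367 P hP).2] at h1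
    have h2 : m ∣ 57 * 367 := by
      have : Nat.card K * (m * Nat.card ↥(K ⊓ Nm P)) = Nat.card K * (57 * 367) := by
        rw [← mul_assoc, ← hm, h1]
      exact ⟨_, (Nat.eq_of_mul_eq_mul_left Nat.card_pos this).symm⟩
    have h3 : ¬ 367 ∣ m := by
      intro h
      have h1 : 367 * 367 ∣ NN := by
        rw [hm]; exact mul_dvd_mul h367 h
      norm_num [NN] at h1
    have h4 : m ∣ 57 := by
      have : Nat.Coprime m 367 := ((Nat.Prime.coprime_iff_not_dvd f367.out).2 h3).symm
      exact this.dvd_of_dvd_mul_right h2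
    have h5 : m ∈ Nat.divisors 57 := by simpa using h4
    have h6 : Nat.divisors 57 = {1, 3, 19, 57} := by decide +kernel
    rw [h6] at h5
    simp only [Finset.mem_insert, Finset.mem_singleton] at h5
    have c19 : ¬ 19 ∣ Nat.card K → 7 ∣ Nat.card K → False := by
      intro h19 h7
      obtain ⟨S, hS⟩ := IsSyl.exists 7 K
      have h8 := cop_dvd f19.out (frat_top hG hS hK) (by norm_num [NN]) h19
      obtain ⟨Q, hQ, hQc⟩ := exists_sub_card1 19 h8
      have h9 := lemA (by norm_num) (hG.na19 7 (by norm_num)) hS.pg hQc hQ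
      obtain ⟨i, hi, hc⟩ := syl_exp hG (k := 1) (m := 2 ^ 4 * 3 * 19 * 41 ^ 2 * 83 ^ 3 * 367) hS.pg (by norm_num [NN]) (by norm_num)
      have h10 := hS.dvd h7
      interval_cases i
      · rw [hc] at h10; norm_num at h10
      · rw [hc] at h9; norm_num at h9
    rcases h5 with rfl | rfl | rfl | rfl
    · rw [mul_one] at hm; exact top_of_card hG hm.symm
    · exfalso
      have hKc : Nat.card K = 2 ^ 4 * 7 * 19 * 41 ^ 2 * 83 ^ 3 * 367 := by
        apply Nat.eq_of_mul_eq_mul_right (show 0 < 3 by norm_num)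
        rw [← hm]; norm_num [NN]
      have hKN : Nat.card ↥(K ⊓ Nm P) = 19 * 367 := by
        apply Nat.eq_of_mul_eq_mul_left (show 0 < NN by norm_num [NN])
        rw [h1, hKc]; norm_num [NN]
      obtain ⟨e, he, hec⟩ := NC' K hP
      have he1 : e = 1 := by
        have : e ∣ 19 * 367 := by rw [← hKN, hec]; exact dvd_mul_left _ _
        have h := Nat.dvd_gcd he this
        norm_num at h; exact h
      rw [he1, mul_one] at hec
      have heq : K ⊓ Ce P = K ⊓ Nm P :=
        Subgroup.eq_of_le_of_card_ge (inf_le_inf_left K (Ce_le_Nm P)) hec.le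
      obtain ⟨M, hMK, hMn, hMc⟩ := burnside hPS (by rw [← heq]; exact inf_le_right)
      have hMc' : Nat.card M = 2 ^ 4 * 7 * 19 * 41 ^ 2 * 83 ^ 3 := by
        rw [hP, hKc] at hMc
        exact Nat.eq_of_mul_eq_mul_right (by norm_num) hMc
      obtain ⟨S, hS⟩ := IsSyl.exists 7 M
      have hSc := hS.card_eq (k := 1) (m := 2 ^ 4 * 19 * 41 ^ 2 * 83 ^ 3) (by rw [hMc']; norm_num) (by norm_num)
      have h8 := cop_dvd f367.out (frattini_dvd hS hMK hMn) h367 (by rw [hMc']; norm_num)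
      obtain ⟨Q, hQ, hQc⟩ := exists_sub_card1 367 h8
      have h9 := lemA (by norm_num) (hG.na367 7 (by norm_num)) hS.pg hQc (hQ.trans inf_le_right)
      rw [hSc] at h9; norm_num at h9
    · exfalso
      have hKc : Nat.card K = 2 ^ 4 * 3 * 7 * 41 ^ 2 * 83 ^ 3 * 367 := by
        apply Nat.eq_of_mul_eq_mul_right (show 0 < 19 by norm_num)
        rw [← hm]; norm_num [NN]
      exact c19 (by rw [hKc]; norm_num) (by rw [hKc]; norm_num)
    · exfalso
      have hKc : Nat.card K = 2 ^ 4 * 7 * 41 ^ 2 * 83 ^ 3 * 367 := by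
        apply Nat.eq_of_mul_eq_mul_right (show 0 < 57 by norm_num)
        rw [← hm]; norm_num [NN]
      exact c19 (by rw [hKc]; norm_num) (by rw [hKc]; norm_num)
  · left
    have key : ∀ r, r = 2 ∨ r = 3 ∨ r = 7 ∨ r = 41 ∨ r = 83 → ∀ [Fact r.Prime], ∀ S, IsSyl r S K →
        Nat.card S % 367 = 1 := by
      intro r hr _ S hS
      have h8 := cop_dvd f367.out (frat_top hG hS hK) (by norm_num [NN]) h367
      obtain ⟨Q, hQ, hQc⟩ := exists_sub_card1 367 h8
      exact lemA (by rintro rfl; omega) (hG.na367 r hr) hS.pg hQc hQ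
    have n2 : ¬ 2 ∣ Nat.card K := by
      intro h
      obtain ⟨S, hS⟩ := IsSyl.exists 2 K
      have h1 := key 2 (by norm_num) S hS
      have h2 := hS.dvd h
      obtain ⟨i, hi, hc⟩ := syl_exp hG (k := 4) (m := 3 * 7 * 19 * 41 ^ 2 * 83 ^ 3 * 367) hS.pg (by norm_num [NN]) (by norm_num)
      rw [hc] at h1 h2
      interval_cases i <;> first | (norm_num at h1; done) | (norm_num at h2; done)
    have n3 : ¬ 3 ∣ Nat.card K := by
      intro h
      obtain ⟨S, hS⟩ := IsSyl.exists 3 K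
      have h1 := key 3 (by norm_num) S hS
      have h2 := hS.dvd h
      obtain ⟨i, hi, hc⟩ := syl_exp hG (k := 1) (m := 2 ^ 4 * 7 * 19 * 41 ^ 2 * 83 ^ 3 * 367) hS.pg (by norm_num [NN]) (by norm_num)
      rw [hc] at h1 h2
      interval_cases i <;> first | (norm_num at h1; done) | (norm_num at h2; done)
    have n7 : ¬ 7 ∣ Nat.card K := by
      intro h
      obtain ⟨S, hS⟩ := IsSyl.exists 7 K
      have h1 := key 7 (by norm_num) S hS
      have h2 := hS.dvd h
      obtain ⟨i, hi, hc⟩ := syl_exp hG (k := 1) (m := 2 ^ 4 * 3 * 19 * 41 ^ 2 * 83 ^ 3 * 367) hS.pg (by norm_num [NN]) (by norm_num)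
      rw [hc] at h1 h2
      interval_cases i <;> first | (norm_num at h1; done) | (norm_num at h2; done)
    have n41 : ¬ 41 ∣ Nat.card K := by
      intro h
      obtain ⟨S, hS⟩ := IsSyl.exists 41 K
      have h1 := key 41 (by norm_num) S hS
      have h2 := hS.dvd h
      obtain ⟨i, hi, hc⟩ := syl_exp hG (k := 2) (m := 2 ^ 4 * 3 * 7 * 19 * 83 ^ 3 * 367) hS.pg (by norm_num [NN]) (by norm_num)
      rw [hc] at h1 h2
      interval_cases i <;> first | (norm_num at h1; done) | (norm_num at h2; done)
    have n83 : ¬ 83 ∣ Nat.card K := by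
      intro h
      obtain ⟨S, hS⟩ := IsSyl.exists 83 K
      have h1 := key 83 (by norm_num) S hS
      have h2 := hS.dvd h
      obtain ⟨i, hi, hc⟩ := syl_exp hG (k := 3) (m := 2 ^ 4 * 3 * 7 * 19 * 41 ^ 2 * 367) hS.pg (by norm_num [NN]) (by norm_num)
      have h8 := cop_dvd f7.out (frat_top hG hS hK) (by norm_num [NN]) n7
      obtain ⟨Q, hQ, hQc⟩ := exists_sub_card1 7 h8
      have h3 := lemA (by norm_num) hG.na7 hS.pg hQc hQ
      rw [hc] at h1 h2 h3
      interval_cases i <;> first | (norm_num at h1; done) | (norm_num at h2; done) | (norm_num at h3; done)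
    have n19 : ¬ 19 ∣ Nat.card K := by
      intro h
      obtain ⟨S, hS⟩ := IsSyl.exists 19 K
      have h2 := hS.dvd h
      obtain ⟨i, hi, hc⟩ := syl_exp hG (k := 1) (m := 2 ^ 4 * 3 * 7 * 41 ^ 2 * 83 ^ 3 * 367) hS.pg (by norm_num [NN]) (by norm_num)
      have h8 := cop_dvd f7.out (frat_top hG hS hK) (by norm_num [NN]) n7
      obtain ⟨Q, hQ, hQc⟩ := exists_sub_card1 7 h8
      have h3 := lemA (by norm_num) (fun h => hG.na19 7 (by norm_num) (ad_symm h)) hS.pg hQc hQ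
      rw [hc] at h2 h3
      interval_cases i <;> first | (norm_num at h2; done) | (norm_num at h3; done)
    obtain ⟨a, b, c', d, e', f, g, ha, hb, hc, hd, he', hf, hg, hcc, z2, z3, z7, z19, z41, z83, z367⟩ := dvd_form' (sub_dvd hG.card K)
    rw [z2 n2, z3 n3, z7 n7, z19 n19, z41 n41, z83 n83, z367 h367] at hcc
    exact Subgroup.card_eq_one.1 (by simpa using hcc)

end
end OD

set_option linter.all false
namespace OD
section
variable {G : Type*} [Group G] [Finite G] {p : ℕ} [hp : Fact p.Prime]

theorem exp_pos' {p a m n : ℕ} (hp : p.Prime) (hn : n = p ^ a * m) (hm : Nat.Coprime p m) (h : p ∣ n) : 1 ≤ a :=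
  exp_pos hp hn h ((Nat.Prime.coprime_iff_not_dvd hp).1 hm)

theorem dvd_full {n : ℕ} (h : n ∣ NN) :
    ∃ a b c d e f g, a ≤ 4 ∧ b ≤ 1 ∧ c ≤ 1 ∧ d ≤ 1 ∧ e ≤ 2 ∧ f ≤ 3 ∧ g ≤ 1 ∧
    n = 2 ^ a * 3 ^ b * 7 ^ c * 19 ^ d * 41 ^ e * 83 ^ f * 367 ^ g ∧
    ((¬ 2 ∣ n → a = 0) ∧ (¬ 3 ∣ n → b = 0) ∧ (¬ 7 ∣ n → c = 0) ∧ (¬ 19 ∣ n → d = 0) ∧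
    (¬ 41 ∣ n → e = 0) ∧ (¬ 83 ∣ n → f = 0) ∧ (¬ 367 ∣ n → g = 0)) ∧
    ((2 ∣ n → 1 ≤ a) ∧ (3 ∣ n → 1 ≤ b) ∧ (7 ∣ n → 1 ≤ c) ∧ (19 ∣ n → 1 ≤ d) ∧
    (41 ∣ n → 1 ≤ e) ∧ (83 ∣ n → 1 ≤ f) ∧ (367 ∣ n → 1 ≤ g)) ∧
    ((41 ^ 2 ∣ n → e = 2) ∧ (∀ k, 83 ^ k ∣ n → k ≤ f) ∧ (∀ k, 2 ^ k ∣ n → k ≤ a)) := by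
  obtain ⟨a, b, c, d, e, f, g, ha, hb, hc, hd, he, hf, hg, rfl, z2, z3, z7, z19, z41, z83, z367⟩ := dvd_form' h
  refine ⟨a, b, c, d, e, f, g, ha, hb, hc, hd, he, hf, hg, rfl, ⟨z2, z3, z7, z19, z41, z83, z367⟩, ⟨?_, ?_, ?_, ?_, ?_, ?_, ?_⟩, ⟨?_, ?_, ?_⟩⟩
  · refine exp_pos' (m := 3 ^ b * 7 ^ c * 19 ^ d * 41 ^ e * 83 ^ f * 367 ^ g) (by norm_num) (by ring) ?_
    simp only [Nat.coprime_mul_iff_right]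
    refine ⟨⟨⟨⟨⟨?_, ?_⟩, ?_⟩, ?_⟩, ?_⟩, ?_⟩ <;> exact Nat.Coprime.pow_right _ (by norm_num)
  · refine exp_pos' (m := 2 ^ a * 7 ^ c * 19 ^ d * 41 ^ e * 83 ^ f * 367 ^ g) (by norm_num) (by ring) ?_
    simp only [Nat.coprime_mul_iff_right]
    refine ⟨⟨⟨⟨⟨?_, ?_⟩, ?_⟩, ?_⟩, ?_⟩, ?_⟩ <;> exact Nat.Coprime.pow_right _ (by norm_num)
  · refine exp_pos' (m := 2 ^ a * 3 ^ b * 19 ^ d * 41 ^ e * 83 ^ f * 367 ^ g) (by norm_num) (by ring) ?_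
    simp only [Nat.coprime_mul_iff_right]
    refine ⟨⟨⟨⟨⟨?_, ?_⟩, ?_⟩, ?_⟩, ?_⟩, ?_⟩ <;> exact Nat.Coprime.pow_right _ (by norm_num)
  · refine exp_pos' (m := 2 ^ a * 3 ^ b * 7 ^ c * 41 ^ e * 83 ^ f * 367 ^ g) (by norm_num) (by ring) ?_
    simp only [Nat.coprime_mul_iff_right]
    refine ⟨⟨⟨⟨⟨?_, ?_⟩, ?_⟩, ?_⟩, ?_⟩, ?_⟩ <;> exact Nat.Coprime.pow_right _ (by norm_num)
  · refine exp_pos' (m := 2 ^ a * 3 ^ b * 7 ^ c * 19 ^ d * 83 ^ f * 367 ^ g) (by norm_num) (by ring) ?_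
    simp only [Nat.coprime_mul_iff_right]
    refine ⟨⟨⟨⟨⟨?_, ?_⟩, ?_⟩, ?_⟩, ?_⟩, ?_⟩ <;> exact Nat.Coprime.pow_right _ (by norm_num)
  · refine exp_pos' (m := 2 ^ a * 3 ^ b * 7 ^ c * 19 ^ d * 41 ^ e * 367 ^ g) (by norm_num) (by ring) ?_
    simp only [Nat.coprime_mul_iff_right]
    refine ⟨⟨⟨⟨⟨?_, ?_⟩, ?_⟩, ?_⟩, ?_⟩, ?_⟩ <;> exact Nat.Coprime.pow_right _ (by norm_num)
  · refine exp_pos' (m := 2 ^ a * 3 ^ b * 7 ^ c * 19 ^ d * 41 ^ e * 83 ^ f) (by norm_num) (by ring) ?_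
    simp only [Nat.coprime_mul_iff_right]
    refine ⟨⟨⟨⟨⟨?_, ?_⟩, ?_⟩, ?_⟩, ?_⟩, ?_⟩ <;> exact Nat.Coprime.pow_right _ (by norm_num)
  · intro h
    have : 41 ^ 2 ∣ 41 ^ e * (2 ^ a * 3 ^ b * 7 ^ c * 19 ^ d * 83 ^ f * 367 ^ g) := by
      convert h using 1; ring
    refine le_antisymm he (pow_dvd_le f41.out this ?_)
    rw [← Nat.Prime.coprime_iff_not_dvd f41.out]
    simp only [Nat.coprime_mul_iff_right]
    refine ⟨⟨⟨⟨⟨?_, ?_⟩, ?_⟩, ?_⟩, ?_⟩, ?_⟩ <;> exact Nat.Coprime.pow_right _ (by norm_num)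
  · intro k h
    have : 83 ^ k ∣ 83 ^ f * (2 ^ a * 3 ^ b * 7 ^ c * 19 ^ d * 41 ^ e * 367 ^ g) := by
      convert h using 1; ring
    refine (pow_dvd_le f83.out this ?_)
    rw [← Nat.Prime.coprime_iff_not_dvd f83.out]
    simp only [Nat.coprime_mul_iff_right]
    refine ⟨⟨⟨⟨⟨?_, ?_⟩, ?_⟩, ?_⟩, ?_⟩, ?_⟩ <;> exact Nat.Coprime.pow_right _ (by norm_num)
  · intro k h
    have : 2 ^ k ∣ 2 ^ a * (3 ^ b * 7 ^ c * 19 ^ d * 41 ^ e * 83 ^ f * 367 ^ g) := by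
      convert h using 1; ring
    refine (pow_dvd_le Nat.prime_two this ?_)
    rw [← Nat.Prime.coprime_iff_not_dvd Nat.prime_two]
    simp only [Nat.coprime_mul_iff_right]
    refine ⟨⟨⟨⟨⟨?_, ?_⟩, ?_⟩, ?_⟩, ?_⟩, ?_⟩ <;> exact Nat.Coprime.pow_right _ (by norm_num)

theorem div6 {e : ℕ} (h : e ∣ 6) : e = 1 ∨ e = 2 ∨ e = 3 ∨ e = 6 := by
  have : e ∈ Nat.divisors 6 := by simpa using h
  have h2 : Nat.divisors 6 = {1,2,3,6} := by decide +kernel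
  rw [h2] at this
  simpa using this

theorem s4_arith {n c e : ℕ} (h2 : NN = n * (c * e)) (h3 : n % 7 = 1) (he : e ∣ 6) (hc : c ∣ NN)
    (d2 : 2 ∣ c) (d3 : 3 ∣ c) (d7 : 7 ∣ c) (d41 : 41 ∣ c) (d19 : ¬ 19 ∣ c) (d83 : ¬ 83 ∣ c) (d367 : ¬ 367 ∣ c) :
    e = 1 ∨ (c = 2 ^ 3 * 3 * 7 * 41 ∧ e = 2) := by
  obtain ⟨a, b, c', d, e', f, g, ha, hb, hc, hd, he', hf, hg, hcc, ⟨z2, z3, z7, z19, z41, z83, z367⟩, ⟨y2, y3, y7, y19, y41, y83, y367⟩, -⟩ := dvd_full hc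
  have e1 := le_antisymm hb (y3 d3)
  have e2 := le_antisymm hc (y7 d7)
  have e3 := z19 d19
  have e4 := z83 d83
  have e5 := z367 d367
  have e6 := y2 d2
  have e7 := y41 d41
  clear z2 z3 z7 z19 z41 z83 z367 y2 y3 y7 y19 y41 y83 y367 d2 d3 d7 d41 d19 d83 d367
  subst e1 e2 e3 e4 e5
  have he := div6 he
  subst hcc
  clear hc hb hd hf hg
  norm_num [NN] at h2
  interval_cases a <;> interval_cases e' <;> (rcases he with rfl | rfl | rfl | rfl <;> norm_num at h2 ⊢ <;> omega)

/-- conjugacy of Sylow subgroups of G of given order -/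
theorem conj_of_card (hG : Hyp G) {S T : Subgroup G} {k m : ℕ} (hN : NN = p ^ k * m) (hm : ¬ p ∣ m)
    (hS : Nat.card S = p ^ k) (hT : Nat.card T = p ^ k) : ∃ g : G, g • S = T := by
  have h : Nat.card (⊤ : Subgroup G) = p ^ k * m := by rw [card_top', hG.card, hN]
  obtain ⟨g, -, h⟩ := (IsSyl.of_card le_top h hm hS).conj (IsSyl.of_card le_top h hm hT)
  exact ⟨g, h⟩

theorem conj7 (hG : Hyp G) {S T : Subgroup G} (hS : Nat.card S = 7) (hT : Nat.card T = 7) : ∃ g : G, g • S = T :=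
  conj_of_card hG (p := 7) (k := 1) (m := 2 ^ 4 * 3 * 19 * 41 ^ 2 * 83 ^ 3 * 367) (by norm_num [NN]) (by norm_num) (by simpa using hS) (by simpa using hT)

theorem conj3 (hG : Hyp G) {S T : Subgroup G} (hS : Nat.card S = 3) (hT : Nat.card T = 3) : ∃ g : G, g • S = T :=
  conj_of_card hG (p := 3) (k := 1) (m := 2 ^ 4 * 7 * 19 * 41 ^ 2 * 83 ^ 3 * 367) (by norm_num [NN]) (by norm_num) (by simpa using hS) (by simpa using hT)

theorem conj41 (hG : Hyp G) {S T : Subgroup G} (hS : Nat.card S = 41 ^ 2) (hT : Nat.card T = 41 ^ 2) : ∃ g : G, g • S = T :=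
  conj_of_card hG (p := 41) (k := 2) (m := 2 ^ 4 * 3 * 7 * 19 * 83 ^ 3 * 367) (by norm_num [NN]) (by norm_num) hS hT

theorem conj83 (hG : Hyp G) {S T : Subgroup G} (hS : Nat.card S = 83 ^ 3) (hT : Nat.card T = 83 ^ 3) : ∃ g : G, g • S = T :=
  conj_of_card hG (p := 83) (k := 3) (m := 2 ^ 4 * 3 * 7 * 19 * 41 ^ 2 * 367) (by norm_num [NN]) (by norm_num) hS hT

theorem le_Ce_of_prime {P : Subgroup G} (hP : Nat.card P = p) : P ≤ Ce P := by
  haveI : IsCyclic P := isCyclic_of_prime_card hP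
  exact Subgroup.le_centralizer P

theorem card_ad (hG : Hyp G) {l r : ℕ} [Fact l.Prime] [Fact r.Prime] (hlr : l ≠ r) (na : ¬ Ad G l r) {A : Subgroup G}
    (hA : l ∣ Nat.card A) : ¬ r ∣ Nat.card ↥(Ce A) := fun h => na (ad_of_comm hlr hA h le_rfl)

theorem cent_of_cop {Q H : Subgroup G} (hQ : Nat.card Q = p) (h : H ≤ Nm Q) (hc : Nat.Coprime (Nat.card H) (p - 1)) :
    H ≤ Ce Q := by
  obtain ⟨e, he, hec⟩ := NC' H hQ
  have h1 : e = 1 := by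
    rw [inf_eq_left.2 h] at hec
    exact Nat.eq_one_of_dvd_coprimes hc ⟨_, hec.trans (mul_comm _ _)⟩ he
  rw [h1, mul_one] at hec
  have heq : H ⊓ Ce Q = H ⊓ Nm Q := Subgroup.eq_of_le_of_card_ge (inf_le_inf_left H (Ce_le_Nm Q)) hec.le
  rw [inf_eq_left.2 h] at heq
  exact heq.ge.trans inf_le_right

theorem S4a (hG : Hyp G) {R : Subgroup G} (hR : Nat.card R = 7) :
    Nat.card ↥(Ce R) = 2 ^ 3 * 3 * 7 * 41 ∧ Nat.card ↥(Nm R) = 2 ^ 4 * 3 * 7 * 41 := by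
  obtain ⟨e, he, hN⟩ := NC hR
  have hS : IsSyl 7 R ⊤ := IsSyl.of_card (k := 1) (m := 2 ^ 4 * 3 * 19 * 41 ^ 2 * 83 ^ 3 * 367) le_top
    (by rw [card_top', hG.card]; norm_num [NN]) (by norm_num) (by simpa using hR)
  have h2 := Syls_count hS
  have h3 := Syls_mod 7 (⊤ : Subgroup G)
  rw [top_inf_eq, card_top', hG.card, hN] at h2
  have had : ∀ r, ∀ [Fact r.Prime], Ad G 7 r → r ∣ Nat.card ↥(Ce R) := by
    intro r _ h
    obtain ⟨A, hA, hr⟩ := ad_exists h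
    obtain ⟨g, rfl⟩ := conj7 hG hA hR
    rwa [Ce_cj, card_cj]
  have hna : ∀ r, ∀ [Fact r.Prime], r ≠ 7 → ¬ Ad G 7 r → ¬ r ∣ Nat.card ↥(Ce R) := by
    intro r _ h7 h
    exact card_ad hG h7.symm h (by rw [hR])
  have h7 : 7 ∣ Nat.card ↥(Ce R) := by
    rw [← hR]; exact Subgroup.card_dvd_of_le (le_Ce_of_prime hR)
  have := s4_arith h2 h3 he (sub_dvd hG.card _) (had 2 hG.a72) (had 3 hG.a73) h7 (had 41 hG.a741)
    (hna 19 (by norm_num) (fun h => hG.na19 7 (by norm_num) (ad_symm h))) (hna 83 (by norm_num) hG.na7)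
    (hna 367 (by norm_num) (fun h => hG.na367 7 (by norm_num) (ad_symm h)))
  rcases this with h | ⟨h, rfl⟩
  · exfalso
    rw [h, mul_one] at hN
    have heq : Ce R = Nm R := Subgroup.eq_of_le_of_card_ge (Ce_le_Nm R) hN.le
    obtain ⟨M, -, hMn, hMc⟩ := burnside hS (by rw [heq]; exact inf_le_right)
    rw [hR, card_top', hG.card] at hMc
    rcases S3 hG (top_le_iff.1 hMn) with rfl | rfl
    · rw [Subgroup.card_bot] at hMc; norm_num [NN] at hMc
    · rw [card_top', hG.card] at hMc; norm_num [NN] at hMc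
  · exact ⟨h, by rw [hN, h]; norm_num⟩

theorem s4_arith2 {n k : ℕ} (h : 2 ^ 3 * 3 * 7 * 41 = n * (7 * 41 * k)) (hn : n % 41 = 1) : n = 1 := by
  have h1 : n * k = 24 := by
    apply Nat.eq_of_mul_eq_mul_left (show 0 < 7 * 41 by norm_num)
    rw [show 7 * 41 * 24 = 2 ^ 3 * 3 * 7 * 41 by norm_num, h]; ring
  have h2 : n ≤ 24 := Nat.le_of_dvd (by norm_num) ⟨k, h1.symm⟩
  omega

theorem mul_dvd_card {l r : ℕ} [hl : Fact l.Prime] [hr : Fact r.Prime] (hlr : l ≠ r) {H : Subgroup G} {i j : ℕ}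
    (h1 : l ^ i ∣ Nat.card H) (h2 : r ^ j ∣ Nat.card H) : l ^ i * r ^ j ∣ Nat.card H := 
  Nat.Coprime.mul_dvd_of_dvd_of_dvd (Nat.Coprime.pow _ _ ((Nat.coprime_primes hl.out hr.out).2 hlr)) h1 h2

theorem S4b (hG : Hyp G) {R : Subgroup G} (hR : Nat.card R = 7) :
    ∃ U : Subgroup G, Nat.card U = 41 ∧ U ≤ Ce R ∧ Nm R ≤ Nm U := by
  obtain ⟨hC, hN⟩ := S4a hG hR
  obtain ⟨U, hU⟩ := IsSyl.exists 41 (Ce R)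
  have hUc : Nat.card U = 41 := by
    have := hU.card_eq (k := 1) (m := 2 ^ 3 * 3 * 7) (by rw [hC]; norm_num) (by norm_num)
    simpa using this
  have h1 := Syls_count hU
  have h2 := Syls_mod 41 (Ce R)
  have h3 : R ≤ Ce R ⊓ Nm U := le_inf (le_Ce_of_prime hR) ((Ce_symm.1 hU.1).trans (Ce_le_Nm U))
  have h4 : U ≤ Ce R ⊓ Nm U := le_inf hU.1 Subgroup.le_normalizer
  have h5 : 7 ^ 1 * 41 ^ 1 ∣ Nat.card ↥(Ce R ⊓ Nm U) := mul_dvd_card (by norm_num)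
    (by rw [pow_one, ← hR]; exact Subgroup.card_dvd_of_le h3) (by rw [pow_one, ← hUc]; exact Subgroup.card_dvd_of_le h4)
  obtain ⟨k, hk⟩ := h5
  rw [hC, hk, pow_one, pow_one] at h1
  have hn := s4_arith2 h1 h2
  have hnorm := normal_of_Syls_one hU hn
  refine ⟨U, hUc, hU.1, ?_⟩
  intro g hg
  have h6 := hU.cj g
  rw [← Ce_cj, mem_Nm.1 hg] at h6
  obtain ⟨c, hc, hcg⟩ := hU.conj h6
  rw [mem_Nm, ← hcg, mem_Nm.1 (hnorm hc)]

end
end OD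

set_option linter.all false
namespace OD
section
variable {G : Type*} [Group G] [Finite G] {p : ℕ} [hp : Fact p.Prime]

theorem strip3 {c : ℕ} (h : c ∣ NN) (h19 : ¬ 19 ∣ c) (h367 : ¬ 367 ∣ c) : c ∣ 2 ^ 4 * 3 * 7 * 41 ^ 2 * 83 ^ 3 := by
  have e1 : Nat.Coprime c 19 := ((Nat.Prime.coprime_iff_not_dvd f19.out).2 h19).symm
  have e2 : Nat.Coprime c 367 := ((Nat.Prime.coprime_iff_not_dvd f367.out).2 h367).symm
  have : NN = 2 ^ 4 * 3 * 7 * 41 ^ 2 * 83 ^ 3 * 19 * 367 := by norm_num [NN]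
  rw [this] at h
  exact e1.dvd_of_dvd_mul_right (e2.dvd_of_dvd_mul_right h)

theorem strip2 {c : ℕ} (h : c ∣ 2 ^ 4 * 3 * 7 * 41 ^ 2 * 83 ^ 3) (h83 : ¬ 83 ∣ c) : c ∣ 2 ^ 4 * 3 * 7 * 41 ^ 2 := by
  have e3 : Nat.Coprime c (83 ^ 3) := Nat.Coprime.pow_right _ ((Nat.Prime.coprime_iff_not_dvd f83.out).2 h83).symm
  exact e3.dvd_of_dvd_mul_right h

theorem strip37 {c m : ℕ} (h : c ∣ 2 ^ 4 * 3 * 7 * m) (h3 : ¬ 3 ∣ c) (h7 : ¬ 7 ∣ c) : c ∣ 2 ^ 4 * m := by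
  have e1 : Nat.Coprime c 3 := ((Nat.Prime.coprime_iff_not_dvd Nat.prime_three).2 h3).symm
  have e2 : Nat.Coprime c 7 := ((Nat.Prime.coprime_iff_not_dvd f7.out).2 h7).symm
  have : 2 ^ 4 * 3 * 7 * m = 2 ^ 4 * m * 3 * 7 := by ring
  rw [this] at h
  exact e1.dvd_of_dvd_mul_right (e2.dvd_of_dvd_mul_right h)

theorem na_Ce (hG : Hyp G) {A : Subgroup G} {r : ℕ} [Fact r.Prime] (hr : r = 2 ∨ r = 3 ∨ r = 7 ∨ r = 41 ∨ r = 83)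
    (hA : r ∣ Nat.card A) : ¬ 19 ∣ Nat.card ↥(Ce A) ∧ ¬ 367 ∣ Nat.card ↥(Ce A) := by
  constructor
  · exact card_ad hG (by rcases hr with rfl|rfl|rfl|rfl|rfl <;> norm_num) (fun h => hG.na19 r hr (ad_symm h)) hA
  · exact card_ad hG (by rcases hr with rfl|rfl|rfl|rfl|rfl <;> norm_num) (fun h => hG.na367 r hr (ad_symm h)) hA

theorem lemB (hG : Hyp G) {R U V : Subgroup G} (hR : Nat.card R = 7) (hV : Nat.card V = 41 ^ 2) (hRV : R ≤ Nm V)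
    (hUV : U ≤ V) (hU : Nat.card U = 41) (hUR : U ≤ Ce R) : False := by
  have h1 := fix_mod (pg_of_card hR) hRV
  rw [hV] at h1
  have h2 : 41 ∣ Nat.card ↥(V ⊓ Ce R) := by rw [← hU]; exact Subgroup.card_dvd_of_le (le_inf hUV hUR)
  have h3 : Nat.card ↥(V ⊓ Ce R) ∣ 41 ^ 2 := by rw [← hV]; exact Subgroup.card_dvd_of_le inf_le_left
  have h4 : Nat.card ↥(V ⊓ Ce R) ∣ 2 ^ 3 * 3 * 7 * 41 := by
    rw [← (S4a hG hR).1]; exact Subgroup.card_dvd_of_le inf_le_right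
  generalize Nat.card ↥(V ⊓ Ce R) = n at *
  have h5 : n ∣ 41 := by
    have := Nat.dvd_gcd h3 h4
    norm_num at this; exact this
  have : n = 41 := Nat.dvd_antisymm h5 h2
  subst this
  norm_num [Nat.ModEq] at h1

theorem exR (hG : Hyp G) : ∃ R : Subgroup G, Nat.card R = 7 := by
  obtain ⟨R, -, h⟩ := exists_sub_card1 (G := G) (H := ⊤) 7 (by rw [card_top', hG.card]; norm_num [NN])
  exact ⟨R, h⟩

theorem div112 {n : ℕ} (h : n ∣ 112) (h1 : n % 41 = 1) : n = 1 := by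
  have : ∀ n ∈ Nat.divisors 112, n % 41 = 1 → n = 1 := by decide +kernel
  exact this n (by simpa using h) h1

theorem S5 (hG : Hyp G) {T : Subgroup G} (hT : Nat.card T = 3) : ¬ 41 ^ 2 ∣ Nat.card ↥(Ce T) := by
  intro h41
  obtain ⟨R, hR⟩ := exR hG
  obtain ⟨U, hU, hUR, hRU⟩ := S4b hG hR
  obtain ⟨T0, hT0R, hT0⟩ := exists_sub_card1 3 (H := Ce R) (by rw [(S4a hG hR).1]; norm_num)
  obtain ⟨g, hg⟩ := conj3 hG hT hT0
  rw [← card_cj g, ← Ce_cj, hg] at h41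
  have hTU : T0 ≤ Ce U := cent_of_cop hU (hT0R.trans ((Ce_le_Nm R).trans hRU)) (by rw [hT0]; norm_num)
  obtain ⟨V, hV, hUV⟩ := IsSyl.exists_le (Ce_symm.1 hTU) (pg_of_card hU)
  have hVc : Nat.card V = 41 ^ 2 := by
    obtain ⟨i, hi, hi2⟩ := syl_exp hG (k := 2) (m := 2 ^ 4 * 3 * 7 * 19 * 83 ^ 3 * 367) hV.pg (by norm_num [NN]) (by norm_num)
    have := hV.pow_dvd h41
    rw [hi2, Nat.pow_dvd_pow_iff_le_right (by norm_num)] at this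
    rw [hi2, le_antisymm hi this]
  have h1 := Syls_count hV
  have h2 := Syls_mod 41 (Ce T0)
  obtain ⟨n19, n367⟩ := na_Ce hG (r := 3) (A := T0) (by norm_num) (by rw [hT0])
  have n83 : ¬ 83 ∣ Nat.card ↥(Ce T0) := card_ad hG (by norm_num) hG.na3 (by rw [hT0])
  have h3 := strip2 (strip3 (sub_dvd hG.card _) n19 n367) n83
  have h4 : 3 ^ 1 * 41 ^ 2 ∣ Nat.card ↥(Ce T0 ⊓ Nm V) := mul_dvd_card (by norm_num)
    (by rw [pow_one, ← hT0]; exact Subgroup.card_dvd_of_le (le_inf (le_Ce_of_prime hT0) ((Ce_symm.1 hV.1).trans (Ce_le_Nm V))))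
    (by rw [← hVc]; exact Subgroup.card_dvd_of_le (le_inf hV.1 Subgroup.le_normalizer))
  have h5 : (Syls 41 (Ce T0)).ncard ∣ 112 := by
    have : (Syls 41 (Ce T0)).ncard * (3 ^ 1 * 41 ^ 2) ∣ 112 * (3 ^ 1 * 41 ^ 2) := by
      refine (Nat.mul_dvd_mul_left _ h4).trans ?_
      rw [← h1]; refine h3.trans (by norm_num)
    exact Nat.dvd_of_mul_dvd_mul_right (by norm_num) this
  have h6 := normal_of_Syls_one hV (div112 h5 h2)
  exact lemB hG hR hVc ((Ce_symm.1 hT0R).trans h6) hUV hU hUR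

end
end OD

set_option linter.all false
namespace OD
section
variable {G : Type*} [Group G] [Finite G] {p : ℕ} [hp : Fact p.Prime]

structure Cfg (R U V : Subgroup G) : Prop where
  hR : Nat.card R = 7
  hU : Nat.card U = 41
  hV : Nat.card V = 41 ^ 2
  hUR : U ≤ Ce R
  hRU : Nm R ≤ Nm U
  hUV : U ≤ V

theorem exCfg (hG : Hyp G) : ∃ R U V : Subgroup G, Cfg R U V := by
  obtain ⟨R, hR⟩ := exR hG
  obtain ⟨U, hU, hUR, hRU⟩ := S4b hG hR
  obtain ⟨V, hV, hUV⟩ := IsSyl.exists_le (le_top : U ≤ ⊤) (pg_of_card hU)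
  refine ⟨R, U, V, hR, hU, ?_, hUR, hRU, hUV⟩
  exact hV.card_eq (k := 2) (m := 2 ^ 4 * 3 * 7 * 19 * 83 ^ 3 * 367) (by rw [card_top', hG.card]; norm_num [NN]) (by norm_num)

theorem abel_sq {V : Subgroup G} (hV : Nat.card V = p ^ 2) : V ≤ Ce V := by
  have := IsPGroup.commutative_of_card_eq_prime_sq (G := V) hV
  intro x hx
  refine mem_Ce.2 ?_
  intro y hy
  exact congrArg Subtype.val (this ⟨y, hy⟩ ⟨x, hx⟩)

theorem div40 {e : ℕ} (h : e ∣ 40) (h5 : ¬ 5 ∣ e) : e = 1 ∨ e = 2 ∨ e = 4 ∨ e = 8 := by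
  have : ∀ n ∈ Nat.divisors 40, ¬ 5 ∣ n → (n = 1 ∨ n = 2 ∨ n = 4 ∨ n = 8) := by decide +kernel
  exact this e (by simpa using h) h5

theorem s6_arith {c n e m : ℕ} (hc : c ∣ NN) (hn : n ∣ NN) (hce : n = c * e) (he : e ∣ 40)
    (h3 : 3 ∣ c) (h7 : 7 ∣ c) (h41 : 41 ^ 2 ∣ c) (h19 : ¬ 19 ∣ c) (h367 : ¬ 367 ∣ c)
    (hm : n = m * (2 ^ 4 * 3 * 7 * 41)) (hm7 : m % 7 = 1) :
    ∃ d f, (d = 1 ∨ d = 3) ∧ f ≤ 4 ∧ n = 2 ^ 4 * 21 * 41 ^ 2 * 83 ^ d ∧ c = 2 ^ f * 21 * 41 ^ 2 * 83 ^ d := by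
  have h5 : ¬ 5 ∣ e := by
    intro h
    have : 5 ∣ NN := h.trans (Dvd.dvd.trans ⟨c, by rw [hce, mul_comm]⟩ hn)
    norm_num [NN] at this
  have he := div40 he h5
  obtain ⟨a, b, c', d, e', f, g, ha, hb, hc', hd, he', hf, hg, hcc, ⟨z2, z3, z7, z19, z41, z83, z367⟩, ⟨y2, y3, y7, y19, y41, y83, y367⟩, y412, -, -⟩ := dvd_full hc
  have e1 := le_antisymm hb (y3 h3)
  have e2 := le_antisymm hc' (y7 h7)
  have e3 := z19 h19
  have e5 := z367 h367
  have e7 := y412 h41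
  clear z2 z3 z7 z19 z41 z83 z367 y2 y3 y7 y19 y41 y83 y367 y412 h3 h7 h41 h19 h367 hb hc' hd hg he' hc
  subst e1 e2 e3 e5 e7 hcc hce
  refine ⟨f, a, ?_, ha, ?_, by ring⟩
  all_goals
    clear h5
    revert hm hm7 hn
    interval_cases f <;> interval_cases a <;> (rcases he with rfl | rfl | rfl | rfl <;> norm_num [NN] <;> omega)

theorem exT (hG : Hyp G) {R U V : Subgroup G} (h : Cfg R U V) : ∃ T, T ≤ Ce R ∧ T ≤ Ce U ∧ Nat.card T = 3 := by
  obtain ⟨T0, hT0R, hT0⟩ := exists_sub_card1 3 (H := Ce R) (by rw [(S4a hG h.hR).1]; norm_num)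
  exact ⟨T0, hT0R, cent_of_cop h.hU (hT0R.trans ((Ce_le_Nm R).trans h.hRU)) (by rw [hT0]; norm_num), hT0⟩

theorem S6 (hG : Hyp G) {R U V : Subgroup G} (h : Cfg R U V) :
    ∃ d f, (d = 1 ∨ d = 3) ∧ f ≤ 4 ∧ Nat.card ↥(Nm U) = 2 ^ 4 * 21 * 41 ^ 2 * 83 ^ d ∧
      Nat.card ↥(Ce U) = 2 ^ f * 21 * 41 ^ 2 * 83 ^ d := by
  obtain ⟨T, -, hTU, hT⟩ := exT hG h
  obtain ⟨e, he, hec⟩ := NC h.hU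
  obtain ⟨n19, n367⟩ := na_Ce hG (r := 41) (A := U) (by norm_num) (by rw [h.hU])
  have hS : IsSyl 7 R (Nm U) := by
    refine IsSyl.mono (H := ⊤) ?_ (Subgroup.le_normalizer.trans h.hRU) le_top
    exact IsSyl.of_card (k := 1) (m := 2 ^ 4 * 3 * 19 * 41 ^ 2 * 83 ^ 3 * 367) le_top
      (by rw [card_top', hG.card]; norm_num [NN]) (by norm_num) (by simpa using h.hR)
  have h1 := Syls_count hS
  rw [inf_eq_right.2 h.hRU, (S4a hG h.hR).2] at h1
  refine s6_arith (sub_dvd hG.card _) (sub_dvd hG.card _) hec he ?_ ?_ ?_ n19 n367 h1 (Syls_mod 7 _)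
  · rw [← hT]; exact Subgroup.card_dvd_of_le hTU
  · rw [← h.hR]; exact Subgroup.card_dvd_of_le (Ce_symm.1 h.hUR)
  · rw [← h.hV]; exact Subgroup.card_dvd_of_le ((abel_sq h.hV).trans (Ce_anti h.hUV))

end
end OD

set_option linter.all false
namespace OD
section
variable {G : Type*} [Group G] [Finite G] {p : ℕ} [hp : Fact p.Prime]

theorem sup_prime_sq {U W V : Subgroup G} (hU : Nat.card U = p) (hW : Nat.card W = p) (hV : Nat.card V = p ^ 2)
    (hUV : U ≤ V) (hWV : W ≤ V) (hne : U ≠ W) : U ⊔ W = V := by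
  have h1 : U ⊔ W ≤ V := sup_le hUV hWV
  have h2 : Nat.card ↥(U ⊔ W) ∣ p ^ 2 := by rw [← hV]; exact Subgroup.card_dvd_of_le h1
  obtain ⟨i, hi, hi2⟩ := (Nat.dvd_prime_pow hp.out).1 h2
  have h3 : i = 2 := by
    by_contra hne2
    have h4 : Nat.card ↥(U ⊔ W) ≤ p := by
      rw [hi2]; calc p ^ i ≤ p ^ 1 := Nat.pow_le_pow_right hp.out.pos (by omega)
        _ = p := pow_one p
    have e1 : U = U ⊔ W := Subgroup.eq_of_le_of_card_ge le_sup_left (by rw [hU]; exact h4)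
    have e2 : W = U ⊔ W := Subgroup.eq_of_le_of_card_ge le_sup_right (by rw [hW]; exact h4)
    exact hne (e1.trans e2.symm)
  exact Subgroup.eq_of_le_of_card_ge h1 (by rw [hi2, h3, hV])

theorem Ce_sup (U W : Subgroup G) : Ce (U ⊔ W) = Ce U ⊓ Ce W := by
  apply le_antisymm
  · exact le_inf (Ce_anti le_sup_left) (Ce_anti le_sup_right)
  · apply Ce_symm.2
    exact sup_le (Ce_symm.2 inf_le_left) (Ce_symm.2 inf_le_right)

theorem s7_arith {n m : ℕ} (hm : m ∣ NN) (h : NN = n * m) (hn : n % 41 = 1) (h41 : 41 ^ 2 ∣ m)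
    (h19 : ¬ 19 ∣ m) (h367 : ¬ 367 ∣ m) : 3 ∣ m := by
  by_contra h3
  obtain ⟨a, b, c', d, e', f, g, ha, hb, hc', hd, he', hf, hg, hcc, ⟨z2, z3, z7, z19, z41, z83, z367⟩, -, y412, -, -⟩ := dvd_full hm
  have e1 := z3 h3
  have e3 := z19 h19
  have e5 := z367 h367
  have e7 := y412 h41
  clear z2 z3 z7 z19 z41 z83 z367 y412 h41 h19 h367 hb hd hg he' hm h3
  subst e1 e3 e5 e7 hcc
  revert h hn
  interval_cases a <;> interval_cases c' <;> interval_cases f <;> norm_num [NN] <;> omega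

theorem S7a (hG : Hyp G) {V : Subgroup G} (hV : Nat.card V = 41 ^ 2) :
    3 ∣ Nat.card ↥(Nm V) ∧ ¬ 19 ∣ Nat.card ↥(Nm V) ∧ ¬ 367 ∣ Nat.card ↥(Nm V) := by
  have n19 : ¬ 19 ∣ Nat.card ↥(Nm V) := by
    intro h
    obtain ⟨P, hP, hPc⟩ := exists_sub_card1 19 h
    have := lemA (r := 41) (by norm_num) (hG.na19 41 (by norm_num)) (IsPGroup.of_card hV) hPc hP
    rw [hV] at this; norm_num at this
  have n367 : ¬ 367 ∣ Nat.card ↥(Nm V) := by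
    intro h
    obtain ⟨P, hP, hPc⟩ := exists_sub_card1 367 h
    have := lemA (r := 41) (by norm_num) (hG.na367 41 (by norm_num)) (IsPGroup.of_card hV) hPc hP
    rw [hV] at this; norm_num at this
  refine ⟨?_, n19, n367⟩
  have hS : IsSyl 41 V ⊤ := IsSyl.of_card (k := 2) (m := 2 ^ 4 * 3 * 7 * 19 * 83 ^ 3 * 367) le_top
      (by rw [card_top', hG.card]; norm_num [NN]) (by norm_num) hV
  have h1 := Syls_count hS
  rw [top_inf_eq, card_top', hG.card] at h1
  exact s7_arith (sub_dvd hG.card _) h1 (Syls_mod 41 _) (by rw [← hV]; exact Subgroup.card_dvd_of_le Subgroup.le_normalizer) n19 n367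

theorem S7 (hG : Hyp G) {R U V : Subgroup G} (h : Cfg R U V) :
    ∃ g : G, g • U ≠ U ∧ g • U ≤ V ∧ Ce U ⊓ Ce (g • U) = Ce V := by
  obtain ⟨T, hTV, hT⟩ := exists_sub_card1 3 (S7a hG h.hV).1
  have h1 : ¬ T ≤ Nm U := by
    intro hTU
    have hTU' : T ≤ Ce U := cent_of_cop h.hU hTU (by rw [hT]; norm_num)
    have h2 := fix_mod (pg_of_card hT) hTV
    have h3 : 41 ∣ Nat.card ↥(V ⊓ Ce T) := by
      rw [← h.hU]; exact Subgroup.card_dvd_of_le (le_inf h.hUV (Ce_symm.1 hTU'))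
    have h4 : Nat.card ↥(V ⊓ Ce T) ∣ 41 ^ 2 := by rw [← h.hV]; exact Subgroup.card_dvd_of_le inf_le_left
    obtain ⟨i, hi, hi2⟩ := (Nat.dvd_prime_pow f41.out).1 h4
    rw [h.hV, hi2] at h2
    have : i = 2 := by
      rw [hi2] at h3
      clear * - hi h2 h3
      interval_cases i
      · norm_num at h3
      · norm_num [Nat.ModEq] at h2
      · rfl
    refine S5 hG hT ?_
    rw [← this, ← hi2]
    exact Subgroup.card_dvd_of_le inf_le_right
  obtain ⟨g, hg, hgU⟩ := SetLike.not_le_iff_exists.1 h1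
  rw [mem_Nm] at hgU
  have h5 : g • U ≤ V := by
    rw [← mem_Nm.1 (hTV hg)]; exact cj_mono h.hUV
  refine ⟨g, hgU, h5, ?_⟩
  rw [← Ce_sup, sup_prime_sq h.hU (by rw [card_cj, h.hU]) h.hV h.hUV h5 (Ne.symm hgU)]

end
end OD

set_option linter.all false
namespace OD
section
variable {G : Type*} [Group G] [Finite G] {p : ℕ} [hp : Fact p.Prime]

theorem set_fix_mod {α : Type*} [MulAction G α] {Q : Subgroup G} (hQ : IsPGroup p Q) {X : Set α} (hX : X.Finite)
    (hi : ∀ q ∈ Q, ∀ x ∈ X, q • x ∈ X) :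
    X.ncard ≡ {x | x ∈ X ∧ ∀ q ∈ Q, q • x = x}.ncard [MOD p] := by
  haveI : Finite X := hX
  letI : MulAction Q X :=
    { smul := fun q x => ⟨(q : G) • (x : α), hi q q.2 x x.2⟩
      one_smul := fun x => by apply Subtype.ext; change (1:G) • (x:α) = x; simp
      mul_smul := fun a b x => by
        apply Subtype.ext
        change ((a:G) * (b:G)) • (x:α) = (a:G) • ((b:G) • (x:α))
        rw [mul_smul] }
  have h := hQ.card_modEq_card_fixedPoints X
  have e1 : Nat.card X = X.ncard := rfl
  rw [e1] at h
  refine h.trans ?_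
  have : Nat.card (MulAction.fixedPoints Q X) = {x | x ∈ X ∧ ∀ q ∈ Q, q • x = x}.ncard := by
    apply Nat.card_congr
    refine ⟨fun y => ⟨y.1.1, y.1.2, fun q hq => congrArg Subtype.val (y.2 ⟨q, hq⟩)⟩,
      fun y => ⟨⟨y.1, y.2.1⟩, fun q => Subtype.ext (y.2.2 q.1 q.2)⟩, fun y => rfl, fun y => rfl⟩
  rw [this]

theorem le_Nm_of {H K : Subgroup G} (h : ∀ g ∈ H, ∀ x ∈ K, g * x * g⁻¹ ∈ K) : H ≤ Nm K := by
  intro g hg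
  rw [mem_Nm]
  refine Subgroup.eq_of_le_of_card_ge ?_ (card_cj g K).ge
  intro x hx
  rw [mem_cj] at hx
  have := h g hg _ hx
  simpa [mul_assoc] using this

theorem syl41 (hG : Hyp G) {V H : Subgroup G} (hV : Nat.card V = 41 ^ 2) (h : V ≤ H) : IsSyl 41 V H := by
  refine IsSyl.mono (H := ⊤) ?_ h le_top
  exact IsSyl.of_card (k := 2) (m := 2 ^ 4 * 3 * 7 * 19 * 83 ^ 3 * 367) le_top
      (by rw [card_top', hG.card]; norm_num [NN]) (by norm_num) hV

theorem lemStar (hG : Hyp G) {R U V N : Subgroup G} (h : Cfg R U V) (hN : N ≤ Ce U) (hn : Ce U ≤ Nm N)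
    (hV : V ≤ N) : 7 ∣ Nat.card N := by
  by_contra h7
  have h1 := frattini_dvd (syl41 hG h.hV hV) hN hn
  have h2 : 7 ∣ Nat.card ↥(Ce U ⊓ Nm V) := by
    refine cop_dvd f7.out h1 ?_ h7
    rw [← h.hR]; exact Subgroup.card_dvd_of_le (Ce_symm.1 h.hUR)
  obtain ⟨R', hR', hc⟩ := exists_sub_card1 7 h2
  exact lemB hG hc h.hV (hR'.trans inf_le_right) h.hUV h.hU (Ce_symm.1 (hR'.trans inf_le_left))

theorem div84 {n : ℕ} (h : n ∣ 2 ^ 4 * 21 * 41) (h1 : n % 83 = 1) : n = 1 ∨ n = 84 := by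
  have : ∀ n ∈ Nat.divisors (2 ^ 4 * 21 * 41), n % 83 = 1 → n = 1 ∨ n = 84 := by
    intro n hn h
    obtain ⟨m, hm⟩ := Nat.dvd_of_mem_divisors hn
    clear hn
    by_cases h1 : n < 83
    · left; omega
    · have h2 : 84 ≤ n := by omega
      have h3 : m ≤ 164 := by nlinarith
      have h4 : (n * m) % 83 = 81 := by rw [← hm]; norm_num
      rw [Nat.mul_mod, h, one_mul, Nat.mod_mod] at h4
      have h5 : m = 81 ∨ m = 164 := by omega
      rcases h5 with rfl | rfl
      · omega
      · right; omega
  exact this n (by simpa using h) h1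

theorem s8_dvd {n m f d : ℕ} (hf : f ≤ 4) (h : 2 ^ f * 21 * 41 ^ 2 * 83 ^ d = n * m) (hm : 41 ^ 1 * 83 ^ d ∣ m) :
    n ∣ 2 ^ 4 * 21 * 41 := by
  have h1 : n * (41 ^ 1 * 83 ^ d) ∣ (2 ^ f * 21 * 41) * (41 ^ 1 * 83 ^ d) := by
    refine (Nat.mul_dvd_mul_left _ hm).trans ?_
    rw [← h]; exact ⟨1, by ring⟩
  have h2 := Nat.dvd_of_mul_dvd_mul_right (by positivity) h1
  refine h2.trans ?_
  exact Nat.mul_dvd_mul_right (Nat.mul_dvd_mul_right (Nat.pow_dvd_pow _ hf) _) _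

theorem not83 {f : ℕ} : ¬ 83 ∣ 2 ^ f * 21 * 41 ^ 2 := by
  intro h
  have h1 : Nat.Coprime 83 (2 ^ f * 21 * 41 ^ 2) := by
    simp only [Nat.coprime_mul_iff_right]
    exact ⟨⟨Nat.Coprime.pow_right _ (by norm_num), by norm_num⟩, Nat.Coprime.pow_right _ (by norm_num)⟩
  exact (Nat.Prime.coprime_iff_not_dvd f83.out).1 h1 h

theorem S8y (hG : Hyp G) {R U V : Subgroup G} (h : Cfg R U V) {d f : ℕ} 
    (hC : Nat.card ↥(Ce U) = 2 ^ f * 21 * 41 ^ 2 * 83 ^ d) {Y : Subgroup G} (hY : IsSyl 83 Y (Ce U)) :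
    Nat.card Y = 83 ^ d := hY.card_eq (hC.trans (mul_comm _ _)) not83

theorem S8a (hG : Hyp G) {R U V : Subgroup G} (h : Cfg R U V) {d f : ℕ} (hd : d = 1 ∨ d = 3) (hf : f ≤ 4)
    (hC : Nat.card ↥(Ce U) = 2 ^ f * 21 * 41 ^ 2 * 83 ^ d) : (Syls 83 (Ce U)).ncard = 84 := by
  obtain ⟨Y, hY⟩ := IsSyl.exists 83 (Ce U)
  have hYc := S8y hG h hC hY
  have h1 := Syls_count hY
  have h2 := Syls_mod 83 (Ce U)
  have h3 : 41 ^ 1 * 83 ^ d ∣ Nat.card ↥(Ce U ⊓ Nm Y) := mul_dvd_card (by norm_num)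
    (by rw [pow_one, ← h.hU]; exact Subgroup.card_dvd_of_le (le_inf (le_Ce_of_prime h.hU) ((Ce_symm.1 hY.1).trans (Ce_le_Nm Y))))
    (by rw [← hYc]; exact Subgroup.card_dvd_of_le (le_inf hY.1 Subgroup.le_normalizer))
  rw [hC] at h1
  rcases div84 (s8_dvd hf h1 h3) h2 with h4 | h4
  · exfalso
    have h5 := normal_of_Syls_one hY h4
    have h6 := lemA (by norm_num) hG.na7 hY.pg h.hR ((Ce_symm.1 h.hUR).trans h5)
    rw [hYc] at h6
    rcases hd with rfl | rfl <;> norm_num at h6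
  · exact h4

theorem fin84 {s t : ℕ} (h1 : 84 ≡ s [MOD 41]) (h2 : s ≡ t [MOD 83]) (ht : t ≤ 1) (hs : s ≤ 84) : s = 84 := by
  unfold Nat.ModEq at *
  obtain rfl | rfl : t = 0 ∨ t = 1 := by omega
  · norm_num at h1 h2; omega
  · norm_num at h1 h2; omega

theorem fin84' {s : ℕ} (h1 : 84 ≡ s [MOD 83]) (hs : s ≤ 84) : s = 1 ∨ s = 84 := by
  unfold Nat.ModEq at *
  omega

theorem S8b (hG : Hyp G) {R U V : Subgroup G} (h : Cfg R U V) {d f : ℕ} (hd : d = 1 ∨ d = 3) (hf : f ≤ 4)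
    (hC : Nat.card ↥(Ce U) = 2 ^ f * 21 * 41 ^ 2 * 83 ^ d) {F : Subgroup G} (hF : IsPGroup 83 F) (hFV : F ≤ Ce V)
    {Y : Subgroup G} (hY : IsSyl 83 Y (Ce U)) : F ≤ Y := by
  have h84 := S8a hG h hd hf hC
  have hVC : V ≤ Ce U := (abel_sq h.hV).trans (Ce_anti h.hUV)
  have hFC : F ≤ Ce U := hFV.trans (Ce_anti h.hUV)
  have hfin : (Syls 83 (Ce U)).Finite := Set.toFinite _
  have key : ∀ Z, IsSyl 83 Z (Ce U) → ∀ q ∈ F, q • Z = Z := by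
    have m1 := set_fix_mod hF hfin (fun q hq x hx => IsSyl.cj_mem hx (hFC hq))
    rw [h84] at m1
    have l1 : {x | x ∈ Syls 83 (Ce U) ∧ ∀ q ∈ F, q • x = x}.ncard ≤ 84 := by
      rw [← h84]; exact Set.ncard_le_ncard (fun x hx => hx.1) hfin
    rcases fin84' m1 l1 with e | e
    · exfalso
      have m2 := set_fix_mod (IsPGroup.of_card h.hV) hfin (fun q hq x hx => IsSyl.cj_mem hx (hVC hq))
      rw [h84] at m2
      have l2 : {x | x ∈ Syls 83 (Ce U) ∧ ∀ q ∈ V, q • x = x}.ncard ≤ 84 := by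
        rw [← h84]; exact Set.ncard_le_ncard (fun x hx => hx.1) hfin
      have m3 := set_fix_mod (X := {x | x ∈ Syls 83 (Ce U) ∧ ∀ q ∈ V, q • x = x}) hF (Set.toFinite _) (by
        rintro q hq x ⟨hx, hx2⟩
        refine ⟨IsSyl.cj_mem hx (hFC hq), ?_⟩
        intro v hv
        rw [← mul_smul, mem_Ce.1 (hFV hq) v hv, mul_smul, hx2 v hv])
      have l3 := Set.ncard_le_ncard (s := {x | x ∈ {x | x ∈ Syls 83 (Ce U) ∧ ∀ q ∈ V, q • x = x} ∧ ∀ q ∈ F, q • x = x})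
        (t := {x | x ∈ Syls 83 (Ce U) ∧ ∀ q ∈ F, q • x = x}) (fun x hx => ⟨hx.1.1, hx.2⟩) (Set.toFinite _)
      rw [e] at l3
      have e2 := fin84 m2 m3 l3 l2
      have e3 : {x | x ∈ Syls 83 (Ce U) ∧ ∀ q ∈ V, q • x = x} = Syls 83 (Ce U) :=
        Set.eq_of_subset_of_ncard_le (fun x hx => hx.1) (by rw [e2, h84]) hfin
      have h7 := lemStar hG h (N := Ce U ⊓ ⨅ Z ∈ Syls 83 (Ce U), Nm Z) inf_le_left (by
        apply le_Nm_of
        intro g hg x hx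
        rw [Subgroup.mem_inf] at hx ⊢
        refine ⟨mul_mem (mul_mem hg hx.1) (inv_mem hg), ?_⟩
        simp only [Subgroup.mem_iInf] at hx ⊢
        intro Z hZ
        have := hx.2 (g⁻¹ • Z) (IsSyl.cj_mem hZ (inv_mem hg))
        rw [mem_Nm] at this ⊢
        rw [mul_smul, mul_smul, this, smul_inv_smul]) (by
        refine le_inf hVC ?_
        intro v hv
        simp only [Subgroup.mem_iInf]
        intro Z hZ
        rw [← e3] at hZ
        rw [mem_Nm]
        exact hZ.2 v hv)
      have h8 : 7 ∣ Nat.card ↥(Ce U ⊓ Nm Y) := h7.trans (Subgroup.card_dvd_of_le (inf_le_inf_left _ (iInf₂_le Y hY)))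
      have h9 := Syls_count hY
      rw [h84, hC] at h9
      obtain ⟨k, hk⟩ := h8
      rw [hk] at h9
      have h10 : 7 ∣ 2 ^ f * 41 ^ 2 * 83 ^ d := by
        refine ⟨4 * k, ?_⟩
        apply Nat.eq_of_mul_eq_mul_left (show 0 < 21 by norm_num)
        calc 21 * (2 ^ f * 41 ^ 2 * 83 ^ d) = 2 ^ f * 21 * 41 ^ 2 * 83 ^ d := by ring
          _ = _ := by rw [h9]; ring
      have h11 : Nat.Coprime 7 (2 ^ f * 41 ^ 2 * 83 ^ d) := by
        simp only [Nat.coprime_mul_iff_right]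
        refine ⟨⟨?_, ?_⟩, ?_⟩ <;> exact Nat.Coprime.pow_right _ (by norm_num)
      exact (Nat.Prime.coprime_iff_not_dvd f7.out).1 h11 h10
    · have e3 : {x | x ∈ Syls 83 (Ce U) ∧ ∀ q ∈ F, q • x = x} = Syls 83 (Ce U) :=
        Set.eq_of_subset_of_ncard_le (fun x hx => hx.1) (by rw [e, h84]) hfin
      intro Z hZ
      have : Z ∈ Syls 83 (Ce U) := hZ
      rw [← e3] at this
      exact this.2
  refine IsSyl.le_of_normal (H := Ce U ⊓ Nm Y) (hY.mono (le_inf hY.1 Subgroup.le_normalizer) inf_le_left) inf_le_right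
    (le_inf hFC ?_) hF
  intro q hq
  rw [mem_Nm]; exact key Y hY q hq

theorem s8_final {o m f : ℕ} (h : 2 ^ f * 21 * 41 ^ 2 * 83 ^ 3 = o * m) (h7 : ¬ 7 ∣ m) (h83 : ¬ 83 ^ 2 ∣ m) : 6973 < o := by
  have ho : 0 < o := by
    rcases Nat.eq_zero_or_pos o with rfl | h'
    · rw [zero_mul] at h; have : 0 < 2 ^ f * 21 * 41 ^ 2 * 83 ^ 3 := by positivity
      rw [h] at this; exact absurd this (lt_irrefl _)
    · exact h'
  have a1 : 7 ∣ o := by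
    have : 7 ∣ o * m := by rw [← h]; exact ⟨2 ^ f * 3 * 41 ^ 2 * 83 ^ 3, by ring⟩
    exact (f7.out.dvd_mul.1 this).resolve_right h7
  have a2 : 83 ^ 2 ∣ o := by
    have h3 : 83 ^ 3 ∣ o * m := by rw [← h]; exact ⟨2 ^ f * 21 * 41 ^ 2, by ring⟩
    by_cases hm : 83 ∣ m
    · obtain ⟨k, rfl⟩ := hm
      have h4 : ¬ 83 ∣ k := by
        rintro ⟨j, rfl⟩; exact h83 ⟨j, by ring⟩
      have h5 : 83 * 83 ^ 2 ∣ 83 * (o * k) := by convert h3 using 1 <;> ring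
      have h6 := Nat.dvd_of_mul_dvd_mul_left (by norm_num) h5
      exact Nat.Coprime.dvd_of_dvd_mul_right (Nat.Coprime.pow_left _ ((Nat.Prime.coprime_iff_not_dvd f83.out).2 h4)) h6
    · exact (Dvd.dvd.trans ⟨83, by norm_num⟩ (Nat.Coprime.dvd_of_dvd_mul_right (Nat.Coprime.pow_left _ ((Nat.Prime.coprime_iff_not_dvd f83.out).2 hm)) h3))
  have a3 : 7 * 83 ^ 2 ∣ o := Nat.Coprime.mul_dvd_of_dvd_of_dvd (by norm_num) a1 a2
  have := Nat.le_of_dvd ho a3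
  omega

/-- main S8 -/
theorem S8 (hG : Hyp G) {V : Subgroup G} (hV : Nat.card V = 41 ^ 2) : ¬ 83 ∣ Nat.card ↥(Ce V) := by
  obtain ⟨R, U, V', h⟩ := exCfg hG
  obtain ⟨g0, rfl⟩ := conj41 hG h.hV hV
  rw [Ce_cj, card_cj]
  clear hV g0
  rename' V' => V
  intro h83
  obtain ⟨d, f, hd, hf, hN, hC⟩ := S6 hG h
  have h84 := S8a hG h hd hf hC
  have hb := fun (F : Subgroup G) => S8b hG h hd hf hC (F := F)
  obtain ⟨F, hF⟩ := IsSyl.exists 83 (Ce V)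
  have hall := fun Y hY => hb F hF.pg hF.1 (Y := Y) hY
  obtain ⟨i, hi⟩ := hF.pg.exists_card_eq
  have hi1 : 1 ≤ i := by
    have := hF.dvd h83
    rw [hi] at this
    rcases Nat.eq_zero_or_pos i with rfl | h'
    · norm_num at this
    · exact h'
  have hne : ∀ E : Subgroup G, Nat.card E = 83 ^ d → ¬ (∀ Y, IsSyl 83 Y (Ce U) → E ≤ Y) := by
    intro E hE hY
    have : (Syls 83 (Ce U)) ⊆ {E} := by
      intro Y hY'
      exact (Subgroup.eq_of_le_of_card_ge (hY Y hY') (by rw [S8y hG h hC hY', hE])).symm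
    have := Set.ncard_le_ncard this
    rw [h84, Set.ncard_singleton] at this
    norm_num at this
  obtain ⟨Y, hY⟩ := IsSyl.exists 83 (Ce U)
  have hid : i ≤ d := by
    have := Subgroup.card_dvd_of_le (hall Y hY)
    rw [hi, S8y hG h hC hY] at this
    exact (Nat.pow_dvd_pow_iff_le_right (by norm_num)).1 this
  have hid2 : i ≠ d := by
    rintro rfl
    exact hne F hi hall
  have hd3 : d = 3 := by
    clear * - hd hid hid2 hi1
    omega
  subst hd3
  clear hd
  have hi12 : i = 1 ∨ i = 2 := by
    clear * - hid hid2 hi1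
    omega
  rcases hi12 with rfl | rfl
  · obtain ⟨g, hg1, hg2, hg3⟩ := S7 hG h
    have ho := orb_stab (Ce U) (g • U)
    rw [stab_eq, hC] at ho
    have h7 : ¬ 7 ∣ Nat.card ↥(Ce U ⊓ Nm (g • U)) := by
      intro h7
      obtain ⟨R', hR', hc⟩ := exists_sub_card1 7 h7
      have h1 : R' ≤ Ce (g • U) := cent_of_cop (p := 41) (by rw [card_cj, h.hU]) (hR'.trans inf_le_right) (by rw [hc]; norm_num)
      have h2 : R' ≤ Ce V := by rw [← hg3]; exact le_inf (hR'.trans inf_le_left) h1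
      exact lemB hG hc h.hV (h2.trans (Ce_le_Nm V)) h.hUV h.hU (Ce_symm.1 (hR'.trans inf_le_left))
    have h83' : ¬ 83 ^ 2 ∣ Nat.card ↥(Ce U ⊓ Nm (g • U)) := by
      intro h7
      obtain ⟨R', hR', hc⟩ := exists_sub_card h7
      have h1 : R' ≤ Ce (g • U) := cent_of_cop (p := 41) (by rw [card_cj, h.hU]) (hR'.trans inf_le_right) (by rw [hc]; norm_num)
      have h2 : R' ≤ Ce V := by rw [← hg3]; exact le_inf (hR'.trans inf_le_left) h1
      have h3 : 83 ^ 2 ∣ Nat.card ↥(Ce V) := by rw [← hc]; exact Subgroup.card_dvd_of_le h2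
      have h4 := hF.pow_dvd h3
      rw [hi] at h4
      norm_num at h4
    have hlt := s8_final ho h7 h83'
    have ho2 := orb_stab (⊤ : Subgroup G) U
    rw [top_inf_eq, stab_eq, hN, card_top', hG.card] at ho2
    have hle : (MulAction.orbit (Ce U) (g • U)).ncard ≤ (MulAction.orbit (⊤ : Subgroup G) U).ncard := by
      apply Set.ncard_le_ncard _ (Set.toFinite _)
      rintro _ ⟨c, rfl⟩
      refine ⟨⟨c.1 * g, trivial⟩, ?_⟩
      change (c.1 * g) • U = c.1 • (g • U)
      rw [mul_smul]
    clear * - hlt ho2 hle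
    norm_num [NN] at ho2
    omega
  · have hE : F = Ce U ⊓ ⨅ Z ∈ Syls 83 (Ce U), Z := by
      have hle : F ≤ Ce U ⊓ ⨅ Z ∈ Syls 83 (Ce U), Z :=
        le_inf (hF.1.trans (Ce_anti h.hUV)) (le_iInf₂ hall)
      refine Subgroup.eq_of_le_of_card_ge hle ?_
      have h2 : Nat.card ↥(Ce U ⊓ ⨅ Z ∈ Syls 83 (Ce U), Z) ∣ 83 ^ 3 := by
        rw [← S8y hG h hC hY]
        exact Subgroup.card_dvd_of_le (inf_le_right.trans (iInf₂_le Y hY))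
      obtain ⟨j, hj, hj2⟩ := (Nat.dvd_prime_pow f83.out).1 h2
      have : j ≠ 3 := by
        rintro rfl
        exact hne _ hj2 (fun Z hZ => inf_le_right.trans (iInf₂_le Z hZ))
      rw [hj2, hi]
      exact Nat.pow_le_pow_right (by norm_num) (by omega)
    have hnF : Ce U ≤ Nm F := by
      apply le_Nm_of
      intro g hg x hx
      rw [hE] at hx ⊢
      rw [Subgroup.mem_inf] at hx ⊢
      refine ⟨mul_mem (mul_mem hg hx.1) (inv_mem hg), ?_⟩
      simp only [Subgroup.mem_iInf] at hx ⊢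
      intro Z hZ
      have := hx.2 (g⁻¹ • Z) (IsSyl.cj_mem hZ (inv_mem hg))
      rw [mem_cj] at this
      simpa using this
    have h7 := lemStar hG h (N := Ce U ⊓ Ce F) inf_le_left (by
      intro g hg
      rw [mem_Nm, cj_inf, cj_eq_of_mem hg, ← Ce_cj, mem_Nm.1 (hnF hg)]) (le_inf ((abel_sq h.hV).trans (Ce_anti h.hUV)) (Ce_symm.1 hF.1))
    have h8 : 7 ∣ Nat.card ↥(Ce F) := h7.trans (Subgroup.card_dvd_of_le inf_le_right)
    exact card_ad hG (by norm_num) (fun h => hG.na7 (ad_symm h)) (l := 83) (r := 7) (A := F) (by rw [hi]; norm_num) h8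

end
end OD

set_option linter.all false
namespace OD
section
variable {G : Type*} [Group G] [Finite G] {p : ℕ} [hp : Fact p.Prime]

open Classical in
theorem count_sub {X Z : Subgroup G} {𝒮 : Set (Subgroup G)} {a : ℕ} (hZX : Z ≤ X)
    (h1 : ∀ S ∈ 𝒮, S ≤ X ∧ Z ≤ S ∧ Nat.card S = a)
    (h2 : ∀ S ∈ 𝒮, ∀ T ∈ 𝒮, S ≠ T → S ⊓ T ≤ Z) : 𝒮.ncard * (a - Nat.card Z) + Nat.card Z ≤ Nat.card X := by
  have hf : 𝒮.Finite := Set.toFinite _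
  let F : Finset (Subgroup G) := hf.toFinset
  have hF : ∀ S, S ∈ F ↔ S ∈ 𝒮 := fun S => hf.mem_toFinset
  let e : Subgroup G → Finset G := fun S => (Set.toFinite ((S : Set G) \ (Z : Set G))).toFinset
  have he : ∀ S x, x ∈ e S ↔ x ∈ S ∧ x ∉ Z := fun S x => by simp [e]
  have hdisj : (F : Set (Subgroup G)).PairwiseDisjoint e := by
    intro S hS T hT hST
    rw [Function.onFun, Finset.disjoint_left]
    intro x hx hx'
    rw [he] at hx hx'
    exact hx.2 (h2 S ((hF S).1 hS) T ((hF T).1 hT) hST ⟨hx.1, hx'.1⟩)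
  have hc : ∀ S ∈ F, (e S).card = a - Nat.card Z := by
    intro S hS
    obtain ⟨-, hZS, hSa⟩ := h1 S ((hF S).1 hS)
    have := Set.ncard_diff_add_ncard_of_subset (s := (Z : Set G)) (t := (S : Set G)) hZS
    rw [Set.ncard_eq_toFinset_card _] at this
    have e1 : (Z : Set G).ncard = Nat.card Z := rfl
    have e2 : (S : Set G).ncard = Nat.card S := rfl
    rw [e1, e2, hSa] at this
    exact (Nat.sub_eq_of_eq_add this.symm).symm
  have hsum : (F.biUnion e).card = F.card * (a - Nat.card Z) := by
    rw [Finset.card_biUnion hdisj, Finset.sum_congr rfl hc, Finset.sum_const, smul_eq_mul]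
  have hFc : F.card = 𝒮.ncard := (Set.ncard_eq_toFinset_card _ hf).symm
  let z : Finset G := (Set.toFinite (Z : Set G)).toFinset
  have hz : z.card = Nat.card Z := (Set.ncard_eq_toFinset_card _ _).symm
  let x : Finset G := (Set.toFinite (X : Set G)).toFinset
  have hx : x.card = Nat.card X := (Set.ncard_eq_toFinset_card _ _).symm
  have hd : Disjoint (F.biUnion e) z := by
    rw [Finset.disjoint_left]
    intro y hy hyz
    obtain ⟨S, -, hS⟩ := Finset.mem_biUnion.1 hy
    rw [he] at hS
    exact hS.2 (by simpa [z] using hyz)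
  rw [← hFc, ← hsum, ← hz, ← hx, ← Finset.card_union_of_disjoint hd]
  apply Finset.card_le_card
  intro y hy
  rcases Finset.mem_union.1 hy with hy | hy
  · obtain ⟨S, hSF, hS⟩ := Finset.mem_biUnion.1 hy
    rw [he] at hS
    have := (h1 S ((hF S).1 hSF)).1 hS.1
    simpa [x] using this
  · have : y ∈ Z := by simpa [z] using hy
    simpa [x] using hZX this

theorem comm_mod {X Z : Subgroup G} (hZX : Z ≤ X) (hZ : X ≤ Ce Z) (hX : Nat.card X = p ^ 3) (hZc : Nat.card Z = p)
    {x y : G} (hx : x ∈ X) (hy : y ∈ X) : x * y * x⁻¹ * y⁻¹ ∈ Z := by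
  let Z' := Z.subgroupOf X
  haveI : Z'.Normal := by
    constructor
    intro n hn g
    have hn' : (n : G) ∈ Z := hn
    have : (g : G) * n * (g : G)⁻¹ = n := by
      rw [← mem_Ce.1 (hZ g.2) _ hn']; group
    change (g : G) * n * (g : G)⁻¹ ∈ Z
    rw [this]; exact hn'
  have hcard : Nat.card (X ⧸ Z') = p ^ 2 := by
    have h1 := Subgroup.card_eq_card_quotient_mul_card_subgroup Z'
    have h2 : Nat.card Z' = p := by
      rw [← hZc]; exact Nat.card_congr (Subgroup.subgroupOfEquivOfLe hZX).toEquiv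
    rw [hX, h2] at h1
    apply Nat.eq_of_mul_eq_mul_right hp.out.pos
    rw [← h1]; ring
  have hcomm := IsPGroup.commutative_of_card_eq_prime_sq hcard
  have h3 := hcomm (QuotientGroup.mk (⟨x, hx⟩ : X)) (QuotientGroup.mk (⟨y, hy⟩ : X))
  rw [← QuotientGroup.mk_mul, ← QuotientGroup.mk_mul] at h3
  have h4 := QuotientGroup.eq.1 h3.symm
  have h5 : ((y * x)⁻¹ * (x * y)) ∈ Z := h4
  have h6 : x * y * x⁻¹ * y⁻¹ = (y * x) * ((y * x)⁻¹ * (x * y)) * (y * x)⁻¹ := by group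
  rw [h6]
  have h7 := mem_Ce.1 (hZ (mul_mem hy hx)) _ h5
  rw [← h7, mul_inv_cancel_right]
  exact h5

/-- elements centralizing `Z` and `D` modulo `Z` -/
def Bsub (Z D J : Subgroup G) : Subgroup G where
  carrier := {h | h ∈ J ∧ h ∈ Ce Z ∧ ∀ d ∈ D, h * d * h⁻¹ * d⁻¹ ∈ Z}
  mul_mem' := by
    rintro a b ⟨ha, ha1, ha2⟩ ⟨hb, hb1, hb2⟩
    refine ⟨mul_mem ha hb, mul_mem ha1 hb1, ?_⟩
    intro d hd
    have h1 := hb2 d hd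
    have h2 := ha2 d hd
    have h3 := mem_Ce.1 ha1 _ h1
    have : a * b * d * (a * b)⁻¹ * d⁻¹ = (b * d * b⁻¹ * d⁻¹) * (a * d * a⁻¹ * d⁻¹) := by
      calc a * b * d * (a * b)⁻¹ * d⁻¹ = (a * (b * d * b⁻¹ * d⁻¹)) * d * a⁻¹ * d⁻¹ := by group
        _ = _ := by rw [← h3]; group
    rw [this]; exact mul_mem h1 h2
  one_mem' := ⟨one_mem _, one_mem _, fun d hd => by simp⟩
  inv_mem' := by
    rintro a ⟨ha, ha1, ha2⟩
    refine ⟨inv_mem ha, inv_mem ha1, ?_⟩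
    intro d hd
    have h2 := ha2 d hd
    have h3 := mem_Ce.1 ha1 _ (inv_mem h2)
    have : a⁻¹ * d * a⁻¹⁻¹ * d⁻¹ = (a * d * a⁻¹ * d⁻¹)⁻¹ := by
      calc a⁻¹ * d * a⁻¹⁻¹ * d⁻¹ = a⁻¹ * ((a * d * a⁻¹ * d⁻¹)⁻¹ * a) := by group
        _ = _ := by rw [h3]; group
    rw [this]; exact inv_mem h2

theorem Bsub_card {Z D J : Subgroup G} (hZ : Nat.card Z = p) (hD : Nat.card D = p ^ 2) (hZD : Z ≤ D) :
    ∃ k, Nat.card ↥(Bsub Z D J) ∣ Nat.card ↥(Ce D) * k ∧ k ∣ p := by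
  have h0 : ∃ d ∈ D, d ∉ Z := by
    by_contra hcon
    push Not at hcon
    have := Subgroup.card_dvd_of_le (show D ≤ Z from hcon)
    rw [hZ, hD] at this
    have := Nat.le_of_dvd hp.out.pos this
    have := hp.out.one_lt
    nlinarith
  obtain ⟨d, hd, hdZ⟩ := h0
  let φ : ↥(Bsub Z D J) →* Z :=
    { toFun := fun b => ⟨b * d * (b : G)⁻¹ * d⁻¹, b.2.2.2 d hd⟩
      map_one' := by apply Subtype.ext; simp
      map_mul' := by
        rintro ⟨a, ha, ha1, ha2⟩ ⟨b, hb, hb1, hb2⟩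
        apply Subtype.ext
        change a * b * d * (a * b)⁻¹ * d⁻¹ = (a * d * a⁻¹ * d⁻¹) * (b * d * b⁻¹ * d⁻¹)
        have h1 := hb2 d hd
        have h2 := ha2 d hd
        have h3 := mem_Ce.1 ha1 _ h1
        have h4 := mem_Ce.1 (le_Ce_of_prime hZ h1) _ h2
        rw [h4]
        calc a * b * d * (a * b)⁻¹ * d⁻¹ = (a * (b * d * b⁻¹ * d⁻¹)) * d * a⁻¹ * d⁻¹ := by group
          _ = _ := by rw [← h3]; group }
  refine ⟨Nat.card φ.range, ?_, ?_⟩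
  · have h1 := Subgroup.card_mul_index φ.ker
    rw [Subgroup.index_ker] at h1
    rw [← h1]
    apply Nat.mul_dvd_mul_right
    have : Nat.card φ.ker = Nat.card ↥(φ.ker.map (Bsub Z D J).subtype) := by
      rw [Subgroup.card_subtype]
    rw [this]
    apply Subgroup.card_dvd_of_le
    rintro _ ⟨⟨b, hb, hb1, hb2⟩, hk, rfl⟩
    have hk2 : b * d * b⁻¹ * d⁻¹ = 1 := congrArg Subtype.val (MonoidHom.mem_ker.1 hk)
    -- the centralizer of b contains Z and d
    have hle : D ≤ Subgroup.centralizer {b} := by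
      have hZb : Z ≤ Subgroup.centralizer {b} := by
        intro z hz
        rw [Subgroup.mem_centralizer_singleton_iff]
        exact (mem_Ce.1 hb1 z hz)
      have hdb : d ∈ Subgroup.centralizer {b} := by
        rw [Subgroup.mem_centralizer_singleton_iff]
        have := mul_eq_of_eq_mul_inv (show b * d * b⁻¹ = 1 * d⁻¹⁻¹ from eq_mul_inv_of_mul_eq hk2)
        have h8 : b * d * b⁻¹ = d := by simpa using eq_mul_inv_of_mul_eq hk2
        have h9 : b * d = d * b := by
          calc b * d = (b * d * b⁻¹) * b := by group
            _ = d * b := by rw [h8]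
        exact h9.symm
      have hlt : Z < D ⊓ Subgroup.centralizer {b} := by
        refine lt_of_le_of_ne (le_inf hZD hZb) ?_
        intro h
        exact hdZ (h ▸ ⟨hd, hdb⟩)
      have hc1 : Nat.card ↥(D ⊓ Subgroup.centralizer {b}) ∣ p ^ 2 := by
        rw [← hD]; exact Subgroup.card_dvd_of_le inf_le_left
      obtain ⟨i, hi, hi2⟩ := (Nat.dvd_prime_pow hp.out).1 hc1
      have hi3 : i = 2 := by
        by_contra hne
        have : Nat.card ↥(D ⊓ Subgroup.centralizer {b}) ≤ Nat.card Z := by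
          rw [hi2, hZ]; calc p ^ i ≤ p ^ 1 := Nat.pow_le_pow_right hp.out.pos (by omega)
            _ = p := pow_one p
        exact hlt.ne (Subgroup.eq_of_le_of_card_ge hlt.le this)
      have := Subgroup.eq_of_le_of_card_ge (inf_le_left : D ⊓ Subgroup.centralizer {b} ≤ D) (by rw [hi2, hi3, hD])
      rw [← this]; exact inf_le_right
    refine mem_Ce.2 ?_
    intro x hx
    exact (Subgroup.mem_centralizer_singleton_iff.1 (hle hx))
  · rw [← hZ]; exact Subgroup.card_subgroup_dvd_card _

end
end OD

set_option linter.all false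
namespace OD
section
variable {G : Type*} [Group G] [Finite G] {p : ℕ} [hp : Fact p.Prime]

theorem syl83 (hG : Hyp G) {V H : Subgroup G} (hV : Nat.card V = 83 ^ 3) (h : V ≤ H) : IsSyl 83 V H := by
  refine IsSyl.mono (H := ⊤) ?_ h le_top
  exact IsSyl.of_card (k := 3) (m := 2 ^ 4 * 3 * 7 * 19 * 41 ^ 2 * 367) le_top
      (by rw [card_top', hG.card]; norm_num [NN]) (by norm_num) hV

theorem syl83_card (hG : Hyp G) {V H : Subgroup G} (hV : IsSyl 83 V H) (h : 83 ^ 3 ∣ Nat.card H) : Nat.card V = 83 ^ 3 := by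
  obtain ⟨i, hi, hi2⟩ := syl_exp hG (k := 3) (m := 2 ^ 4 * 3 * 7 * 19 * 41 ^ 2 * 367) hV.pg (by norm_num [NN]) (by norm_num)
  have := hV.pow_dvd h
  rw [hi2, Nat.pow_dvd_pow_iff_le_right (by norm_num)] at this
  rw [hi2, le_antisymm hi this]

/-- 83 ∣ |D| implies 41^2 does not divide |C(D)| -/
theorem no41 (hG : Hyp G) {D : Subgroup G} (hD : 83 ∣ Nat.card D) : ¬ 41 ^ 2 ∣ Nat.card ↥(Ce D) := by
  intro h
  obtain ⟨V, hV, hVc⟩ := exists_sub_card h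
  exact S8 hG hVc (hD.trans (Subgroup.card_dvd_of_le (Ce_symm.1 hV)))

theorem z_fin {n : ℕ} (h : n ≡ 1 [MOD 83]) (hn : n * (83 - 1) + 1 ≤ 83 ^ 2) : n = 1 ∨ n = 84 := by
  unfold Nat.ModEq at h
  omega

theorem pos_of_mod {n m : ℕ} (h : n = 1 ∨ n = 84) (hm : n ≡ m [MOD 41]) : m ≠ 0 := by
  unfold Nat.ModEq at hm
  rintro rfl
  rcases h with rfl | rfl <;> norm_num at hm

theorem frat83 {h k a b : ℕ} (he : h * a = k * b) (h3 : 83 ^ 3 ∣ h) (ha : 83 ^ 2 ∣ a) (hk : ¬ 83 ^ 3 ∣ k) (hk0 : k ≠ 0) (hb0 : b ≠ 0) : 83 ^ 3 ∣ b := by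
  have hp := f83.out
  have h1 : h * a ≠ 0 := by rw [he]; exact mul_ne_zero hk0 hb0
  have hh0 : h ≠ 0 := left_ne_zero_of_mul h1
  have ha0 : a ≠ 0 := right_ne_zero_of_mul h1
  rw [hp.pow_dvd_iff_le_factorization hh0] at h3
  rw [hp.pow_dvd_iff_le_factorization ha0] at ha
  rw [hp.pow_dvd_iff_le_factorization hk0] at hk
  rw [hp.pow_dvd_iff_le_factorization hb0]
  have h2 := congrArg (fun x => x.factorization 83) he
  simp only [Nat.factorization_mul hh0 ha0, Nat.factorization_mul hk0 hb0, Finsupp.add_apply] at h2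
  omega

theorem lemL (hG : Hyp G) {D : Subgroup G} (hD : Nat.card D = 83 ^ 2) (h83 : 83 ^ 3 ∣ Nat.card ↥(Nm D))
    (h41 : 41 ^ 2 ∣ Nat.card ↥(Nm D)) : ∃ X : Subgroup G, Nat.card X = 83 ^ 3 ∧ X ≤ Nm D ∧ 41 ∣ Nat.card ↥(Nm D ⊓ Nm X) := by
  have hCD : Ce D ≤ Nm D := Ce_le_Nm D
  have hCn : Nm D ≤ Nm (Ce D) := Nm_le_Nm_Ce D
  have hDd : 83 ∣ Nat.card D := by rw [hD]; norm_num
  have h41' : 41 ∣ Nat.card ↥(Nm D) := Dvd.dvd.trans (by norm_num) h41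
  by_cases hA : 83 ^ 3 ∣ Nat.card ↥(Ce D)
  · obtain ⟨X, hX, hXc⟩ := exists_sub_card hA
    refine ⟨X, hXc, hX.trans hCD, ?_⟩
    have h1 := frattini_dvd (syl83 hG hXc hX) hCD hCn
    by_contra hn
    refine no41 hG hDd ?_
    exact Nat.Coprime.dvd_of_dvd_mul_right (Nat.Coprime.pow_left _ ((Nat.Prime.coprime_iff_not_dvd f41.out).2 hn)) (h41.trans h1)
  by_cases hB : 41 ∣ Nat.card ↥(Ce D)
  · obtain ⟨U, hU⟩ := IsSyl.exists 41 (Ce D)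
    have hUc : Nat.card U = 41 := by
      obtain ⟨i, hi⟩ := hU.pg.exists_card_eq
      have h1 := hU.dvd hB
      have h2 : ¬ 41 ^ 2 ∣ Nat.card U := fun h => no41 hG hDd (h.trans (Subgroup.card_dvd_of_le hU.1))
      rw [hi] at h1 h2
      rw [Nat.pow_dvd_pow_iff_le_right (by norm_num)] at h2
      have : i ≠ 0 := by rintro rfl; norm_num at h1
      rw [hi, show i = 1 by omega, pow_one]
    have h1 := frattini hU hCD hCn
    have h2 : 83 ^ 2 ∣ Nat.card ↥(Ce D ⊓ Nm U) := by
      rw [← hD]; exact Subgroup.card_dvd_of_le (le_inf (abel_sq hD) ((Ce_symm.1 hU.1).trans (Ce_le_Nm U)))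
    have h3 := frat83 h1 h83 h2 hA Nat.card_pos.ne' Nat.card_pos.ne'
    obtain ⟨X, hX, hXc⟩ := exists_sub_card h3
    refine ⟨X, hXc, hX.trans inf_le_left, ?_⟩
    have h4 : X ≤ Ce U := cent_of_cop hUc (hX.trans inf_le_right) (by rw [hXc]; norm_num)
    rw [← hUc]
    exact Subgroup.card_dvd_of_le (le_inf (hU.1.trans hCD) ((Ce_symm.1 h4).trans (Ce_le_Nm X)))
  -- the main case
  have hDX : ∀ X, IsSyl 83 X (Nm D) → D ≤ X := by
    intro X hX
    obtain ⟨Y, hY, hDY⟩ := IsSyl.exists_le (Subgroup.le_normalizer : D ≤ Nm D) (IsPGroup.of_card hD)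
    obtain ⟨g, hg, rfl⟩ := hY.conj hX
    rw [← mem_Nm.1 hg]; exact cj_mono hDY
  have hXc : ∀ X, IsSyl 83 X (Nm D) → Nat.card X = 83 ^ 3 := fun X hX => syl83_card hG hX h83
  have hZc : ∀ X, IsSyl 83 X (Nm D) → Nat.card ↥(D ⊓ Ce X) = 83 := by
    intro X hX
    have h1 := fix_mod hX.pg hX.1
    have h2 : Nat.card ↥(D ⊓ Ce X) ∣ 83 ^ 2 := by rw [← hD]; exact Subgroup.card_dvd_of_le inf_le_left
    obtain ⟨i, hi, hi2⟩ := (Nat.dvd_prime_pow f83.out).1 h2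
    have hi3 : i ≠ 2 := by
      rintro rfl
      have h3 : D ⊓ Ce X = D := Subgroup.eq_of_le_of_card_ge inf_le_left (by rw [hi2, hD])
      have h4 : X ≤ Ce D := Ce_symm.1 (by rw [← h3]; exact inf_le_right)
      exact hA (by rw [← hXc X hX]; exact Subgroup.card_dvd_of_le h4)
    have hi4 : i ≠ 0 := by
      rintro rfl
      rw [hi2, hD] at h1
      norm_num [Nat.ModEq] at h1
    rw [hi2, show i = 1 by omega, pow_one]
  let 𝒵 : Set (Subgroup G) := {Z | ∃ X, IsSyl 83 X (Nm D) ∧ Z = D ⊓ Ce X}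
  have h𝒵inv : ∀ g ∈ Nm D, ∀ Z ∈ 𝒵, g • Z ∈ 𝒵 := by
    rintro g hg _ ⟨X, hX, rfl⟩
    refine ⟨g • X, hX.cj_mem hg, ?_⟩
    rw [cj_inf, Ce_cj, mem_Nm.1 hg]
  obtain ⟨X, hX⟩ := IsSyl.exists 83 (Nm D)
  have h𝒵c : 𝒵.ncard = 1 ∨ 𝒵.ncard = 84 := by
    have h1 := set_fix_mod hX.pg (Set.toFinite 𝒵) (fun q hq => h𝒵inv q (hX.1 hq))
    have h2 : {Z | Z ∈ 𝒵 ∧ ∀ q ∈ X, q • Z = Z} = {D ⊓ Ce X} := by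
      ext Z; constructor
      · rintro ⟨⟨Y, hY, rfl⟩, hfix⟩
        have h3 : X ≤ Nm (D ⊓ Ce Y) := fun q hq => mem_Nm.2 (hfix q hq)
        have h4 : X ≤ Ce (D ⊓ Ce Y) := cent_of_cop (hZc Y hY) h3 (by rw [hXc X hX]; norm_num)
        exact Subgroup.eq_of_le_of_card_ge (le_inf inf_le_left (Ce_symm.1 h4)) (by rw [hZc X hX, hZc Y hY])
      · rintro rfl
        refine ⟨⟨X, hX, rfl⟩, ?_⟩
        intro q hq
        rw [cj_inf, ← Ce_cj, cj_eq_of_mem hq, mem_Nm.1 (hX.1 hq)]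
    rw [h2, Set.ncard_singleton] at h1
    have h5 := count_sub (X := D) (Z := ⊥) (𝒮 := 𝒵) (a := 83) bot_le (by
      rintro _ ⟨Y, hY, rfl⟩
      exact ⟨inf_le_left, bot_le, hZc Y hY⟩) (by
      rintro _ ⟨Y, hY, rfl⟩ _ ⟨Y', hY', rfl⟩ hne
      rw [le_bot_iff]
      by_contra hnb
      have h6 : Nat.card ↥((D ⊓ Ce Y) ⊓ (D ⊓ Ce Y')) ∣ 83 := by
        rw [← hZc Y hY]; exact Subgroup.card_dvd_of_le inf_le_left
      rcases (Nat.dvd_prime f83.out).1 h6 with h7 | h7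
      · exact hnb (Subgroup.card_eq_one.1 h7)
      · have e1 := Subgroup.eq_of_le_of_card_ge (inf_le_left : (D ⊓ Ce Y) ⊓ (D ⊓ Ce Y') ≤ (D ⊓ Ce Y)) (by rw [h7, hZc Y hY])
        have e2 := Subgroup.eq_of_le_of_card_ge (inf_le_right : (D ⊓ Ce Y) ⊓ (D ⊓ Ce Y') ≤ (D ⊓ Ce Y')) (by rw [h7, hZc Y' hY'])
        exact hne (e1.symm.trans e2))
    rw [Subgroup.card_bot, hD] at h5
    exact z_fin h1 h5
  obtain ⟨V, hV, hVc⟩ := exists_sub_card h41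
  have h6 := set_fix_mod (IsPGroup.of_card hVc) (Set.toFinite 𝒵) (fun q hq => h𝒵inv q (hV hq))
  have h7 := pos_of_mod h𝒵c h6
  obtain ⟨Z, ⟨X, hX, rfl⟩, hVZ⟩ := (Set.ncard_pos (Set.toFinite _)).1 (Nat.pos_of_ne_zero h7)
  refine ⟨X, hXc X hX, hX.1, ?_⟩
  have hZX : X ≤ Ce (D ⊓ Ce X) := Ce_symm.1 inf_le_right
  let J := Nm D ⊓ Nm (D ⊓ Ce X)
  let B := Bsub (D ⊓ Ce X) D J
  have hXB : X ≤ B := by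
    intro x hx
    refine ⟨⟨hX.1 hx, Ce_le_Nm _ (hZX hx)⟩, hZX hx, ?_⟩
    intro d hd
    exact comm_mod (inf_le_left.trans (hDX X hX)) hZX (hXc X hX) (hZc X hX) hx (hDX X hX hd)
  have hBJ : B ≤ J := fun x hx => hx.1
  have hJB : J ≤ Nm B := by
    apply le_Nm_of
    rintro g hg x ⟨hx1, hx2, hx3⟩
    refine ⟨mul_mem (mul_mem hg hx1) (inv_mem hg), ?_, ?_⟩
    · have h8 : g ∈ Nm (Ce (D ⊓ Ce X)) := Nm_le_Nm_Ce _ hg.2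
      exact mem_Nm_conj h8 hx2
    · intro d hd
      have hd' : g⁻¹ * d * g ∈ D := by
        have := mem_Nm_conj (inv_mem hg.1) hd; simpa using this
      have h9 := mem_Nm_conj hg.2 (hx3 _ hd')
      have : g * x * g⁻¹ * d * (g * x * g⁻¹)⁻¹ * d⁻¹ = g * (x * (g⁻¹ * d * g) * x⁻¹ * (g⁻¹ * d * g)⁻¹) * g⁻¹ := by group
      rw [this]; exact h9
  have hB41 : ¬ 41 ∣ Nat.card B := by
    intro h
    obtain ⟨k, hk, hk2⟩ := Bsub_card (J := J) (hZc X hX) hD inf_le_left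
    rcases f41.out.dvd_mul.1 (h.trans hk) with h8 | h8
    · exact hB h8
    · have := h8.trans hk2; norm_num at this
  have h8 := frattini_dvd (syl83 hG (hXc X hX) hXB) hBJ hJB
  have h9 : 41 ∣ Nat.card J := by
    have : V ≤ J := le_inf hV (fun v hv => mem_Nm.2 (hVZ v hv))
    have h10 := Subgroup.card_dvd_of_le this
    rw [hVc] at h10
    exact Dvd.dvd.trans (by norm_num) h10
  have h10 := cop_dvd f41.out h8 h9 hB41
  exact h10.trans (Subgroup.card_dvd_of_le (inf_le_inf_right _ inf_le_left))

end
end OD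

set_option linter.all false
namespace OD
section
variable {G : Type*} [Group G] [Finite G] {p : ℕ} [hp : Fact p.Prime]

theorem div_big {n : ℕ} (h : n ∣ 2 ^ 4 * 3 * 7 * 41 ^ 2) (h1 : n % 83 = 1) :
    n = 1 ∨ n = 84 ∨ n = 82 ^ 2 ∨ n = 84 * 82 ^ 2 := by
  have h0 : n ∣ NN := h.trans (by norm_num [NN])
  have z19' : ¬ 19 ∣ n := fun h2 => by have := h2.trans h; norm_num at this
  have z83' : ¬ 83 ∣ n := fun h2 => by have := h2.trans h; norm_num at this
  have z367' : ¬ 367 ∣ n := fun h2 => by have := h2.trans h; norm_num at this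
  obtain ⟨a, b, c', d, e', f, g, ha, hb, hc', hd, he', hf, hg, hcc, ⟨z2, z3, z7, z19, z41, z83, z367⟩, -, -, -, -⟩ := dvd_full h0
  have e1 := z19 z19'
  have e3 := z83 z83'
  have e5 := z367 z367'
  subst e1 e3 e5
  clear z2 z3 z7 z19 z41 z83 z367 h0 z19' z83' z367' h hd hf hg
  subst hcc
  revert h1
  interval_cases a <;> interval_cases b <;> interval_cases c' <;> interval_cases e' <;> norm_num

theorem div656 {n : ℕ} (h : n ∣ 2 ^ 4 * 41) (h1 : n % 83 = 1) : n = 1 := by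
  have : ∀ n ∈ Nat.divisors (2 ^ 4 * 41), n % 83 = 1 → n = 1 := by
    intro n hn h
    obtain ⟨m, hm⟩ := Nat.dvd_of_mem_divisors hn
    clear hn
    by_cases h1 : n < 83
    · omega
    · have h2 : 84 ≤ n := by omega
      have h3 : m ≤ 7 := by nlinarith
      have h4 : (n * m) % 83 = 75 := by rw [← hm]; norm_num
      rw [Nat.mul_mod, h, one_mul, Nat.mod_mod] at h4
      omega
  exact this n (by simpa using h) h1

theorem na83 (hG : Hyp G) {D : Subgroup G} (hD : 83 ∣ Nat.card D) :
    ¬ 3 ∣ Nat.card ↥(Ce D) ∧ ¬ 7 ∣ Nat.card ↥(Ce D) ∧ ¬ 19 ∣ Nat.card ↥(Ce D) ∧ ¬ 367 ∣ Nat.card ↥(Ce D) :=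
  ⟨card_ad hG (l := 83) (by norm_num) (fun h => hG.na3 (ad_symm h)) hD,
   card_ad hG (l := 83) (by norm_num) (fun h => hG.na7 (ad_symm h)) hD,
   na_Ce hG (r := 83) (by norm_num) hD⟩

theorem grow (hG : Hyp G) {D : Subgroup G} (hD : Nat.card D = 83 ^ 2) : 83 ^ 3 ∣ Nat.card ↥(Nm D) :=
  Sylow.prime_pow_dvd_card_normalizer (n := 2) (by rw [hG.card]; norm_num [NN]) hD

theorem Nm83_2 (hG : Hyp G) {D : Subgroup G} (hD : Nat.card D = 83 ^ 2) :
    ¬ 19 ∣ Nat.card ↥(Nm D) ∧ ¬ 367 ∣ Nat.card ↥(Nm D) := by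
  constructor
  · intro h
    obtain ⟨P, hP, hPc⟩ := exists_sub_card1 19 h
    have := lemA (r := 83) (by norm_num) (hG.na19 83 (by norm_num)) (IsPGroup.of_card hD) hPc hP
    rw [hD] at this; norm_num at this
  · intro h
    obtain ⟨P, hP, hPc⟩ := exists_sub_card1 367 h
    have := lemA (r := 83) (by norm_num) (hG.na367 83 (by norm_num)) (IsPGroup.of_card hD) hPc hP
    rw [hD] at this; norm_num at this

/-- number of Sylow 83-subgroups in the normalizer of a subgroup of order 83^2 -/
theorem n83_Nm (hG : Hyp G) {D : Subgroup G} (hD : Nat.card D = 83 ^ 2) :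
    (Syls 83 (Nm D)).ncard ∣ 2 ^ 4 * 3 * 7 * 41 ^ 2 := by
  obtain ⟨X, hX⟩ := IsSyl.exists 83 (Nm D)
  have hXc := syl83_card hG hX (grow hG hD)
  have h1 := Syls_count hX
  have h2 := strip3 (sub_dvd hG.card _) (Nm83_2 hG hD).1 (Nm83_2 hG hD).2
  rw [h1] at h2
  have h3 : 83 ^ 3 ∣ Nat.card ↥(Nm D ⊓ Nm X) := by
    rw [← hXc]; exact Subgroup.card_dvd_of_le (le_inf hX.1 Subgroup.le_normalizer)
  exact Nat.dvd_of_mul_dvd_mul_right (by norm_num) ((Nat.mul_dvd_mul_left _ h3).trans h2)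

theorem two_le_Q (hG : Hyp G) {Y : Subgroup G} (hY : Nat.card Y = 83) : 83 ^ 2 ∣ Nat.card ↥(Ce Y) := by
  obtain ⟨X, hX, hYX⟩ := IsSyl.exists_le (le_top : Y ≤ ⊤) (pg_of_card hY)
  have hXc : Nat.card X = 83 ^ 3 := syl83_card hG hX (by rw [card_top', hG.card]; norm_num [NN])
  have h1 := fix_mod hX.pg (Subgroup.le_normalizer : X ≤ Nm X)
  have h2 : 83 ∣ Nat.card ↥(X ⊓ Ce X) := by
    rw [hXc] at h1
    refine (Nat.modEq_zero_iff_dvd.1 (h1.symm.trans ?_))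
    norm_num [Nat.ModEq]
  obtain ⟨Z, hZ, hZc⟩ := exists_sub_card1 83 h2
  by_cases hZY : Z = Y
  · subst hZY
    have : X ≤ Ce Z := Ce_symm.1 (hZ.trans inf_le_right)
    have := Subgroup.card_dvd_of_le this
    rw [hXc] at this
    exact Dvd.dvd.trans (by norm_num) this
  · have h3 : Z ⊔ Y ≤ Ce Y := sup_le ((hZ.trans inf_le_right).trans (Ce_anti hYX)) (le_Ce_of_prime hY)
    have h4 : Z ⊔ Y ≤ X := sup_le (hZ.trans inf_le_left) hYX
    have h5 := Subgroup.card_dvd_of_le h4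
    rw [hXc] at h5
    obtain ⟨i, hi, hi2⟩ := (Nat.dvd_prime_pow f83.out).1 h5
    have h6 : 2 ≤ i := by
      by_contra hlt
      have h7 : Nat.card ↥(Z ⊔ Y) ≤ 83 := by
        rw [hi2]; calc 83 ^ i ≤ 83 ^ 1 := Nat.pow_le_pow_right (by norm_num) (by omega)
          _ = 83 := pow_one _
      have e1 : Z = Z ⊔ Y := Subgroup.eq_of_le_of_card_ge le_sup_left (by rw [hZc]; exact h7)
      have e2 : Y = Z ⊔ Y := Subgroup.eq_of_le_of_card_ge le_sup_right (by rw [hY]; exact h7)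
      exact hZY (e1.trans e2.symm)
    refine Dvd.dvd.trans (Nat.pow_dvd_pow 83 h6) ?_
    rw [← hi2]; exact Subgroup.card_dvd_of_le h3

theorem strip41 {c : ℕ} (h : c ∣ 2 ^ 4 * (41 ^ 2 * 83 ^ 3)) (h41 : ¬ 41 ^ 2 ∣ c) : c ∣ 2 ^ 4 * 41 * 83 ^ 3 := by
  obtain ⟨k, hk⟩ := h
  have h41k : 41 ∣ k := by
    by_contra hn
    apply h41
    refine Nat.Coprime.dvd_of_dvd_mul_right (Nat.Coprime.pow_left 2 ((Nat.Prime.coprime_iff_not_dvd f41.out).2 hn)) (n := k) ?_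
    rw [← hk]; norm_num
  obtain ⟨j, rfl⟩ := h41k
  refine ⟨j, ?_⟩
  apply Nat.eq_of_mul_eq_mul_left (show 0 < 41 by norm_num)
  calc 41 * (2 ^ 4 * 41 * 83 ^ 3) = 2 ^ 4 * (41 ^ 2 * 83 ^ 3) := by norm_num
    _ = _ := by rw [hk]; ring

theorem S9a (hG : Hyp G) : ∃ X : Subgroup G, Nat.card X = 83 ^ 3 ∧ 41 ∣ Nat.card ↥(Nm X) := by
  obtain ⟨A, hA, hr⟩ := ad_exists hG.a4183
  obtain ⟨Y, hYA, hY⟩ := exists_sub_card1 83 hr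
  have hYd : 83 ∣ Nat.card Y := by rw [hY]
  obtain ⟨n3, n7, n19, n367⟩ := na83 hG hYd
  obtain ⟨Q, hQ⟩ := IsSyl.exists 83 (Ce Y)
  have hAY : A ≤ Ce Y := Ce_symm.1 hYA
  have hQn : Ce Y ≤ Nm Q := by
    apply normal_of_Syls_one hQ
    apply div656 _ (Syls_mod 83 _)
    have h1 := strip41 (strip37 (m := 41 ^ 2 * 83 ^ 3) (by have := strip3 (sub_dvd hG.card _) n19 n367; rwa [mul_assoc (2 ^ 4 * 3 * 7)] at this) n3 n7) (no41 hG hYd)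
    have h2 : Nat.Coprime (Syls 83 (Ce Y)).ncard (83 ^ 3) := by
      apply Nat.Coprime.pow_right
      apply Nat.Coprime.symm
      rw [Nat.Prime.coprime_iff_not_dvd f83.out]
      intro h
      have := Syls_mod 83 (Ce Y)
      rw [Nat.mod_eq_zero_of_dvd h] at this
      norm_num at this
    refine h2.dvd_of_dvd_mul_right (Dvd.dvd.trans ?_ h1)
    exact ⟨_, Syls_count hQ⟩
  have h41Q : 41 ∣ Nat.card ↥(Nm Q) := by rw [← hA]; exact Subgroup.card_dvd_of_le (hAY.trans hQn)
  obtain ⟨i, hi, hi2⟩ := syl_exp hG (k := 3) (m := 2 ^ 4 * 3 * 7 * 19 * 41 ^ 2 * 367) hQ.pg (by norm_num [NN]) (by norm_num)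
  have h2 := hQ.pow_dvd (two_le_Q hG hY)
  rw [hi2, Nat.pow_dvd_pow_iff_le_right (by norm_num)] at h2
  obtain rfl | rfl : i = 2 ∨ i = 3 := by clear * - hi h2; omega
  · obtain ⟨X, hX⟩ := IsSyl.exists 83 (Nm Q)
    have hXc := syl83_card hG hX (grow hG hi2)
    by_cases h41 : 41 ∣ Nat.card ↥(Nm Q ⊓ Nm X)
    · exact ⟨X, hXc, h41.trans (Subgroup.card_dvd_of_le inf_le_right)⟩
    · have h3 := Syls_count hX
      have h4 : 41 ∣ (Syls 83 (Nm Q)).ncard := by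
        rw [h3] at h41Q
        exact (f41.out.dvd_mul.1 h41Q).resolve_right h41
      have h5 : 41 ^ 2 ∣ (Syls 83 (Nm Q)).ncard := by
        rcases div_big (n83_Nm hG hi2) (Syls_mod 83 _) with h | h | h | h <;> rw [h] at h4 ⊢ <;> first | (norm_num at h4; done) | norm_num
      obtain ⟨X', h6, -, h8⟩ := lemL hG hi2 (grow hG hi2) (h5.trans ⟨_, h3⟩)
      exact ⟨X', h6, h8.trans (Subgroup.card_dvd_of_le inf_le_right)⟩
  · exact ⟨Q, hi2, h41Q⟩

theorem s9_arith {n m : ℕ} (hm : m ∣ NN) (h : NN = n * m) (hn : n % 83 = 1) (h3 : ¬ 3 ∣ m) (h7 : ¬ 7 ∣ m)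
    (h41 : 41 ∣ m) (h83 : 83 ^ 3 ∣ m) : m = 83 ^ 3 * 82 ^ 2 ∨ m = 83 ^ 3 * 82 ^ 2 * (19 * 367) := by
  obtain ⟨a, b, c', d, e', f, g, ha, hb, hc', hd, he', hf, hg, hcc, ⟨z2, z3, z7, z19, z41, z83, z367⟩, ⟨y2, y3, y7, y19, y41, y83, y367⟩, -, y833, -⟩ := dvd_full hm
  have e1 := z3 h3
  have e2 := z7 h7
  have e3 := le_antisymm hf (y833 3 h83)
  have e4 := y41 h41
  subst e1 e2 e3
  clear z2 z3 z7 z19 z41 z83 z367 y2 y3 y7 y19 y41 y83 y367 y833 h3 h7 h41 h83 hm hb hc' hf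
  subst hcc
  revert h hn
  interval_cases a <;> interval_cases d <;> interval_cases e' <;> interval_cases g <;> norm_num [NN] <;> omega

theorem s9_arith2 {n k : ℕ} (h : 83 ^ 3 * 82 ^ 2 * (19 * 367) = n * k) (hn : n % 367 = 1) (hk : k ∣ 3 * 19 * 367) (h367 : 367 ∣ k) : False := by
  obtain ⟨j, rfl⟩ := h367
  have hj : j ∣ 57 := Nat.dvd_of_mul_dvd_mul_left (show 0 < 367 by norm_num) (hk.trans (by norm_num))
  have : j = 1 ∨ j = 3 ∨ j = 19 ∨ j = 57 := by
    have : ∀ n ∈ Nat.divisors 57, n = 1 ∨ n = 3 ∨ n = 19 ∨ n = 57 := by decide +kernel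
    exact this j (by simpa using hj)
  norm_num at h
  rcases this with rfl | rfl | rfl | rfl <;> omega

theorem S9 (hG : Hyp G) {X : Subgroup G} (hX : Nat.card X = 83 ^ 3) : Nat.card ↥(Nm X) = 83 ^ 3 * 82 ^ 2 := by
  obtain ⟨X', hX', h41'⟩ := S9a hG
  have h41 : 41 ∣ Nat.card ↥(Nm X) := by
    obtain ⟨g, rfl⟩ := conj83 hG hX' hX
    rwa [Nm_cj, card_cj]
  have hS := syl83 hG hX (le_top : X ≤ ⊤)
  have h1 := Syls_count hS
  rw [top_inf_eq, card_top', hG.card] at h1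
  have h3 : ¬ 3 ∣ Nat.card ↥(Nm X) := by
    intro h
    obtain ⟨P, hP, hPc⟩ := exists_sub_card1 3 h
    have := lemA (r := 83) (by norm_num) hG.na3 (IsPGroup.of_card hX) hPc hP
    rw [hX] at this; norm_num at this
  have h7 : ¬ 7 ∣ Nat.card ↥(Nm X) := by
    intro h
    obtain ⟨P, hP, hPc⟩ := exists_sub_card1 7 h
    have := lemA (r := 83) (by norm_num) hG.na7 (IsPGroup.of_card hX) hPc hP
    rw [hX] at this; norm_num at this
  rcases s9_arith (sub_dvd hG.card _) h1 (Syls_mod 83 _) h3 h7 h41 (by rw [← hX]; exact Subgroup.card_dvd_of_le Subgroup.le_normalizer) with h | h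
  · exact h
  · exfalso
    obtain ⟨P, hP, hPc⟩ := exists_sub_card1 367 (H := Nm X) (by rw [h]; norm_num)
    have hPS : IsSyl 367 P (Nm X) := IsSyl.of_card (k := 1) (m := 83 ^ 3 * 82 ^ 2 * 19) hP (by rw [h]; norm_num) (by norm_num) (by simpa using hPc)
    have h4 := Syls_count hPS
    rw [h] at h4
    refine s9_arith2 h4 (Syls_mod 367 _) ?_ ?_
    · rw [← (hG.C367 P hPc).2]; exact Subgroup.card_dvd_of_le inf_le_right
    · rw [← hPc]; exact Subgroup.card_dvd_of_le (le_inf hP Subgroup.le_normalizer)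

end
end OD

set_option linter.all false
namespace OD
section
variable {G : Type*} [Group G] [Finite G] {p : ℕ} [hp : Fact p.Prime]

theorem le_Nm_sq {D X : Subgroup G} (hDX : D ≤ X) (hD : Nat.card D = p ^ 2) (hX : Nat.card X = p ^ 3) : X ≤ Nm D := by
  let D' := D.subgroupOf X
  have h2 : Nat.card D' = p ^ 2 := by
    rw [← hD]; exact Nat.card_congr (Subgroup.subgroupOfEquivOfLe hDX).toEquiv
  have h3 := Sylow.prime_pow_dvd_card_normalizer (G := X) (p := p) (n := 2) (H := D') (by rw [hX]) h2
  have h4 : Subgroup.normalizer (D' : Set X) = ⊤ := by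
    apply Subgroup.eq_top_of_le_card
    rw [hX]; exact Nat.le_of_dvd Nat.card_pos h3
  haveI : D'.Normal := Subgroup.normalizer_eq_top_iff.1 h4
  apply le_Nm_of
  intro g hg x hx
  exact this.conj_mem ⟨x, hDX hx⟩ hx ⟨g, hg⟩

/-- vertices: subgroups of order `83^2` lying in two distinct Sylow 83-subgroups -/
def Vx (D : Subgroup G) : Prop :=
  Nat.card D = 83 ^ 2 ∧ ∃ X X' : Subgroup G, X ≠ X' ∧ Nat.card X = 83 ^ 3 ∧ Nat.card X' = 83 ^ 3 ∧ D ≤ X ∧ D ≤ X'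

theorem Vx.cj {D : Subgroup G} (h : Vx D) (g : G) : Vx (g • D) := by
  obtain ⟨h1, X, X', hne, h2, h3, h4, h5⟩ := h
  refine ⟨by rw [card_cj, h1], g • X, g • X', fun h => hne (smul_left_cancel g h), by rw [card_cj, h2], by rw [card_cj, h3], cj_mono h4, cj_mono h5⟩

theorem Syls_Nm (hG : Hyp G) {D : Subgroup G} (hD : Nat.card D = 83 ^ 2) :
    Syls 83 (Nm D) = {X : Subgroup G | Nat.card X = 83 ^ 3 ∧ D ≤ X} := by
  ext X; constructor
  · intro hX
    refine ⟨syl83_card hG hX (grow hG hD), ?_⟩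
    obtain ⟨Y, hY, hDY⟩ := IsSyl.exists_le (Subgroup.le_normalizer : D ≤ Nm D) (IsPGroup.of_card hD)
    obtain ⟨g, hg, rfl⟩ := hY.conj hX
    rw [← mem_Nm.1 hg]; exact cj_mono hDY
  · rintro ⟨h1, h2⟩
    exact syl83 hG h1 (le_Nm_sq h2 hD h1)

theorem Vx.count (hG : Hyp G) {D : Subgroup G} (h : Vx D) : {X : Subgroup G | Nat.card X = 83 ^ 3 ∧ D ≤ X}.ncard = 84 := by
  have hD := h.1
  rw [← Syls_Nm hG hD]
  have h1 : (Syls 83 (Nm D)).ncard ≠ 1 := by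
    rw [Syls_Nm hG hD]
    obtain ⟨h1, X, X', hne, h2, h3, h4, h5⟩ := h
    intro h6
    obtain ⟨Y, hY⟩ := Set.ncard_eq_one.1 h6
    have e1 : X ∈ ({Y} : Set (Subgroup G)) := by rw [← hY]; exact ⟨h2, h4⟩
    have e2 : X' ∈ ({Y} : Set (Subgroup G)) := by rw [← hY]; exact ⟨h3, h5⟩
    exact hne (e1.trans e2.symm)
  have key : ¬ 41 ^ 2 ∣ (Syls 83 (Nm D)).ncard := by
    intro h41
    obtain ⟨Y, hY⟩ := IsSyl.exists 83 (Nm D)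
    obtain ⟨X, hX, hXN, hX41⟩ := lemL hG hD (grow hG hD) (h41.trans ⟨_, Syls_count hY⟩)
    have h3 := Syls_count (syl83 hG hX hXN)
    have h4 : 41 ^ 2 * 41 ∣ NN := by
      refine Dvd.dvd.trans ?_ (sub_dvd hG.card (Nm D))
      rw [h3]; exact Nat.mul_dvd_mul h41 hX41
    norm_num [NN] at h4
  rcases div_big (n83_Nm hG hD) (Syls_mod 83 _) with h2 | h2 | h2 | h2
  · exact absurd h2 h1
  · exact h2
  · exact absurd (by rw [h2]; norm_num) key
  · exact absurd (by rw [h2]; norm_num) key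

theorem Vx.not_le (hG : Hyp G) {D X : Subgroup G} (h : Vx D) (hX : Nat.card X = 83 ^ 3) : ¬ X ≤ Ce D := by
  intro hle
  have h1 := frattini_dvd (syl83 hG hX hle) (Ce_le_Nm D) (Nm_le_Nm_Ce D)
  have h7 : 7 ∣ Nat.card ↥(Nm D) := by
    obtain ⟨Y, hY⟩ := IsSyl.exists 83 (Nm D)
    have h2 := h.count hG
    rw [← Syls_Nm hG h.1] at h2
    have h3 := Syls_count hY
    rw [h2] at h3
    exact Dvd.dvd.trans (by norm_num) ⟨_, h3⟩
  have h8 := cop_dvd f7.out h1 h7 (na83 hG (D := D) (by rw [h.1]; norm_num)).2.1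
  have h9 := h8.trans (Subgroup.card_dvd_of_le inf_le_right)
  rw [S9 hG hX] at h9
  norm_num at h9

theorem eq_of_lt_sq {D K X : Subgroup G} (hD : Nat.card D = p ^ 2) (hX : Nat.card X = p ^ 3) (h1 : D ≤ K) (h2 : K ≤ X) (h3 : D ≠ K) : K = X := by
  have h4 := Subgroup.card_dvd_of_le h2
  rw [hX] at h4
  obtain ⟨i, hi, hi2⟩ := (Nat.dvd_prime_pow hp.out).1 h4
  have : i = 3 := by
    by_contra hne
    apply h3
    refine Subgroup.eq_of_le_of_card_ge h1 ?_
    rw [hi2, hD]; exact Nat.pow_le_pow_right hp.out.pos (by omega)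
  exact Subgroup.eq_of_le_of_card_ge h2 (by rw [hi2, this, hX])

theorem Vx.center (hG : Hyp G) {D X : Subgroup G} (h : Vx D) (hX : Nat.card X = 83 ^ 3) (hDX : D ≤ X) :
    X ⊓ Ce X ≤ D ∧ Nat.card ↥(X ⊓ Ce X) = 83 := by
  have h1 : X ⊓ Ce X ≤ D := by
    by_contra hn
    have hK : D ⊔ (X ⊓ Ce X) = X := by
      refine eq_of_lt_sq h.1 hX le_sup_left (sup_le hDX inf_le_left) ?_
      intro he
      exact hn (by rw [he]; exact le_sup_right)
    apply h.not_le hG hX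
    rw [← hK]
    exact sup_le (abel_sq h.1) (inf_le_right.trans (Ce_anti hDX))
  refine ⟨h1, ?_⟩
  have h2 := fix_mod (IsPGroup.of_card hX) (Subgroup.le_normalizer : X ≤ Nm X)
  have h3 := Subgroup.card_dvd_of_le h1
  rw [h.1] at h3
  obtain ⟨i, hi, hi2⟩ := (Nat.dvd_prime_pow f83.out).1 h3
  have hi0 : i ≠ 0 := by
    rintro rfl
    rw [hi2, hX] at h2
    norm_num [Nat.ModEq] at h2
  have hi2' : i ≠ 2 := by
    rintro rfl
    have : X ⊓ Ce X = D := Subgroup.eq_of_le_of_card_ge h1 (by rw [hi2, h.1])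
    apply h.not_le hG hX
    apply Ce_symm.1
    rw [← this]; exact inf_le_right
  rw [hi2, show i = 1 by omega, pow_one]

theorem Vx.inter (hG : Hyp G) {D D' X : Subgroup G} (h : Vx D) (h' : Vx D') (hX : Nat.card X = 83 ^ 3) (hDX : D ≤ X) (hDX' : D' ≤ X)
    (hne : D ≠ D') : D ⊓ D' = X ⊓ Ce X := by
  obtain ⟨h1, h2⟩ := h.center hG hX hDX
  obtain ⟨h3, -⟩ := h'.center hG hX hDX'
  symm
  refine Subgroup.eq_of_le_of_card_ge (le_inf h1 h3) ?_
  have h4 := Subgroup.card_dvd_of_le (inf_le_left : D ⊓ D' ≤ D)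
  rw [h.1] at h4
  obtain ⟨i, hi, hi2⟩ := (Nat.dvd_prime_pow f83.out).1 h4
  have hi2' : i ≠ 2 := by
    rintro rfl
    have e1 : D ⊓ D' = D := Subgroup.eq_of_le_of_card_ge inf_le_left (by rw [hi2, h.1])
    have e2 : D ⊓ D' = D' := Subgroup.eq_of_le_of_card_ge inf_le_right (by rw [hi2, h'.1])
    exact hne (e1.symm.trans e2)
  rw [hi2, h2]
  calc 83 ^ i ≤ 83 ^ 1 := Nat.pow_le_pow_right (by norm_num) (by omega)
    _ = 83 := pow_one _

theorem Vx.le84 (hG : Hyp G) {X : Subgroup G} (hX : Nat.card X = 83 ^ 3) : {D | Vx D ∧ D ≤ X}.ncard ≤ 84 := by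
  by_cases hne : ∃ D, Vx D ∧ D ≤ X
  · obtain ⟨D, hD, hDX⟩ := hne
    have h1 := count_sub (X := X) (Z := X ⊓ Ce X) (𝒮 := {D | Vx D ∧ D ≤ X}) (a := 83 ^ 2) inf_le_left
      (fun S hS => ⟨hS.2, (hS.1.center hG hX hS.2).1, hS.1.1⟩) (fun S hS T hT hST => (hS.1.inter hG hT.1 hX hS.2 hT.2 hST).le)
    rw [(hD.center hG hX hDX).2, hX] at h1
    clear * - h1
    omega
  · have : {D | Vx D ∧ D ≤ X} = ∅ := by
      ext D; constructor
      · intro h; exact hne ⟨D, h⟩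
      · intro h; exact h.elim
    rw [this]; simp

theorem dvd_of_orbits {α : Type*} [MulAction G α] {H : Subgroup G} {Y : Set α} (hY : Y.Finite) {q : ℕ}
    (hi : ∀ h ∈ H, ∀ y ∈ Y, h • y ∈ Y) (ho : ∀ y ∈ Y, q ∣ (MulAction.orbit H y).ncard) : q ∣ Y.ncard := by
  induction' hn : Y.ncard using Nat.strong_induction_on with n ih generalizing Y
  by_cases hne : Y.Nonempty
  · obtain ⟨y, hy⟩ := hne
    have hsub : MulAction.orbit H y ⊆ Y := by
      rintro _ ⟨h, rfl⟩
      exact hi h h.2 y hy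
    have h1 := Set.ncard_diff_add_ncard_of_subset hsub hY
    have hpos : 0 < (MulAction.orbit H y).ncard := (Set.ncard_pos (hY.subset hsub)).2 ⟨y, MulAction.mem_orbit_self y⟩
    have h2 : q ∣ (Y \ MulAction.orbit H y).ncard := by
      refine ih _ (by omega) (hY.subset Set.diff_subset) ?_ (fun z hz => ho z hz.1) rfl
      rintro h hh z ⟨hz, hz2⟩
      refine ⟨hi h hh z hz, ?_⟩
      intro hz3
      apply hz2
      have : (⟨h, hh⟩ : H) • z ∈ MulAction.orbit H y := hz3
      have h5 := MulAction.mem_orbit_of_mem_orbit (⟨h, hh⟩⁻¹ : H) this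
      rwa [inv_smul_smul] at h5
    rw [← hn, ← h1]
    exact Nat.dvd_add h2 (ho y hy)
  · rw [Set.not_nonempty_iff_eq_empty] at hne
    subst hne
    simp at hn
    subst hn
    exact dvd_zero _

end
end OD

set_option linter.all false
namespace OD

theorem fib_count {α β : Type*} [Finite α] [Finite β] {A : Set α} {B : Set β} (f : α → β) {k : ℕ}
    (hf : ∀ a ∈ A, f a ∈ B) (hk : ∀ b ∈ B, {a | a ∈ A ∧ f a = b}.ncard = k) : A.ncard = B.ncard * k := by
  classical
  haveI := Fintype.ofFinite α
  haveI := Fintype.ofFinite β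
  have h := Finset.card_eq_sum_card_fiberwise (s := A.toFinset) (t := B.toFinset) (f := f)
    (fun a ha => by simpa using hf a (by simpa using ha))
  rw [Set.ncard_eq_toFinset_card', Set.ncard_eq_toFinset_card', h, Finset.sum_const_nat]
  intro b hb
  rw [← hk b (by simpa using hb), Set.ncard_eq_toFinset_card']
  congr 1
  ext a; simp

section
variable {G : Type*} [Group G] [Finite G] {p : ℕ} [hp : Fact p.Prime]

theorem Syl_le_eq (hG : Hyp G) {X X' : Subgroup G} (hX : Nat.card X = 83 ^ 3) (hX' : Nat.card X' = 83 ^ 3) :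
    X ⊓ Nm X' = X ⊓ X' := by
  apply le_antisymm _ (inf_le_inf_left _ Subgroup.le_normalizer)
  refine le_inf inf_le_left ?_
  exact IsSyl.le_of_normal (syl83 hG hX' Subgroup.le_normalizer) le_rfl inf_le_right
    ((IsPGroup.of_card hX).to_le inf_le_left)

theorem Syl_ncard (hG : Hyp G) : {X : Subgroup G | Nat.card X = 83 ^ 3}.ncard = 585732 := by
  have h0 : {X : Subgroup G | Nat.card X = 83 ^ 3} = Syls 83 (⊤ : Subgroup G) := by
    ext X; constructor
    · intro h; exact syl83 hG h le_top
    · intro h; exact syl83_card hG h (by rw [card_top', hG.card]; norm_num [NN])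
  obtain ⟨X, hX⟩ := IsSyl.exists 83 (⊤ : Subgroup G)
  have hXc : Nat.card X = 83 ^ 3 := syl83_card hG hX (by rw [card_top', hG.card]; norm_num [NN])
  rw [h0]
  have h1 := Syls_count hX
  rw [top_inf_eq, card_top', hG.card, S9 hG hXc] at h1
  generalize (Syls 83 (⊤ : Subgroup G)).ncard = n at h1
  clear * - h1
  unfold NN at h1
  omega

theorem s10_arith {k m b n : ℕ} (h : n = 1 + (k * 83 + b)) (hn : n = 585732) (hk : k ≤ 84) (hb : b = 83 ^ 2 * m) : k = 2 := by
  omega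

theorem Vx.two (hG : Hyp G) {X : Subgroup G} (hX : Nat.card X = 83 ^ 3) : {D : Subgroup G | Vx D ∧ D ≤ X}.ncard = 2 := by
  let A : Set (Subgroup G) := {X' | (Nat.card X' = 83 ^ 3 ∧ X' ≠ X) ∧ Nat.card ↥(X ⊓ X') = 83 ^ 2}
  let B : Set (Subgroup G) := {X' | (Nat.card X' = 83 ^ 3 ∧ X' ≠ X) ∧ Nat.card ↥(X ⊓ X') ≠ 83 ^ 2}
  have hA : A.ncard = {D : Subgroup G | Vx D ∧ D ≤ X}.ncard * 83 := by
    apply fib_count (fun X' => X ⊓ X')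
    · rintro X' ⟨⟨h1, h2⟩, h3⟩
      exact ⟨⟨h3, X, X', h2.symm, hX, h1, inf_le_left, inf_le_right⟩, inf_le_left⟩
    · rintro D ⟨hD, hDX⟩
      have h1 := hD.count hG
      have h2 : X ∈ {X : Subgroup G | Nat.card X = 83 ^ 3 ∧ D ≤ X} := ⟨hX, hDX⟩
      have h3 := Set.ncard_diff_singleton_add_one h2 (Set.toFinite _)
      have h4 : {X' | X' ∈ A ∧ X ⊓ X' = D} = {X : Subgroup G | Nat.card X = 83 ^ 3 ∧ D ≤ X} \ {X} := by
        ext X'; constructor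
        · rintro ⟨⟨⟨h4, h5⟩, h6⟩, h7⟩
          exact ⟨⟨h4, h7 ▸ inf_le_right⟩, h5⟩
        · rintro ⟨⟨h4, h5⟩, h6⟩
          have h7 : X ⊓ X' = D := by
            by_contra hne
            have h8 := eq_of_lt_sq hD.1 hX (le_inf hDX h5) inf_le_left (Ne.symm hne)
            have h9 := eq_of_lt_sq hD.1 h4 (le_inf hDX h5) inf_le_right (Ne.symm hne)
            exact h6 (h9.symm.trans h8)
          exact ⟨⟨⟨h4, h6⟩, by rw [h7, hD.1]⟩, h7⟩
      rw [h4]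
      rw [h1] at h3
      clear * - h3
      omega
  have hB : 83 ^ 2 ∣ B.ncard := by
    apply dvd_of_orbits (H := X) (Set.toFinite _)
    · rintro h hh X' ⟨⟨h1, h2⟩, h3⟩
      have e1 : h • X = X := cj_eq_of_mem hh
      refine ⟨⟨by rw [card_cj, h1], ?_⟩, ?_⟩
      · intro h4; rw [← e1] at h4; exact h2 (smul_left_cancel h h4)
      · have : X ⊓ h • X' = h • (X ⊓ X') := by rw [cj_inf, e1]
        rw [this, card_cj]; exact h3
    · rintro X' ⟨⟨h1, h2⟩, h3⟩
      have h4 := orb_stab X X'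
      rw [stab_eq, Syl_le_eq hG hX h1, hX] at h4
      have h5 := Subgroup.card_dvd_of_le (inf_le_left : X ⊓ X' ≤ X)
      rw [hX] at h5
      obtain ⟨i, hi, hi2⟩ := (Nat.dvd_prime_pow f83.out).1 h5
      have hi3 : i ≠ 3 := by
        rintro rfl
        have e1 : X ⊓ X' = X := Subgroup.eq_of_le_of_card_ge inf_le_left (by rw [hi2, hX])
        have e2 : X ⊓ X' = X' := Subgroup.eq_of_le_of_card_ge inf_le_right (by rw [hi2, h1])
        exact h2 (e2.symm.trans e1)
      have hi4 : i ≠ 2 := by rintro rfl; exact h3 hi2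
      have hi5 : i = 0 ∨ i = 1 := by clear * - hi hi3 hi4; omega
      rw [hi2] at h4
      generalize (MulAction.orbit X X').ncard = n at *
      clear * - h4 hi5
      rcases hi5 with rfl | rfl <;> omega
  obtain ⟨m, hm⟩ := hB
  have hAB : {X : Subgroup G | Nat.card X = 83 ^ 3} = {X} ∪ (A ∪ B) := by
    ext X'; constructor
    · intro h
      by_cases h1 : X' = X
      · exact Or.inl h1
      · by_cases h2 : Nat.card ↥(X ⊓ X') = 83 ^ 2
        · exact Or.inr (Or.inl ⟨⟨h, h1⟩, h2⟩)
        · exact Or.inr (Or.inr ⟨⟨h, h1⟩, h2⟩)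
    · rintro (h | h | h)
      · rw [h]; exact hX
      · exact h.1.1
      · exact h.1.1
  have hc : {X : Subgroup G | Nat.card X = 83 ^ 3}.ncard = 1 + (A.ncard + B.ncard) := by
    rw [hAB, Set.ncard_union_eq, Set.ncard_union_eq, Set.ncard_singleton]
    · rw [Set.disjoint_left]; intro Y h1 h2; exact h2.2 h1.2
    · rw [Set.disjoint_left]; rintro Y h1 (h2 | h2)
      · exact h2.1.2 h1
      · exact h2.1.2 h1
  rw [hA] at hc
  exact s10_arith hc (Syl_ncard hG) (Vx.le84 hG hX) hm

theorem Vx.ncard (hG : Hyp G) : {D : Subgroup G | Vx D}.ncard = 13946 := by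
  let F : Set (Subgroup G × Subgroup G) := {q | Vx q.1 ∧ Nat.card q.2 = 83 ^ 3 ∧ q.1 ≤ q.2}
  have h1 : F.ncard = {D : Subgroup G | Vx D}.ncard * 84 := by
    apply fib_count Prod.fst
    · rintro q hq; exact hq.1
    · rintro D hD
      have e := Set.ncard_image_of_injective {X : Subgroup G | Nat.card X = 83 ^ 3 ∧ D ≤ X} (Prod.mk_right_injective D)
      rw [hD.count hG] at e
      rw [← e]
      refine congrArg Set.ncard ?_
      ext ⟨a, b⟩; constructor
      · rintro ⟨⟨h1, h2, h3⟩, h4⟩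
        dsimp at h1 h2 h3 h4
        subst h4
        exact ⟨b, ⟨h2, h3⟩, rfl⟩
      · rintro ⟨c, ⟨h2, h3⟩, h4⟩
        cases h4
        exact ⟨⟨hD, h2, h3⟩, rfl⟩
  have h2 : F.ncard = {X : Subgroup G | Nat.card X = 83 ^ 3}.ncard * 2 := by
    apply fib_count Prod.snd
    · rintro q hq; exact hq.2.1
    · rintro X hX
      have e := Set.ncard_image_of_injective {D : Subgroup G | Vx D ∧ D ≤ X} (Prod.mk_left_injective X)
      rw [Vx.two hG hX] at e
      rw [← e]
      refine congrArg Set.ncard ?_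
      ext ⟨a, b⟩; constructor
      · rintro ⟨⟨h1, h2, h3⟩, h4⟩
        dsimp at h1 h2 h3 h4
        subst h4
        exact ⟨a, ⟨h1, h3⟩, rfl⟩
      · rintro ⟨c, ⟨h2, h3⟩, h4⟩
        cases h4
        exact ⟨⟨h2, hX, h3⟩, rfl⟩
  rw [Syl_ncard hG] at h2
  rw [h1] at h2
  clear * - h2
  omega

end
end OD

set_option linter.all false
namespace OD

/-- the abstract graph data -/
structure GA (G V : Type*) [Group G] [MulAction G V] where
  Adj : V → V → Prop
  symm : ∀ {a b}, Adj a b → Adj b a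
  irrefl : ∀ {a}, ¬ Adj a a
  inv : ∀ (g : G) {a b}, Adj a b → Adj (g • a) (g • b)
  deg : ∀ a, {b | Adj a b}.ncard = 84
  card : Nat.card V = 13946
  edge : ∀ {a b c d}, Adj a b → Adj c d → ∃ g : G, (g • a = c ∧ g • b = d) ∨ (g • a = d ∧ g • b = c)
  tr : ∀ {a a' b c}, Adj b c → Adj b a → Adj b a' → a ≠ c → a' ≠ c →
    ∃ g : G, g • a = a' ∧ g • b = b ∧ g • c = c ∧ ∀ x, Adj c x → g • x = x
  simple : ∀ K : Subgroup G, K.Normal → K = ⊥ ∨ K = ⊤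
  fix : ∀ a : V, ∃ E : Subgroup G, Nat.card E = 83 ^ 2 ∧ (∀ x ∈ E, ∀ y ∈ E, x * y = y * x) ∧
    ∀ e ∈ E, e • a = a ∧ ∀ x, Adj a x → e • x = x

section
variable {G : Type*} [Group G] [Finite G] {p : ℕ} [hp : Fact p.Prime]

/-- the vertex type -/
abbrev VT (G : Type*) [Group G] := {D : Subgroup G // Vx D}

instance : MulAction G (VT G) where
  smul g D := ⟨g • D.1, D.2.cj g⟩
  one_smul D := Subtype.ext (one_smul G D.1)
  mul_smul g h D := Subtype.ext (mul_smul g h D.1)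

theorem VT.coe_smul (g : G) (D : VT G) : ((g • D : VT G) : Subgroup G) = g • D.1 := rfl

def adj (a b : VT G) : Prop := a ≠ b ∧ ∃ X : Subgroup G, Nat.card X = 83 ^ 3 ∧ a.1 ≤ X ∧ b.1 ≤ X

theorem sup_of {a b : VT G} (hne : a ≠ b) {X : Subgroup G} (hX : Nat.card X = 83 ^ 3) (h1 : a.1 ≤ X) (h2 : b.1 ≤ X) :
    a.1 ⊔ b.1 = X := by
  refine eq_of_lt_sq a.2.1 hX le_sup_left (sup_le h1 h2) ?_
  intro h
  have h3 : b.1 ≤ a.1 := by rw [h]; exact le_sup_right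
  exact hne (Subtype.ext (Subgroup.eq_of_le_of_card_ge h3 (by rw [a.2.1, b.2.1])).symm)

theorem two_of (hG : Hyp G) {a b c : VT G} (hne : a ≠ b) {X : Subgroup G} (hX : Nat.card X = 83 ^ 3) (h1 : a.1 ≤ X) (h2 : b.1 ≤ X)
    (h3 : c.1 ≤ X) : c = a ∨ c = b := by
  obtain ⟨x, y, hxy, hs⟩ := Set.ncard_eq_two.1 (Vx.two hG hX)
  have e1 : a.1 ∈ ({x, y} : Set (Subgroup G)) := hs ▸ ⟨a.2, h1⟩
  have e2 : b.1 ∈ ({x, y} : Set (Subgroup G)) := hs ▸ ⟨b.2, h2⟩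
  have e3 : c.1 ∈ ({x, y} : Set (Subgroup G)) := hs ▸ ⟨c.2, h3⟩
  have hne' : a.1 ≠ b.1 := fun h => hne (Subtype.ext h)
  simp only [Set.mem_insert_iff, Set.mem_singleton_iff] at e1 e2 e3
  rw [Subtype.ext_iff, Subtype.ext_iff]
  rcases e1 with e1 | e1 <;> rcases e2 with e2 | e2 <;> rcases e3 with e3 | e3 <;> simp_all

theorem adj_sup {a b : VT G} (h : adj a b) : Nat.card ↥(a.1 ⊔ b.1) = 83 ^ 3 := by
  obtain ⟨hne, X, hX, h1, h2⟩ := h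
  rw [sup_of hne hX h1 h2, hX]

theorem adj_symm {a b : VT G} (h : adj a b) : adj b a := by
  obtain ⟨hne, X, hX, h1, h2⟩ := h
  exact ⟨hne.symm, X, hX, h2, h1⟩

theorem adj_inv (g : G) {a b : VT G} (h : adj a b) : adj (g • a) (g • b) := by
  obtain ⟨hne, X, hX, h1, h2⟩ := h
  exact ⟨fun h => hne (smul_left_cancel g h), g • X, by rw [card_cj, hX], cj_mono h1, cj_mono h2⟩

theorem adj_deg (hG : Hyp G) (a : VT G) : {b | adj a b}.ncard = 84 := by
  have h1 : {b | adj a b}.ncard = {X : Subgroup G | Nat.card X = 83 ^ 3 ∧ a.1 ≤ X}.ncard * 1 := by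
    apply fib_count (fun b => a.1 ⊔ b.1)
    · intro b hb; exact ⟨adj_sup hb, le_sup_left⟩
    · rintro X ⟨hX, haX⟩
      rw [Set.ncard_eq_one]
      have h2 := Vx.two hG hX
      have h3 : a.1 ∈ {D : Subgroup G | Vx D ∧ D ≤ X} := ⟨a.2, haX⟩
      have h4 := Set.ncard_diff_singleton_add_one h3 (Set.toFinite _)
      rw [h2] at h4
      have h5 : ({D : Subgroup G | Vx D ∧ D ≤ X} \ {a.1}).ncard = 1 := by clear * - h4; omega
      obtain ⟨b, hb⟩ := Set.ncard_eq_one.1 h5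
      have hb1 : b ∈ {D : Subgroup G | Vx D ∧ D ≤ X} \ {a.1} := by rw [hb]; rfl
      have hne : a ≠ ⟨b, hb1.1.1⟩ := fun h => hb1.2 (congrArg Subtype.val h).symm
      refine ⟨⟨b, hb1.1.1⟩, ?_⟩
      ext c; constructor
      · rintro ⟨h6, h7⟩
        have hcX : c.1 ≤ X := by rw [← h7]; exact le_sup_right
        rcases two_of hG (b := ⟨b, hb1.1.1⟩) hne hX haX hb1.1.2 hcX with h | h
        · exact absurd h.symm h6.1
        · exact h
      · intro h
        rw [Set.mem_singleton_iff] at h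
        subst h
        exact ⟨⟨hne, X, hX, haX, hb1.1.2⟩, sup_of hne hX haX hb1.1.2⟩
  rw [h1, a.2.count hG]

theorem adj_edge (hG : Hyp G) {a b c d : VT G} (h1 : adj a b) (h2 : adj c d) :
    ∃ g : G, (g • a = c ∧ g • b = d) ∨ (g • a = d ∧ g • b = c) := by
  obtain ⟨hne, X, hX, ha, hb⟩ := h1
  obtain ⟨hne', X', hX', hc, hd⟩ := h2
  obtain ⟨g, rfl⟩ := conj83 hG hX hX'
  have e1 := two_of hG hne' hX' hc hd (c := g • a) (cj_mono ha)
  have e2 := two_of hG hne' hX' hc hd (c := g • b) (cj_mono hb)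
  have e3 : g • a ≠ g • b := fun h => hne (smul_left_cancel g h)
  refine ⟨g, ?_⟩
  rcases e1 with e1 | e1 <;> rcases e2 with e2 | e2
  · exact absurd (e1.trans e2.symm) e3
  · exact Or.inl ⟨e1, e2⟩
  · exact Or.inr ⟨e1, e2⟩
  · exact absurd (e1.trans e2.symm) e3

theorem adj_fix {a x : VT G} (h : adj a x) {e : G} (he : e ∈ a.1) : e • x = x := by
  apply Subtype.ext
  obtain ⟨hne, X, hX, ha, hx⟩ := h
  exact mem_Nm.1 (le_Nm_sq hx x.2.1 hX (ha he))

theorem self_fix {a : VT G} {e : G} (he : e ∈ a.1) : e • a = a := Subtype.ext (cj_eq_of_mem he)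

theorem adj_tr (hG : Hyp G) {a a' b c : VT G} (hbc : adj b c) (hba : adj b a) (hba' : adj b a') (hac : a ≠ c) (hac' : a' ≠ c) :
    ∃ g : G, g • a = a' ∧ g • b = b ∧ g • c = c ∧ ∀ x, adj c x → g • x = x := by
  suffices h : a' ∈ MulAction.orbit c.1 a by
    obtain ⟨g, rfl⟩ := h
    exact ⟨g, rfl, adj_fix (adj_symm hbc) g.2, self_fix g.2, fun x hx => adj_fix hx g.2⟩
  have hsub : MulAction.orbit c.1 a ⊆ {x | adj b x} \ {c} := by
    rintro _ ⟨g, rfl⟩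
    have e1 : (g : G) • b = b := adj_fix (adj_symm hbc) g.2
    refine ⟨?_, ?_⟩
    · have := adj_inv (g : G) hba
      rw [e1] at this; exact this
    · intro h
      have h1 : (g : G) • a = c := h
      exact hac (smul_left_cancel (g : G) (h1.trans (self_fix g.2).symm))
  have hc : ({x | adj b x} \ {c}).ncard = 83 := by
    have h4 := Set.ncard_diff_singleton_add_one (show c ∈ {x | adj b x} from hbc) (Set.toFinite _)
    rw [adj_deg hG] at h4
    clear * - h4; omega
  have horb : 83 ≤ (MulAction.orbit c.1 a).ncard := by
    have h1 := orb_stab c.1 a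
    have h2 : Nat.card ↥(c.1 ⊓ MulAction.stabilizer G a) ∣ 83 ^ 2 := by
      rw [← c.2.1]; exact Subgroup.card_dvd_of_le inf_le_left
    obtain ⟨i, hi, hi2⟩ := (Nat.dvd_prime_pow f83.out).1 h2
    have hi3 : i ≠ 2 := by
      rintro rfl
      have e1 : c.1 ⊓ MulAction.stabilizer G a = c.1 := Subgroup.eq_of_le_of_card_ge inf_le_left (by rw [hi2, c.2.1])
      have e2 : c.1 ≤ MulAction.stabilizer G a := by rw [← e1]; exact inf_le_right
      have hX := adj_sup hba
      have e3 : c.1 ≤ Nm (b.1 ⊔ a.1) := by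
        intro g hg
        have q1 : g • a.1 = a.1 := congrArg Subtype.val (e2 hg : g • a = a)
        have q2 : g • b.1 = b.1 := congrArg Subtype.val (adj_fix (adj_symm hbc) hg)
        rw [mem_Nm]
        have : g • (b.1 ⊔ a.1) = g • b.1 ⊔ g • a.1 := Subgroup.map_sup _ _ _
        rw [this, q1, q2]
      have e4 : c.1 ≤ b.1 ⊔ a.1 := IsSyl.le_of_normal (syl83 hG hX Subgroup.le_normalizer) le_rfl e3 (IsPGroup.of_card c.2.1)
      rcases two_of hG hba.1 hX le_sup_left le_sup_right e4 with h | h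
      · exact hbc.1 h.symm
      · exact hac h.symm
    have hi4 : i = 0 ∨ i = 1 := by clear * - hi hi3; omega
    rw [hi2, c.2.1] at h1
    generalize (MulAction.orbit c.1 a).ncard = n at *
    clear * - h1 hi4
    rcases hi4 with rfl | rfl <;> omega
  have heq := Set.eq_of_subset_of_ncard_le hsub (by rw [hc]; exact horb) (Set.toFinite _)
  rw [heq]
  exact ⟨hba', hac'⟩

def mkGA (hG : Hyp G) : GA G (VT G) where
  Adj := adj
  symm := adj_symm
  irrefl := fun h => h.1 rfl
  inv := fun g _ _ h => adj_inv g h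
  deg := adj_deg hG
  card := Vx.ncard hG
  edge := adj_edge hG
  tr := adj_tr hG
  simple := fun K hK => S3 hG (Subgroup.normalizer_eq_top_iff.2 hK)
  fix := fun a => ⟨a.1, a.2.1, fun x hx y hy => mem_Ce.1 (abel_sq a.2.1 hy) x hx, fun e he => ⟨self_fix he, fun x hx => adj_fix hx he⟩⟩

end
end OD

set_option linter.all false
namespace OD
section
variable {G V : Type*} [Group G] [MulAction G V] [Finite V] (A : GA G V)
namespace GA

/-- neighbours -/
def N (a : V) : Set V := {b | A.Adj a b}

theorem deg1 {a c : V} (h : A.Adj a c) : (A.N a \ {c}).ncard = 83 := by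
  have h4 := Set.ncard_diff_singleton_add_one (show c ∈ A.N a from h) (Set.toFinite _)
  have := A.deg a
  change (A.N a).ncard = 84 at this
  omega

theorem ne {a b : V} (h : A.Adj a b) : a ≠ b := by rintro rfl; exact A.irrefl h

theorem exN (a : V) : ∃ b, A.Adj a b := by
  have h : 0 < (A.N a).ncard := by
    have := A.deg a
    change (A.N a).ncard = 84 at this
    rw [this]; norm_num
  exact (Set.ncard_pos (Set.toFinite _)).1 h

theorem exN1 {a c : V} (h : A.Adj a c) : ∃ b, A.Adj a b ∧ b ≠ c := by
  have h : 0 < (A.N a \ {c}).ncard := by rw [A.deg1 h]; norm_num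
  exact (Set.ncard_pos (Set.toFinite _)).1 h

theorem exN2 {a c : V} (h : A.Adj a c) (d : V) : ∃ b, A.Adj a b ∧ b ≠ c ∧ b ≠ d := by
  have h1 : 1 < (A.N a \ {c}).ncard := by rw [A.deg1 h]; norm_num
  obtain ⟨b, hb, hne⟩ := Set.exists_ne_of_one_lt_ncard h1 d
  exact ⟨b, hb.1, hb.2, hne⟩

theorem exA (A : GA G V) : Nonempty V := by
  have h : 0 < Nat.card V := by rw [A.card]; norm_num
  exact (Nat.card_pos_iff.1 h).1

/-- reduced 3-paths -/
def P3 (a b c d : V) : Prop := A.Adj a b ∧ A.Adj b c ∧ A.Adj c d ∧ a ≠ c ∧ b ≠ d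

theorem p3_tr {a b c d a' b' c' d' : V} (h : A.P3 a b c d) (h' : A.P3 a' b' c' d') :
    ∃ g : G, (g • a = a' ∧ g • b = b' ∧ g • c = c' ∧ g • d = d') ∨ (g • a = d' ∧ g • b = c' ∧ g • c = b' ∧ g • d = a') := by
  have key : ∀ {a b c d a' d' : V}, A.P3 a b c d → A.P3 a' b c d' → ∃ g : G, g • a = a' ∧ g • b = b ∧ g • c = c ∧ g • d = d' := by
    rintro a b c d a' d' ⟨h1, h2, h3, h4, h5⟩ ⟨h1', -, h3', h4', h5'⟩
    obtain ⟨g, g1, g2, g3, g4⟩ := A.tr h2 (A.symm h1) (A.symm h1') h4 h4'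
    obtain ⟨k, k1, k2, k3, k4⟩ := A.tr (A.symm h2) h3 h3' h5.symm h5'.symm
    refine ⟨k * g, ?_, ?_, ?_, ?_⟩
    · rw [mul_smul, g1, k4 _ (A.symm h1')]
    · rw [mul_smul, g2, k3]
    · rw [mul_smul, g3, k2]
    · rw [mul_smul, g4 _ h3, k1]
  have inv : ∀ (g : G) {a b c d : V}, A.P3 a b c d → A.P3 (g • a) (g • b) (g • c) (g • d) := by
    rintro g a b c d ⟨h1, h2, h3, h4, h5⟩
    exact ⟨A.inv g h1, A.inv g h2, A.inv g h3, fun h => h4 (smul_left_cancel g h), fun h => h5 (smul_left_cancel g h)⟩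
  obtain ⟨g, ⟨g1, g2⟩ | ⟨g1, g2⟩⟩ := A.edge h.2.1 h'.2.1
  · have h1 := inv g h
    rw [g1, g2] at h1
    obtain ⟨k, k1, k2, k3, k4⟩ := key h1 h'
    refine ⟨k * g, Or.inl ⟨?_, ?_, ?_, ?_⟩⟩
    · rw [mul_smul, k1]
    · rw [mul_smul, g1, k2]
    · rw [mul_smul, g2, k3]
    · rw [mul_smul, k4]
  · have h1 := inv g h
    rw [g1, g2] at h1
    have h2 : A.P3 d' c' b' a' := ⟨A.symm h'.2.2.1, A.symm h'.2.1, A.symm h'.1, h'.2.2.2.2.symm, h'.2.2.2.1.symm⟩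
    obtain ⟨k, k1, k2, k3, k4⟩ := key h1 h2
    refine ⟨k * g, Or.inr ⟨?_, ?_, ?_, ?_⟩⟩
    · rw [mul_smul, k1]
    · rw [mul_smul, g1, k2]
    · rw [mul_smul, g2, k3]
    · rw [mul_smul, k4]

/-- invariant symmetric relations are constant on ends of reduced 3-paths -/
theorem p3_rel {R : V → V → Prop} (hs : ∀ a b, R a b → R b a) (hi : ∀ (g : G) a b, R a b → R (g • a) (g • b))
    {a b c d a' b' c' d' : V} (h : A.P3 a b c d) (h' : A.P3 a' b' c' d') (hR : R a d) : R a' d' := by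
  obtain ⟨g, ⟨g1, g2, g3, g4⟩ | ⟨g1, g2, g3, g4⟩⟩ := A.p3_tr h h'
  · rw [← g1, ← g4]; exact hi g _ _ hR
  · rw [← g1, ← g4]; exact hs _ _ (hi g _ _ hR)

theorem no3 {a b c : V} (h1 : A.Adj a b) (h2 : A.Adj b c) (h3 : A.Adj c a) : False := by
  have hp : A.P3 a b c a := ⟨h1, h2, h3, (A.ne h3).symm, (A.ne h1).symm⟩
  obtain ⟨d, hd, hd1, hd2⟩ := A.exN2 (A.symm h2) a
  have hp' : A.P3 a b c d := ⟨h1, h2, hd, (A.ne h3).symm, hd1.symm⟩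
  have := A.p3_rel (R := fun x y => x = y) (fun _ _ h => h.symm) (fun g _ _ h => congrArg _ h) hp hp' rfl
  exact hd2 this.symm

theorem no4 {a b c d : V} (h1 : A.Adj a b) (h2 : A.Adj b c) (h3 : A.Adj c d) (h4 : A.Adj d a) (h5 : a ≠ c) (h6 : b ≠ d) : False := by
  have key : ∀ {a b c d : V}, A.P3 a b c d → A.Adj a d := fun h' =>
    A.p3_rel (R := A.Adj) (fun _ _ h => A.symm h) (fun g _ _ h => A.inv g h) ⟨h1, h2, h3, h5, h6⟩ h' (A.symm h4)
  have twin : ∀ {a b c : V}, A.Adj b a → A.Adj b c → A.N c ⊆ A.N a := by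
    intro a b c hba hbc d hd
    by_cases hac : a = c
    · subst hac; exact hd
    by_cases hbd : b = d
    · subst hbd; exact A.symm hba
    exact key ⟨A.symm hba, hbc, hd, hac, hbd⟩
  have hc : (Set.univ : Set V).ncard = (Set.range A.N).ncard * 84 := by
    apply fib_count A.N
    · intro a _; exact ⟨a, rfl⟩
    · rintro _ ⟨a, rfl⟩
      obtain ⟨b, hb⟩ := A.exN a
      have : {x | x ∈ Set.univ ∧ A.N x = A.N a} = A.N b := by
        ext x; constructor
        · rintro ⟨-, hx⟩
          have : b ∈ A.N x := by rw [hx]; exact hb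
          exact A.symm this
        · intro hx
          exact ⟨trivial, le_antisymm (twin (A.symm hb) hx) (twin hx (A.symm hb))⟩
      rw [this]; exact A.deg b
  rw [Set.ncard_univ, A.card] at hc
  clear * - hc
  omega

/-- second neighbourhood -/
def N2 (a : V) : Set V := {c | c ≠ a ∧ ∃ b, A.Adj a b ∧ A.Adj b c}

theorem card_N2 (a : V) : (A.N2 a).ncard = 84 * 83 := by
  classical
  have hch : ∀ c : V, ∃ b, c ∈ A.N2 a → A.Adj a b ∧ A.Adj b c := by
    intro c
    by_cases h : c ∈ A.N2 a
    · obtain ⟨-, b, hb⟩ := h; exact ⟨b, fun _ => hb⟩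
    · exact ⟨c, fun h' => absurd h' h⟩
  choose f hf using hch
  have h1 : (A.N2 a).ncard = (A.N a).ncard * 83 := by
    apply fib_count f
    · intro c hc; exact (hf c hc).1
    · intro b hb
      have : {c | c ∈ A.N2 a ∧ f c = b} = A.N b \ {a} := by
        ext c; constructor
        · rintro ⟨h1, h2⟩
          have := hf c h1
          rw [h2] at this
          exact ⟨this.2, h1.1⟩
        · rintro ⟨h1, h2⟩
          have hc : c ∈ A.N2 a := ⟨h2, b, hb, h1⟩
          refine ⟨hc, ?_⟩
          by_contra hne
          exact A.no4 (hf c hc).1 (hf c hc).2 (A.symm h1) (A.symm hb) (Ne.symm h2) hne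
      rw [this]; exact A.deg1 (A.symm hb)
  have := A.deg a
  change (A.N a).ncard = 84 at this
  rw [h1, this]

/-- even set -/
def ev (a : V) : Set V := {a} ∪ A.N2 a

theorem self_ev (a : V) : a ∈ A.ev a := Or.inl rfl

theorem card_ev (a : V) : (A.ev a).ncard = 6973 := by
  unfold ev
  rw [Set.ncard_union_eq, Set.ncard_singleton, A.card_N2]
  rw [Set.disjoint_left]; intro x h1 h2; exact h2.1 h1

theorem no5 {a b c d : V} (h : A.P3 a b c d) {e : V} (h1 : A.Adj a e) (h2 : A.Adj e d) : False := by
  have key : ∀ {a b c d : V}, A.P3 a b c d → ∃ e, A.Adj a e ∧ A.Adj e d := fun h' =>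
    A.p3_rel (R := fun x y => ∃ e, A.Adj x e ∧ A.Adj e y) (fun _ _ ⟨e, h1, h2⟩ => ⟨e, A.symm h2, A.symm h1⟩)
      (fun g _ _ ⟨e, h1, h2⟩ => ⟨g • e, A.inv g h1, A.inv g h2⟩) h h' ⟨e, h1, h2⟩
  let B : V → Set V := fun a => A.ev a ∪ A.N a
  have hB : ∀ a, (B a).ncard = 7057 := by
    intro a
    have hd := A.deg a
    change (A.N a).ncard = 84 at hd
    change (A.ev a ∪ A.N a).ncard = _
    rw [Set.ncard_union_eq, A.card_ev, hd]
    rw [Set.disjoint_left]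
    rintro x (h1 | ⟨h1, b, h2, h3⟩) h4
    · rw [Set.mem_singleton_iff] at h1; subst h1; exact A.irrefl h4
    · exact A.no3 h2 h3 (A.symm h4)
  have mem2 : ∀ {a b c}, A.Adj a b → A.Adj b c → c ∈ B a := by
    intro a b c h1 h2
    by_cases h3 : c = a
    · subst h3; exact Or.inl (A.self_ev _)
    · exact Or.inl (Or.inr ⟨h3, b, h1, h2⟩)
  have hcl : ∀ a x y, x ∈ B a → A.Adj x y → y ∈ B a := by
    rintro a x y ((hx | ⟨hx, b, h1, h2⟩) | hx) hxy
    · rw [Set.mem_singleton_iff] at hx; subst hx; exact Or.inr hxy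
    · by_cases hb : b = y
      · subst hb; exact Or.inr h1
      · obtain ⟨e, h3, h4⟩ := key (⟨h1, h2, hxy, Ne.symm hx, hb⟩ : A.P3 a b x y)
        exact mem2 h3 h4
    · exact mem2 hx hxy
  have hBB : ∀ a x, x ∈ B a → B x = B a := by
    intro a x hx
    have hsub : B x ⊆ B a := by
      rintro y ((hy | ⟨hy, b, h1, h2⟩) | hy)
      · rw [Set.mem_singleton_iff] at hy; subst hy; exact hx
      · exact hcl _ _ _ (hcl _ _ _ hx h1) h2
      · exact hcl _ _ _ hx hy
    exact Set.eq_of_subset_of_ncard_le hsub (by rw [hB, hB]) (Set.toFinite _)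
  have hc : (Set.univ : Set V).ncard = (Set.range B).ncard * 7057 := by
    apply fib_count B
    · intro a _; exact ⟨a, rfl⟩
    · rintro _ ⟨a, rfl⟩
      have : {x | x ∈ Set.univ ∧ B x = B a} = B a := by
        ext x; constructor
        · rintro ⟨-, hx⟩; rw [← hx]; exact Or.inl (A.self_ev _)
        · intro hx; exact ⟨trivial, hBB a x hx⟩
      rw [this]; exact hB a
  rw [Set.ncard_univ, A.card] at hc
  clear * - hc
  omega

theorem ev_compl {a c : V} (h : A.Adj a c) : A.ev c = (A.ev a)ᶜ := by
  have hdis : Disjoint (A.ev c) (A.ev a) := by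
    rw [Set.disjoint_left]
    rintro y (hy | ⟨hy, d, h1, h2⟩) (hy' | ⟨hy', b, h3, h4⟩)
    · rw [Set.mem_singleton_iff] at hy hy'
      exact A.ne h (hy'.symm.trans hy)
    · rw [Set.mem_singleton_iff] at hy; subst hy
      exact A.no3 h3 h4 (A.symm h)
    · rw [Set.mem_singleton_iff] at hy'; subst hy'
      exact A.no3 h1 h2 h
    · by_cases e1 : b = c
      · subst e1; exact A.no3 h1 h2 (A.symm h4)
      by_cases e2 : a = d
      · subst e2; exact A.no3 h3 h4 (A.symm h2)
      exact A.no5 (⟨A.symm h3, h, h1, e1, e2⟩ : A.P3 b a c d) h4 (A.symm h2)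
  refine Set.eq_of_subset_of_ncard_le (Set.subset_compl_iff_disjoint_right.2 hdis) ?_ (Set.toFinite _)
  have := Set.ncard_add_ncard_compl (A.ev a)
  rw [A.card, A.card_ev] at this
  rw [A.card_ev]
  clear * - this
  omega

theorem ev_eq {a x : V} (h : x ∈ A.ev a) : A.ev x = A.ev a := by
  rcases h with h | ⟨h, b, h1, h2⟩
  · rw [Set.mem_singleton_iff] at h; rw [h]
  · rw [A.ev_compl h2, A.ev_compl h1, compl_compl]

theorem ev_cases (a x : V) : A.ev x = A.ev a ∨ A.ev x = (A.ev a)ᶜ := by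
  obtain ⟨c, hc⟩ := A.exN a
  by_cases h : x ∈ A.ev a
  · exact Or.inl (A.ev_eq h)
  · right
    have : x ∈ A.ev c := by rw [A.ev_compl hc]; exact h
    rw [A.ev_eq this, A.ev_compl hc]

theorem ev_smul (g : G) (a x : V) : g • x ∈ A.ev (g • a) ↔ x ∈ A.ev a := by
  have key : ∀ (g : G) (a x : V), x ∈ A.ev a → g • x ∈ A.ev (g • a) := by
    rintro g a x (h | ⟨h, b, h1, h2⟩)
    · rw [Set.mem_singleton_iff] at h; rw [h]; exact A.self_ev _
    · exact Or.inr ⟨fun h' => h (smul_left_cancel g h'), g • b, A.inv g h1, A.inv g h2⟩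
  refine ⟨fun h => ?_, key g a x⟩
  have := key g⁻¹ _ _ h
  rwa [inv_smul_smul, inv_smul_smul] at this

theorem ev_smul_eq (g : G) {a x : V} (h : A.ev x = A.ev a) : A.ev (g • x) = A.ev (g • a) := by
  apply A.ev_eq
  rw [A.ev_smul, ← h]; exact A.self_ev x

theorem ev_fixed (g : G) (a : V) : A.ev (g • a) = A.ev a := by
  let K : Subgroup G :=
    { carrier := {g | ∀ x, A.ev (g • x) = A.ev x}
      mul_mem' := by
        intro g h hg hh x
        rw [mul_smul, hg, hh]
      one_mem' := by intro x; rw [one_smul]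
      inv_mem' := by
        intro g hg x
        have := hg (g⁻¹ • x)
        rw [smul_inv_smul] at this; exact this.symm }
  have hK : K.Normal := by
    constructor
    intro k hk g x
    have h1 := A.ev_smul_eq g (hk (g⁻¹ • x))
    rw [smul_inv_smul, ← mul_smul, ← mul_smul] at h1
    exact h1
  have hK2 : K ≠ ⊥ := by
    obtain ⟨E, h1, -, h2⟩ := A.fix a
    intro hbot
    have hE : E ≤ K := by
      intro e he x
      have h3 := (h2 e he).1
      rcases A.ev_cases a x with h | h
      · have := A.ev_smul_eq e h
        rw [this, h3, h]
      · obtain ⟨c, hc⟩ := A.exN a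
        rw [← A.ev_compl hc] at h
        have := A.ev_smul_eq e h
        rw [this, (h2 e he).2 c hc, h]
    rw [hbot, le_bot_iff] at hE
    rw [hE] at h1
    rw [Subgroup.card_bot] at h1
    norm_num at h1
  have hK3 : K = ⊤ := (A.simple K hK).resolve_left hK2
  have : g ∈ K := by rw [hK3]; trivial
  exact this a

theorem faithful (A : GA G V) {g : G} (hg : ∀ x : V, g • x = x) : g = 1 := by
  let K : Subgroup G :=
    { carrier := {g | ∀ x : V, g • x = x}
      mul_mem' := by
        intro g h hg hh x
        rw [mul_smul, hh, hg]
      one_mem' := by intro x; rw [one_smul]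
      inv_mem' := by
        intro g hg x
        rw [inv_smul_eq_iff]; exact (hg x).symm }
  have hK : K.Normal := by
    constructor
    intro k hk g x
    rw [mul_smul, mul_smul, hk, smul_inv_smul]
  rcases A.simple K hK with h | h
  · have : g ∈ K := hg
    rw [h] at this; exact this
  · exfalso
    obtain ⟨b⟩ := A.exA
    obtain ⟨c, hc⟩ := A.exN b
    obtain ⟨a, ha, hac⟩ := A.exN1 hc
    obtain ⟨a', ha', hac', haa⟩ := A.exN2 hc a
    obtain ⟨k, hk, -⟩ := A.tr hc ha ha' hac hac'
    have : k ∈ K := by rw [h]; trivial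
    exact haa (hk.symm.trans (this a))

end GA
end
end OD

set_option linter.all false
namespace OD

/-- projective plane with group action and a translation group -/
structure PL (G V : Type*) [Group G] [MulAction G V] where
  Adj : V → V → Prop
  symm : ∀ {a b}, Adj a b → Adj b a
  inv : ∀ (g : G) {a b}, Adj a b → Adj (g • a) (g • b)
  pt : V → Prop
  pt_inv : ∀ (g : G) {a}, pt a → pt (g • a)
  bip : ∀ {a b}, Adj a b → (pt a ↔ ¬ pt b)
  join : ∀ {a b}, a ≠ b → (pt a ↔ pt b) → ∃ m, Adj a m ∧ Adj b m
  uniq : ∀ {a b m n}, a ≠ b → Adj a m → Adj b m → Adj a n → Adj b n → m = n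
  deg : ∀ a, {b | Adj a b}.ncard = 84
  npt : {a | pt a}.ncard = 6973
  faithful : ∀ g : G, (∀ x : V, g • x = x) → g = 1
  l : V
  hl : ¬ pt l
  E : Subgroup G
  hE : Nat.card E = 83 ^ 2
  comm : ∀ x ∈ E, ∀ y ∈ E, x * y = y * x
  fixl : ∀ e ∈ E, e • l = l
  fix : ∀ e ∈ E, ∀ x, Adj l x → e • x = x

section
variable {G V : Type*} [Group G] [MulAction G V] [Finite V]

noncomputable def GA.toPL (A : GA G V) : PL G V :=
  let l : V := Classical.choice A.exA
  { Adj := A.Adj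
    symm := A.symm
    inv := A.inv
    pt := fun x => A.ev x ≠ A.ev l
    pt_inv := fun g a h => by rw [A.ev_fixed]; exact h
    bip := by
      intro a b h
      have h1 := A.ev_compl h
      have hne : A.ev a ≠ A.ev b := by
        intro h2
        have : b ∈ (A.ev a)ᶜ := by rw [← h1]; exact A.self_ev b
        exact this (by rw [h2]; exact A.self_ev b)
      constructor
      · intro h2 h3
        rcases A.ev_cases l a with h4 | h4
        · exact h2 h4
        · rw [h4, compl_compl] at h1; exact h3 h1
      · intro h2 h3
        exact h2 (fun h4 => hne (h3.trans h4.symm))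
    join := by
      intro a b hne h
      have h1 : A.ev a = A.ev b := by
        by_cases h3 : A.ev b = A.ev l
        · have : A.ev a = A.ev l := by
            by_contra h4; exact (h.1 h4) h3
          rw [this, h3]
        · have h5 := (A.ev_cases l b).resolve_left h3
          have h6 := (A.ev_cases l a).resolve_left (h.2 h3)
          rw [h5, h6]
      have h2 : b ∈ A.ev a := by rw [h1]; exact A.self_ev b
      rcases h2 with h2 | ⟨-, m, h3, h4⟩
      · exact absurd h2.symm hne
      · exact ⟨m, h3, A.symm h4⟩
    uniq := by
      intro a b m n hne h1 h2 h3 h4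
      by_contra h5
      exact A.no4 h1 (A.symm h2) h4 (A.symm h3) hne h5
    deg := A.deg
    npt := by
      obtain ⟨c, hc⟩ := A.exN l
      have : {a | A.ev a ≠ A.ev l} = A.ev c := by
        ext x; constructor
        · intro h
          have h5 := (A.ev_cases l x).resolve_left h
          rw [A.ev_compl hc, ← h5]; exact A.self_ev x
        · intro h h2
          rw [A.ev_compl hc] at h
          exact h (by rw [← h2]; exact A.self_ev x)
      rw [this, A.card_ev]
    faithful := fun g hg => A.faithful hg
    l := l
    hl := fun h => h rfl
    E := Classical.choose (A.fix l)
    hE := (Classical.choose_spec (A.fix l)).1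
    comm := (Classical.choose_spec (A.fix l)).2.1
    fixl := fun e he => ((Classical.choose_spec (A.fix l)).2.2 e he).1
    fix := fun e he => ((Classical.choose_spec (A.fix l)).2.2 e he).2 }

namespace PL
variable (A : PL G V)

/-- affine points -/
def Aff (x : V) : Prop := A.pt x ∧ ¬ A.Adj A.l x

theorem pt_of_l {x : V} (h : A.Adj A.l x) : A.pt x := by
  by_contra h2
  exact A.hl ((A.bip h).2 h2)

theorem ne_l {x m : V} (hx : A.Aff x) (h : A.Adj x m) : m ≠ A.l := by
  rintro rfl; exact hx.2 (A.symm h)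

theorem npt_of {x m : V} (hx : A.Aff x) (h : A.Adj x m) : ¬ A.pt m := (A.bip h).1 hx.1

theorem line_Q {x Q : V} (hx : A.Aff x) (hQ : A.Adj A.l Q) : ∃ m, A.Adj x m ∧ A.Adj Q m := by
  have hQp := A.pt_of_l hQ
  exact A.join (fun h => hx.2 (h ▸ hQ)) ⟨fun _ => hQp, fun _ => hx.1⟩

theorem meet_l {x m : V} (hx : A.Aff x) (h : A.Adj x m) : ∃ Q, A.Adj A.l Q ∧ A.Adj Q m := by
  obtain ⟨Q, h1, h2⟩ := A.join (A.ne_l hx h) ⟨fun h' => absurd h' (A.npt_of hx h), fun h' => absurd h' A.hl⟩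
  exact ⟨Q, h2, A.symm h1⟩

theorem meet_uniq {x m Q Q' : V} (hx : A.Aff x) (h : A.Adj x m) (h1 : A.Adj A.l Q) (h2 : A.Adj Q m)
    (h1' : A.Adj A.l Q') (h2' : A.Adj Q' m) : Q = Q' :=
  A.uniq (A.ne_l hx h) (A.symm h2) h1 (A.symm h2') h1'

theorem aff_inv {e x : _} (he : e ∈ A.E) (hx : A.Aff x) : A.Aff (e • x) := by
  refine ⟨A.pt_inv e hx.1, fun h => hx.2 ?_⟩
  have := A.inv e⁻¹ h
  rwa [inv_smul_smul, A.fixl _ (A.E.inv_mem he)] at this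

theorem aff_of_line {x Q m y : V} (hx : A.Aff x) (h : A.Adj x m) (hQ : A.Adj A.l Q) (hQm : A.Adj Q m) (hy : A.Adj y m) (hne : y ≠ Q) :
    A.Aff y := by
  refine ⟨(A.bip hy).2 (A.npt_of hx h), fun h1 => hne ?_⟩
  exact A.meet_uniq hx h h1 hy hQ hQm

theorem exQ (Q : V) : ∃ Q', A.Adj A.l Q' ∧ Q' ≠ Q := by
  have h1 : 1 < {b | A.Adj A.l b}.ncard := by rw [A.deg]; norm_num
  obtain ⟨b, hb, hne⟩ := Set.exists_ne_of_one_lt_ncard h1 Q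
  exact ⟨b, hb, hne⟩

theorem card_aff : {x | A.Aff x}.ncard = 83 ^ 2 := by
  have h1 : {x | A.Aff x} = {x | A.pt x} \ {x | A.Adj A.l x} := rfl
  have h2 := Set.ncard_diff_add_ncard_of_subset (s := {x | A.Adj A.l x}) (t := {x | A.pt x}) (fun x hx => A.pt_of_l hx) (Set.toFinite _)
  rw [← h1, A.deg, A.npt] at h2
  clear * - h2
  omega

theorem exO : ∃ o, A.Aff o := by
  have h : 0 < {x | A.Aff x}.ncard := by rw [A.card_aff]; norm_num
  exact (Set.ncard_pos (Set.toFinite _)).1 h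

/-- third point of a line -/
theorem exP {m : V} (a b : V) : ∃ x, A.Adj x m ∧ x ≠ a ∧ x ≠ b := by
  by_contra hcon
  have h1 : {x | A.Adj m x} ⊆ {a, b} := by
    intro x hx
    by_contra h2
    simp only [Set.mem_insert_iff, Set.mem_singleton_iff, not_or] at h2
    exact hcon ⟨x, A.symm hx, h2.1, h2.2⟩
  have h2 := Set.ncard_le_ncard h1 (Set.toFinite _)
  have h3 := Set.ncard_insert_le a {b}
  rw [A.deg] at h2
  rw [Set.ncard_singleton] at h3
  clear * - h2 h3
  omega

variable [Finite G]

theorem free {e o : _} (he : e ∈ A.E) (ho : A.Aff o) (h : e • o = o) : e = 1 := by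
  have hz : Subgroup.zpowers e ≤ A.E := by rwa [Subgroup.zpowers_le]
  have hzo : ∀ k ∈ Subgroup.zpowers e, k • o = o := by
    have : Subgroup.zpowers e ≤ MulAction.stabilizer G o := by rw [Subgroup.zpowers_le]; exact h
    exact this
  -- all affine points are fixed
  have haff : ∀ x, A.Aff x → e • x = x := by
    intro x hx
    by_cases hxo : x = o
    · rw [hxo, h]
    obtain ⟨m, hxm, hom⟩ := A.join hxo ⟨fun _ => ho.1, fun _ => hx.1⟩
    obtain ⟨Q, hQ, hQm⟩ := A.meet_l ho hom
    have hoQ : o ≠ Q := fun h => ho.2 (h ▸ hQ)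
    have hxQ : x ≠ Q := fun h => hx.2 (h ▸ hQ)
    have hmfix : ∀ k ∈ Subgroup.zpowers e, k • m = m := by
      intro k hk
      have h1 := A.inv k hom
      have h2 := A.inv k hQm
      rw [hzo k hk] at h1
      rw [A.fix k (hz hk) Q hQ] at h2
      exact A.uniq hoQ h1 h2 hom hQm
    have hsub : MulAction.orbit (Subgroup.zpowers e) x ⊆ ({y | A.Adj m y} \ {o}) \ {Q} := by
      rintro _ ⟨k, rfl⟩
      have h1 := A.inv (k : G) hxm
      rw [hmfix k k.2] at h1
      refine ⟨⟨A.symm h1, ?_⟩, ?_⟩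
      · intro h2
        have h3 : (k : G) • x = o := h2
        exact hxo (smul_left_cancel (k : G) (h3.trans (hzo k k.2).symm))
      · intro h2
        have h3 : (k : G) • x = Q := h2
        exact hxQ (smul_left_cancel (k : G) (h3.trans (A.fix k (hz k.2) Q hQ).symm))
    have h1 := Set.ncard_diff_singleton_add_one (show o ∈ {y | A.Adj m y} from A.symm hom) (Set.toFinite _)
    have h2 := Set.ncard_diff_singleton_add_one (show Q ∈ {y | A.Adj m y} \ {o} from ⟨A.symm hQm, hoQ.symm⟩) (Set.toFinite _)
    have h3 := Set.ncard_le_ncard hsub (Set.toFinite _)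
    rw [A.deg] at h1
    have h4 : (MulAction.orbit (Subgroup.zpowers e) x).ncard ≤ 82 := by
      clear * - h1 h2 h3
      omega
    have h5 : (MulAction.orbit (Subgroup.zpowers e) x).ncard ∣ 83 ^ 2 := by
      rw [← A.hE]
      exact Dvd.dvd.trans ⟨_, orb_stab (Subgroup.zpowers e) x⟩ (Subgroup.card_dvd_of_le hz)
    obtain ⟨i, hi, hi2⟩ := (Nat.dvd_prime_pow f83.out).1 h5
    have hi0 : i = 0 := by
      by_contra hi0
      have h6 : 83 ^ 1 ≤ 83 ^ i := Nat.pow_le_pow_right (by norm_num) (Nat.one_le_iff_ne_zero.2 hi0)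
      rw [← hi2] at h6
      clear * - h6 h4
      omega
    rw [hi0, pow_zero] at hi2
    obtain ⟨y, hy⟩ := Set.ncard_eq_one.1 hi2
    have e1 : x ∈ ({y} : Set V) := by rw [← hy]; exact MulAction.mem_orbit_self x
    have e2 : e • x ∈ ({y} : Set V) := by
      rw [← hy]; exact ⟨⟨e, Subgroup.mem_zpowers e⟩, rfl⟩
    exact (e2 : e • x = y).trans (e1 : x = y).symm
  have hpt : ∀ x, A.pt x → e • x = x := by
    intro x hx
    by_cases h1 : A.Adj A.l x
    · exact A.fix e he x h1
    · exact haff x ⟨hx, h1⟩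
  apply A.faithful
  intro x
  by_cases hx : A.pt x
  · exact hpt x hx
  · obtain ⟨a, ha, -, -⟩ := A.exP (m := x) x x
    obtain ⟨b, hb, hba, -⟩ := A.exP (m := x) a a
    have pa : A.pt a := (A.bip ha).2 hx
    have pb : A.pt b := (A.bip hb).2 hx
    have h1 := A.inv e ha
    have h2 := A.inv e hb
    rw [hpt a pa] at h1
    rw [hpt b pb] at h2
    exact A.uniq hba.symm h1 h2 ha hb

theorem trans {x y : V} (hx : A.Aff x) (hy : A.Aff y) : ∃ e ∈ A.E, e • x = y := by
  have h1 := orb_stab A.E x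
  have h2 : A.E ⊓ MulAction.stabilizer G x = ⊥ := by
    rw [eq_bot_iff]
    rintro e ⟨he, he2⟩
    exact A.free he hx he2
  rw [h2, Subgroup.card_bot, mul_one, A.hE] at h1
  have hsub : MulAction.orbit A.E x ⊆ {y | A.Aff y} := by
    rintro _ ⟨e, rfl⟩
    exact A.aff_inv e.2 hx
  have h3 := Set.eq_of_subset_of_ncard_le hsub (by rw [A.card_aff, h1]) (Set.toFinite _)
  have : y ∈ MulAction.orbit A.E x := by rw [h3]; exact hy
  obtain ⟨e, he⟩ := this
  exact ⟨e, e.2, he⟩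

/-- the translation `e` has direction `Q` -/
def R (e : G) (Q : V) : Prop := ∀ x, A.Aff x → ∃ m, A.Adj x m ∧ A.Adj (e • x) m ∧ A.Adj Q m

theorem R_mul {e e' Q : _} (he' : e' ∈ A.E) (hQ : A.Adj A.l Q) (h : A.R e Q) (h' : A.R e' Q) : A.R (e * e') Q := by
  intro x hx
  have hx' := A.aff_inv he' hx
  obtain ⟨m, h1, h2, h3⟩ := h' x hx
  obtain ⟨n, h4, h5, h6⟩ := h _ hx'
  have hne : e' • x ≠ Q := fun h => hx'.2 (h ▸ hQ)
  have := A.uniq hne h2 h3 h4 h6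
  subst this
  exact ⟨m, h1, by rwa [mul_smul], h3⟩

theorem R_one {Q : V} (hQ : A.Adj A.l Q) : A.R (1 : G) Q := by
  intro x hx
  obtain ⟨m, h1, h2⟩ := A.line_Q hx hQ
  exact ⟨m, h1, by rwa [one_smul], h2⟩

theorem R_pow {e Q : _} (he : e ∈ A.E) (hQ : A.Adj A.l Q) (h : A.R e Q) (n : ℕ) : A.R (e ^ n) Q := by
  induction' n with n ih
  · rw [pow_zero]; exact A.R_one hQ
  · rw [pow_succ]; exact A.R_mul he hQ ih h

theorem R_of {e Q x m : _} (he : e ∈ A.E) (hQ : A.Adj A.l Q) (hx : A.Aff x) (h1 : A.Adj x m) (h2 : A.Adj (e • x) m) (h3 : A.Adj Q m) : A.R e Q := by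
  intro y hy
  obtain ⟨k, hk, rfl⟩ := A.trans hx hy
  refine ⟨k • m, A.inv k h1, ?_, ?_⟩
  · rw [← mul_smul, A.comm e he k hk, mul_smul]; exact A.inv k h2
  · have := A.inv k h3
    rwa [A.fix k hk Q hQ] at this

theorem R_iff {e Q x m : _} (he : e ∈ A.E) (hQ : A.Adj A.l Q) (hx : A.Aff x) (h1 : A.Adj x m) (h3 : A.Adj Q m) :
    A.R e Q ↔ A.Adj (e • x) m := by
  constructor
  · intro h
    obtain ⟨n, h4, h5, h6⟩ := h x hx
    have hne : x ≠ Q := fun h => hx.2 (h ▸ hQ)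
    rw [A.uniq hne h1 h3 h4 h6]; exact h5
  · intro h; exact A.R_of he hQ hx h1 h h3

theorem R_ex {e : G} (he : e ∈ A.E) (h1 : e ≠ 1) : ∃ Q, A.Adj A.l Q ∧ A.R e Q := by
  obtain ⟨o, ho⟩ := A.exO
  have hne : o ≠ e • o := fun h => h1 (A.free he ho h.symm)
  obtain ⟨m, h2, h3⟩ := A.join hne ⟨fun _ => (A.aff_inv he ho).1, fun _ => ho.1⟩
  obtain ⟨Q, hQ, hQm⟩ := A.meet_l ho h2
  exact ⟨Q, hQ, A.R_of he hQ ho h2 h3 hQm⟩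

theorem R_uniq {e : G} (he : e ∈ A.E) (h1 : e ≠ 1) {Q Q' : V} (hQ : A.Adj A.l Q) (hQ' : A.Adj A.l Q') (h : A.R e Q) (h' : A.R e Q') : Q = Q' := by
  obtain ⟨o, ho⟩ := A.exO
  have hne : o ≠ e • o := fun h => h1 (A.free he ho h.symm)
  obtain ⟨m, h2, h3, h4⟩ := h o ho
  obtain ⟨n, h5, h6, h7⟩ := h' o ho
  have := A.uniq hne h2 h3 h5 h6
  subst this
  exact A.meet_uniq ho h2 hQ h4 hQ' h7

/-- every direction is realised -/
theorem R_surj {Q : V} (hQ : A.Adj A.l Q) : ∃ e ∈ A.E, e ≠ 1 ∧ A.R e Q := by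
  obtain ⟨o, ho⟩ := A.exO
  obtain ⟨m, h1, h2⟩ := A.line_Q ho hQ
  obtain ⟨x, hx, hxo, hxQ⟩ := A.exP (m := m) o Q
  have hxa := A.aff_of_line ho h1 hQ h2 hx hxQ
  obtain ⟨e, he, rfl⟩ := A.trans ho hxa
  refine ⟨e, he, ?_, A.R_of he hQ ho h1 hx h2⟩
  rintro rfl
  exact hxo (one_smul _ _)

theorem R_not {Q : V} (hQ : A.Adj A.l Q) : ∃ e ∈ A.E, ¬ A.R e Q := by
  obtain ⟨Q', hQ', hne⟩ := A.exQ Q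
  obtain ⟨e, he, h1, h2⟩ := A.R_surj hQ'
  exact ⟨e, he, fun h => hne (A.R_uniq he h1 hQ' hQ h2 h)⟩

theorem exp83 {e : G} (he : e ∈ A.E) : e ^ 83 = 1 := by
  by_contra hn
  have h1 : e ≠ 1 := by rintro rfl; exact hn (one_pow _)
  obtain ⟨Q, hQ, hR⟩ := A.R_ex he h1
  have hz : Subgroup.zpowers e ≤ A.E := by rwa [Subgroup.zpowers_le]
  have h2 : orderOf e ∣ 83 ^ 2 := by
    rw [← A.hE, ← Nat.card_zpowers]; exact Subgroup.card_dvd_of_le hz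
  have h3 : orderOf e = 83 ^ 2 := by
    have := orderOf_eq_prime_pow (x := e) (p := 83) (n := 1) (by simpa using hn) (by
      exact orderOf_dvd_iff_pow_eq_one.1 h2)
    exact this
  have h4 : Subgroup.zpowers e = A.E := Subgroup.eq_of_le_of_card_ge hz (by rw [Nat.card_zpowers, h3, A.hE])
  obtain ⟨k, hk, hkn⟩ := A.R_not hQ
  rw [← h4] at hk
  have hk2 := (mem_powers_iff_mem_zpowers (x := e) (y := k)).2 hk
  obtain ⟨n, rfl⟩ := hk2
  exact hkn (A.R_pow he hQ hR n)

end PL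
end
end OD

set_option linter.all false
namespace OD
section
variable {G V : Type*} [Group G] [MulAction G V] [Finite V] [Finite G]

theorem tau_exists {E : Subgroup G} (hE : Nat.card E = 83 ^ 2) (comm : ∀ x ∈ E, ∀ y ∈ E, x * y = y * x)
    (hx : ∀ e ∈ E, e ^ 83 = 1) : ∃ τ : ZMod 83 → ZMod 83 → G, (∀ x y, τ x y ∈ E) ∧
      (∀ x y x' y', τ (x + x') (y + y') = τ x y * τ x' y') ∧ (∀ e ∈ E, ∃ x y, τ x y = e) ∧
      (∀ x y, τ x y = 1 → x = 0 ∧ y = 0) := by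
  letI : CommGroup E := { (inferInstance : Group E) with
    mul_comm := fun a b => Subtype.ext (comm a a.2 b b.2) }
  letI : Module (ZMod 83) (Additive E) := AddCommGroup.zmodModule (n := 83) (by
    intro x
    apply Additive.toMul.injective
    apply Subtype.ext
    exact hx _ (Additive.toMul x).2)
  haveI : Finite (Additive E) := inferInstanceAs (Finite E)
  have h2 : Module.finrank (ZMod 83) (Additive E) = 2 := by
    have := Module.natCard_eq_pow_finrank (K := ZMod 83) (V := Additive E)
    rw [Nat.card_zmod, show Nat.card (Additive E) = 83 ^ 2 from hE] at this
    exact (Nat.pow_right_injective (le_refl 83 |>.trans' (by norm_num)) this).symm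
  let L : (ZMod 83 × ZMod 83) ≃ₗ[ZMod 83] Additive E := LinearEquiv.ofFinrankEq _ _ (by rw [h2]; simp)
  refine ⟨fun x y => ((Additive.toMul (L (x, y)) : E) : G), ?_, ?_, ?_, ?_⟩
  · intro x y; exact (Additive.toMul (L (x, y))).2
  · intro x y x' y'
    dsimp only
    rw [← Prod.mk_add_mk, map_add]; rfl
  · intro e he
    refine ⟨(L.symm (Additive.ofMul ⟨e, he⟩)).1, (L.symm (Additive.ofMul ⟨e, he⟩)).2, ?_⟩
    dsimp only
    rw [Prod.mk.eta, LinearEquiv.apply_symm_apply]; rfl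
  · intro x y h
    have h3 : L (x, y) = 0 := by
      apply Additive.toMul.injective
      apply Subtype.ext
      exact h
    rw [LinearEquiv.map_eq_zero_iff] at h3
    exact Prod.mk_eq_zero.1 h3

theorem tau_smul {τ : ZMod 83 → ZMod 83 → G} (h : ∀ x y x' y', τ (x + x') (y + y') = τ x y * τ x' y') (c x y : ZMod 83) :
    τ (c * x) (c * y) = τ x y ^ c.val := by
  have h0 : τ 0 0 = 1 := by
    have := h 0 0 0 0
    rw [add_zero] at this
    exact mul_eq_left.1 this.symm
  have : ∀ n : ℕ, τ ((n : ZMod 83) * x) ((n : ZMod 83) * y) = τ x y ^ n := by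
    intro n
    induction' n with n ih
    · simp [h0]
    · rw [Nat.cast_succ, add_mul, add_mul, one_mul, one_mul, h, ih, pow_succ]
  have h2 := this c.val
  rwa [ZMod.natCast_zmod_val] at h2

theorem coord (A : PL G V) : ∃ f : (Fin 3 → ZMod 83) → V, (∀ v, v ≠ 0 → A.pt (f v)) ∧ (∀ x, A.pt x → ∃ v, v ≠ 0 ∧ f v = x) ∧
    (∀ (v : Fin 3 → ZMod 83) (c : ZMod 83), v ≠ 0 → c ≠ 0 → f (c • v) = f v) ∧
    (∀ φ : Fin 3 → ZMod 83, φ ≠ 0 → ∃ m, ¬ A.pt m ∧ ∀ v, v ≠ 0 → (A.Adj (f v) m ↔ φ 0 * v 0 + φ 1 * v 1 + φ 2 * v 2 = 0)) := by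
  classical
  obtain ⟨τ, t1, t2, t3, t4⟩ := tau_exists A.hE A.comm (fun e he => A.exp83 he)
  obtain ⟨o, ho⟩ := A.exO
  have t0 : τ 0 0 = 1 := by
    have := t2 0 0 0 0
    rw [add_zero] at this
    exact mul_eq_left.1 this.symm
  have t5 : ∀ x y, ¬ (x = 0 ∧ y = 0) → τ x y ≠ 1 := fun x y h h2 => h (t4 x y h2)
  have hscal : ∀ {x y Q}, A.Adj A.l Q → A.R (τ x y) Q → ∀ c, A.R (τ (c * x) (c * y)) Q := by
    intro x y Q hQ h c
    rw [tau_smul t2]; exact A.R_pow (t1 _ _) hQ h _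
  have hlin : ∀ {a b Q}, A.Adj A.l Q → A.R (τ a b) Q → ¬ (a = 0 ∧ b = 0) → ∀ x y, A.R (τ x y) Q ↔ a * y - b * x = 0 := by
    intro a b Q hQ h hab x y
    constructor
    · intro h2
      by_contra hd
      obtain ⟨e, he, hne⟩ := A.R_not hQ
      obtain ⟨s, t, rfl⟩ := t3 e he
      apply hne
      have e1 : s = (s * y - t * x) / (a * y - b * x) * a + (a * t - b * s) / (a * y - b * x) * x := by
        rw [div_mul_eq_mul_div, div_mul_eq_mul_div, ← add_div, eq_div_iff hd]; ring
      have e2 : t = (s * y - t * x) / (a * y - b * x) * b + (a * t - b * s) / (a * y - b * x) * y := by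
        rw [div_mul_eq_mul_div, div_mul_eq_mul_div, ← add_div, eq_div_iff hd]; ring
      have e3 := t2 ((s * y - t * x) / (a * y - b * x) * a) ((s * y - t * x) / (a * y - b * x) * b) ((a * t - b * s) / (a * y - b * x) * x) ((a * t - b * s) / (a * y - b * x) * y)
      rw [← e1, ← e2] at e3
      rw [e3]
      exact A.R_mul (t1 _ _) hQ (hscal hQ h _) (hscal hQ h2 _)
    · intro h2
      by_cases ha : a = 0
      · have hb : b ≠ 0 := fun h => hab ⟨ha, h⟩
        have h3 := hscal hQ h (y / b)
        have e1 : y / b * a = x := by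
          subst ha
          have : b * x = 0 := by linear_combination - h2
          rcases mul_eq_zero.1 this with h | h
          · exact absurd h hb
          · rw [h, mul_zero]
        rwa [e1, div_mul_cancel₀ _ hb] at h3
      · have h3 := hscal hQ h (x / a)
        have e1 : x / a * b = y := by
          field_simp
          linear_combination - h2
        rwa [e1, div_mul_cancel₀ _ ha] at h3
  have hdir : ∀ x y, ∃ Q, ¬ (x = 0 ∧ y = 0) → A.Adj A.l Q ∧ A.R (τ x y) Q := by
    intro x y
    by_cases h : x = 0 ∧ y = 0
    · exact ⟨A.l, fun h' => absurd h h'⟩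
    · obtain ⟨Q, hQ⟩ := A.R_ex (t1 x y) (t5 x y h)
      exact ⟨Q, fun _ => hQ⟩
  choose dir hdir using hdir
  have hdu : ∀ {x y Q}, ¬ (x = 0 ∧ y = 0) → A.Adj A.l Q → A.R (τ x y) Q → dir x y = Q := fun h hQ hR =>
    A.R_uniq (t1 _ _) (t5 _ _ h) (hdir _ _ h).1 hQ (hdir _ _ h).2 hR
  have hnz : ∀ v : Fin 3 → ZMod 83, v ≠ 0 → v 2 = 0 → ¬ (v 0 = 0 ∧ v 1 = 0) := by
    rintro v hv h2 ⟨h0, h1⟩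
    apply hv; ext i; fin_cases i <;> simp [h0, h1, h2]
  let f : (Fin 3 → ZMod 83) → V := fun v => if v 2 = 0 then dir (v 0) (v 1) else τ (v 0 / v 2) (v 1 / v 2) • o
  have f0 : ∀ v, v 2 = 0 → f v = dir (v 0) (v 1) := fun v h => if_pos h
  have f1 : ∀ v, v 2 ≠ 0 → f v = τ (v 0 / v 2) (v 1 / v 2) • o := fun v h => if_neg h
  have haff : ∀ v, v 2 ≠ 0 → A.Aff (f v) := fun v h => by rw [f1 v h]; exact A.aff_inv (t1 _ _) ho
  have hinf : ∀ v, v ≠ 0 → v 2 = 0 → A.Adj A.l (f v) := fun v hv h => by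
    rw [f0 v h]; exact (hdir _ _ (hnz v hv h)).1
  refine ⟨f, ?_, ?_, ?_, ?_⟩
  · intro v hv
    by_cases h : v 2 = 0
    · exact A.pt_of_l (hinf v hv h)
    · exact (haff v h).1
  · intro x hx
    by_cases h : A.Adj A.l x
    · obtain ⟨e, he, he1, heR⟩ := A.R_surj h
      obtain ⟨s, t, rfl⟩ := t3 e he
      have hst : ¬ (s = 0 ∧ t = 0) := by
        rintro ⟨rfl, rfl⟩; exact he1 t0
      refine ⟨![s, t, 0], ?_, ?_⟩
      · intro hv
        exact hst ⟨congrFun hv 0, congrFun hv 1⟩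
      · rw [f0 _ rfl]
        exact hdu hst h heR
    · obtain ⟨e, he, rfl⟩ := A.trans ho ⟨hx, h⟩
      obtain ⟨s, t, rfl⟩ := t3 e he
      refine ⟨![s, t, 1], ?_, ?_⟩
      · intro hv
        have := congrFun hv 2
        simp at this
      · rw [f1 _ (by simp)]
        simp
  · intro v c hv hc
    by_cases h : v 2 = 0
    · have h' : (c • v) 2 = 0 := by simp [h]
      rw [f0 v h, f0 _ h']
      have hz := hnz v hv h
      have h2 := hdir _ _ hz
      apply hdu
      · simp only [Pi.smul_apply, smul_eq_mul, mul_eq_zero, hc, false_or]; exact hz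
      · exact h2.1
      · exact hscal h2.1 h2.2 c
    · have h' : (c • v) 2 ≠ 0 := by simp [h, hc]
      rw [f1 v h, f1 _ h']
      simp only [Pi.smul_apply, smul_eq_mul]
      rw [mul_div_mul_left _ _ hc, mul_div_mul_left _ _ hc]
  · intro φ hφ
    by_cases hab : φ 0 = 0 ∧ φ 1 = 0
    · have hc : φ 2 ≠ 0 := by
        intro hc
        apply hφ; ext i; fin_cases i <;> simp [hab.1, hab.2, hc]
      refine ⟨A.l, A.hl, fun v hv => ?_⟩
      rw [hab.1, hab.2]
      constructor
      · intro h
        by_cases h2 : v 2 = 0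
        · rw [h2]; ring
        · exact absurd (A.symm h) (haff v h2).2
      · intro h
        have h2 : v 2 = 0 := by
          have : φ 2 * v 2 = 0 := by linear_combination h
          exact (mul_eq_zero.1 this).resolve_left hc
        exact A.symm (hinf v hv h2)
    · have hd : ¬ (φ 1 = 0 ∧ - φ 0 = 0) := by
        rintro ⟨h1, h2⟩; exact hab ⟨neg_eq_zero.1 h2, h1⟩
      obtain ⟨hQ, hQR⟩ := hdir _ _ hd
      set Q := dir (φ 1) (- φ 0) with hQd
      obtain ⟨x0, y0, h0⟩ : ∃ x0 y0, φ 0 * x0 + φ 1 * y0 + φ 2 = 0 := by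
        by_cases h : φ 0 = 0
        · have h1 : φ 1 ≠ 0 := fun h' => hab ⟨h, h'⟩
          exact ⟨0, - φ 2 / φ 1, by field_simp; ring⟩
        · exact ⟨- φ 2 / φ 0, 0, by field_simp; ring⟩
      have hp : A.Aff (τ x0 y0 • o) := A.aff_inv (t1 _ _) ho
      obtain ⟨m, hpm, hQm⟩ := A.line_Q hp hQ
      refine ⟨m, A.npt_of hp hpm, fun v hv => ?_⟩
      by_cases h2 : v 2 = 0
      · have hz := hnz v hv h2
        have h3 := hinf v hv h2
        have h4 : A.Adj (f v) m ↔ A.R (τ (v 0) (v 1)) Q := by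
          constructor
          · intro h
            have : f v = Q := A.meet_uniq hp hpm h3 h hQ hQm
            rw [← this, f0 v h2]; exact (hdir _ _ hz).2
          · intro h
            have : f v = Q := by rw [f0 v h2]; exact hdu hz hQ h
            rw [this]; exact hQm
        rw [h4, hlin hQ hQR hd, h2]
        constructor
        · intro h; linear_combination h
        · intro h; linear_combination h
      · have h3 : f v = τ (v 0 / v 2 - x0) (v 1 / v 2 - y0) • (τ x0 y0 • o) := by
          rw [f1 v h2, ← mul_smul, ← t2]; congr 2 <;> ring
        rw [h3, ← A.R_iff (t1 _ _) hQ hp hpm hQm, hlin hQ hQR hd]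
        have e : φ 1 * (v 1 / v 2 - y0) - - φ 0 * (v 0 / v 2 - x0) = (φ 0 * v 0 + φ 1 * v 1 + φ 2 * v 2) / v 2 := by
          field_simp
          linear_combination (- v 2) * h0
        rw [e, div_eq_zero_iff]
        simp [h2]

end
end OD

set_option linter.all false
namespace OD
section

/-- determinant of three vectors -/
def dt {F : Type*} [CommRing F] (u v w : Fin 3 → F) : F :=
  u 0 * (v 1 * w 2 - v 2 * w 1) - u 1 * (v 0 * w 2 - v 2 * w 0) + u 2 * (v 0 * w 1 - v 1 * w 0)

theorem dt_det {F : Type*} [CommRing F] (u v w : Fin 3 → F) : dt u v w = (Matrix.of ![u, v, w]).det := by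
  rw [Matrix.det_fin_three]; simp [dt]; ring

theorem dt_mul {F : Type*} [CommRing F] (M : Matrix (Fin 3) (Fin 3) F) (u v w : Fin 3 → F) :
    dt (M.mulVec u) (M.mulVec v) (M.mulVec w) = M.det * dt u v w := by
  rw [dt_det, dt_det, mul_comm, ← Matrix.det_transpose M, ← Matrix.det_mul]
  congr 1
  ext i j
  fin_cases i <;> simp [Matrix.mul_apply, Matrix.mulVec, dotProduct, mul_comm]

theorem dt_smul {F : Type*} [CommRing F] (a b : F) (u v w : Fin 3 → F) : dt (a • u) (b • v) w = a * b * dt u v w := by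
  simp [dt]; ring

variable {p : ℕ} [hp : Fact p.Prime]

theorem ftpg1 {ρ : (Fin 3 → ZMod p) → (Fin 3 → ZMod p)} (h0 : ∀ v, v ≠ 0 → ρ v ≠ 0)
    (hd : ∀ u v w, u ≠ 0 → v ≠ 0 → w ≠ 0 → dt u v w = 0 → dt (ρ u) (ρ v) (ρ w) = 0)
    (h1 : ∃ c : ZMod p, ρ ![1, 0, 0] = c • ![1, 0, 0]) (h2 : ∃ c : ZMod p, ρ ![0, 1, 0] = c • ![0, 1, 0])
    (h3 : ∃ c : ZMod p, ρ ![0, 0, 1] = c • ![0, 0, 1]) (h4 : ∃ c : ZMod p, ρ ![1, 1, 1] = c • ![1, 1, 1]) :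
    ∀ v, v ≠ 0 → ∃ c : ZMod p, ρ v = c • v := by
  have lin : ∀ a b w, (∃ c : ZMod p, ρ a = c • a) → (∃ c : ZMod p, ρ b = c • b) → a ≠ 0 → b ≠ 0 → w ≠ 0 → dt a b w = 0 → dt a b (ρ w) = 0 := by
    rintro a b w ⟨c, hc⟩ ⟨d, hd'⟩ ha hb hw h
    have h5 := hd a b w ha hb hw h
    have hc0 : c ≠ 0 := by rintro rfl; exact h0 a ha (by rw [hc, zero_smul])
    have hd0 : d ≠ 0 := by rintro rfl; exact h0 b hb (by rw [hd', zero_smul])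
    rw [hc, hd', dt_smul] at h5
    exact (mul_eq_zero.1 h5).resolve_left (mul_ne_zero hc0 hd0)
  have nz : ∀ {x y z : ZMod p}, (x ≠ 0 ∨ y ≠ 0 ∨ z ≠ 0) → (![x, y, z] : Fin 3 → ZMod p) ≠ 0 := by
    intro x y z h h'
    have e0 : x = 0 := congrFun h' 0
    have e1 : y = 0 := congrFun h' 1
    have e2 : z = 0 := congrFun h' 2
    rcases h with h | h | h
    · exact h e0
    · exact h e1
    · exact h e2
  have fin : ∀ {x y z c : ZMod p}, ρ ![x, y, z] 0 = c * x → ρ ![x, y, z] 1 = c * y → ρ ![x, y, z] 2 = c * z →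
      ∃ c : ZMod p, ρ ![x, y, z] = c • ![x, y, z] := by
    intro x y z c e0 e1 e2
    refine ⟨c, ?_⟩
    ext i; fin_cases i
    · simpa using e0
    · simpa using e1
    · simpa using e2
  have n1 : (![1, 0, 0] : Fin 3 → ZMod p) ≠ 0 := nz (Or.inl one_ne_zero)
  have n2 : (![0, 1, 0] : Fin 3 → ZMod p) ≠ 0 := nz (Or.inr (Or.inl one_ne_zero))
  have n3 : (![0, 0, 1] : Fin 3 → ZMod p) ≠ 0 := nz (Or.inr (Or.inr one_ne_zero))
  have n4 : (![1, 1, 1] : Fin 3 → ZMod p) ≠ 0 := nz (Or.inl one_ne_zero)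
  -- (1,0,1) and (0,1,1)
  have n5 : (![1, 0, 1] : Fin 3 → ZMod p) ≠ 0 := nz (Or.inl one_ne_zero)
  have h5 : ∃ c : ZMod p, ρ ![1, 0, 1] = c • ![1, 0, 1] := by
    have a1 := lin _ _ ![1, 0, 1] h1 h3 n1 n3 n5 (by simp [dt])
    have a2 := lin _ _ ![1, 0, 1] h2 h4 n2 n4 n5 (by simp [dt])
    simp [dt] at a1 a2
    refine fin (c := ρ ![1, 0, 1] 2) ?_ ?_ ?_
    · linear_combination a2
    · linear_combination a1
    · ring
  have n6 : (![0, 1, 1] : Fin 3 → ZMod p) ≠ 0 := nz (Or.inr (Or.inl one_ne_zero))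
  have h6 : ∃ c : ZMod p, ρ ![0, 1, 1] = c • ![0, 1, 1] := by
    have a1 := lin _ _ ![0, 1, 1] h2 h3 n2 n3 n6 (by simp [dt])
    have a2 := lin _ _ ![0, 1, 1] h1 h4 n1 n4 n6 (by simp [dt])
    simp [dt] at a1 a2
    refine fin (c := ρ ![0, 1, 1] 2) ?_ ?_ ?_
    · linear_combination a1
    · linear_combination - a2
    · ring
  have n7 : (![1, -1, 0] : Fin 3 → ZMod p) ≠ 0 := nz (Or.inl one_ne_zero)
  have h7 : ∃ c : ZMod p, ρ ![1, -1, 0] = c • ![1, -1, 0] := by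
    have a1 := lin _ _ ![1, -1, 0] h1 h2 n1 n2 n7 (by simp [dt])
    have a2 := lin _ _ ![1, -1, 0] h5 h6 n5 n6 n7 (by simp [dt])
    simp [dt] at a1 a2
    refine fin (c := ρ ![1, -1, 0] 0) ?_ ?_ ?_
    · ring
    · linear_combination a1 - a2
    · linear_combination a1
  have nx : ∀ x y : ZMod p, (![x, y, 1] : Fin 3 → ZMod p) ≠ 0 := fun x y => nz (Or.inr (Or.inr one_ne_zero))
  have hx : ∀ n : ℕ, ∃ c : ZMod p, ρ ![(n : ZMod p), 0, 1] = c • ![(n : ZMod p), 0, 1] := by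
    intro n
    induction' n with n ih
    · simpa using h3
    · have q : ∃ c : ZMod p, ρ ![(n : ZMod p), 1, 1] = c • ![(n : ZMod p), 1, 1] := by
        have a1 := lin _ _ ![(n : ZMod p), 1, 1] ih h2 (nx _ _) n2 (nx _ _) (by simp [dt])
        have a2 := lin _ _ ![(n : ZMod p), 1, 1] h6 h1 n6 n1 (nx _ _) (by simp [dt])
        simp [dt] at a1 a2
        refine fin (c := ρ ![(n : ZMod p), 1, 1] 2) ?_ ?_ ?_
        · linear_combination - a1
        · linear_combination a2
        · ring
      have a1 := lin _ _ ![((n + 1 : ℕ) : ZMod p), 0, 1] h1 h3 n1 n3 (nx _ _) (by simp [dt])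
      have a2 := lin _ _ ![((n + 1 : ℕ) : ZMod p), 0, 1] q h7 (nx _ _) n7 (nx _ _) (by simp [dt])
      simp only [dt, Matrix.cons_val_zero, Matrix.cons_val_one, Matrix.cons_val] at a1 a2
      refine fin (c := ρ ![((n + 1 : ℕ) : ZMod p), 0, 1] 2) ?_ ?_ ?_
      · push_cast at a1 a2 ⊢
        linear_combination a2 + a1
      · linear_combination - a1
      · ring
  have hy : ∀ n : ℕ, ∃ c : ZMod p, ρ ![0, (n : ZMod p), 1] = c • ![0, (n : ZMod p), 1] := by
    intro n
    induction' n with n ih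
    · simpa using h3
    · have q : ∃ c : ZMod p, ρ ![1, (n : ZMod p), 1] = c • ![1, (n : ZMod p), 1] := by
        have a1 := lin _ _ ![1, (n : ZMod p), 1] ih h1 (nx _ _) n1 (nx _ _) (by simp [dt])
        have a2 := lin _ _ ![1, (n : ZMod p), 1] h5 h2 n5 n2 (nx _ _) (by simp [dt])
        simp [dt] at a1 a2
        refine fin (c := ρ ![1, (n : ZMod p), 1] 2) ?_ ?_ ?_
        · linear_combination - a2
        · linear_combination a1
        · ring
      have a1 := lin _ _ ![0, ((n + 1 : ℕ) : ZMod p), 1] h2 h3 n2 n3 (nx _ _) (by simp [dt])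
      have a2 := lin _ _ ![0, ((n + 1 : ℕ) : ZMod p), 1] q h7 (nx _ _) n7 (nx _ _) (by simp [dt]; ring)
      simp only [dt, Matrix.cons_val_zero, Matrix.cons_val_one, Matrix.cons_val] at a1 a2
      refine fin (c := ρ ![0, ((n + 1 : ℕ) : ZMod p), 1] 2) ?_ ?_ ?_
      · linear_combination a1
      · push_cast at a1 a2 ⊢
        linear_combination a2 - a1
      · ring
  have hx' : ∀ x : ZMod p, ∃ c : ZMod p, ρ ![x, 0, 1] = c • ![x, 0, 1] := fun x => by
    have := hx x.val; rwa [ZMod.natCast_zmod_val] at this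
  have hy' : ∀ x : ZMod p, ∃ c : ZMod p, ρ ![0, x, 1] = c • ![0, x, 1] := fun x => by
    have := hy x.val; rwa [ZMod.natCast_zmod_val] at this
  have hz : ∀ x y z : ZMod p, z ≠ 0 → ∃ c : ZMod p, ρ ![x, y, z] = c • ![x, y, z] := by
    intro x y z hz
    have nn : (![x, y, z] : Fin 3 → ZMod p) ≠ 0 := nz (Or.inr (Or.inr hz))
    have a1 := lin _ _ ![x, y, z] (hx' (x / z)) h2 (nx _ _) n2 nn (by simp [dt]; field_simp; ring)
    have a2 := lin _ _ ![x, y, z] (hy' (y / z)) h1 (nx _ _) n1 nn (by simp [dt]; field_simp; ring)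
    simp [dt] at a1 a2
    refine fin (c := ρ ![x, y, z] 2 / z) ?_ ?_ ?_
    · linear_combination - a1
    · linear_combination a2
    · field_simp
  intro v hv
  have ev : v = ![v 0, v 1, v 2] := by ext i; fin_cases i <;> rfl
  by_cases h : v 2 = 0
  · have hne : v 0 ≠ 0 ∨ v 1 ≠ 0 := by
      by_contra hcon
      rw [not_or, not_not, not_not] at hcon
      apply hv; ext i; fin_cases i <;> simp [h, hcon.1, hcon.2]
    rw [h] at ev
    have nn : (![v 0, v 1, 0] : Fin 3 → ZMod p) ≠ 0 := by rw [← ev]; exact hv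
    have a1 := lin _ _ ![v 0, v 1, 0] h1 h2 n1 n2 nn (by simp [dt])
    have a2 := lin _ _ ![v 0, v 1, 0] h3 (hz (v 0) (v 1) 1 one_ne_zero) n3 (nx _ _) nn (by simp [dt]; ring)
    rw [ev]
    simp [dt] at a1 a2
    by_cases h0' : v 0 = 0
    · have h1' : v 1 ≠ 0 := hne.resolve_left (fun h => h h0')
      refine fin (c := ρ ![v 0, v 1, 0] 1 / v 1) ?_ ?_ ?_
      · field_simp
        linear_combination - a2
      · field_simp
      · linear_combination a1
    · refine fin (c := ρ ![v 0, v 1, 0] 0 / v 0) ?_ ?_ ?_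
      · field_simp
      · field_simp
        linear_combination a2
      · linear_combination a1
  · rw [ev]; exact hz _ _ _ h

theorem ftpg {σ : (Fin 3 → ZMod p) → (Fin 3 → ZMod p)} (h0 : ∀ v, v ≠ 0 → σ v ≠ 0)
    (hd : ∀ u v w, u ≠ 0 → v ≠ 0 → w ≠ 0 → (dt u v w = 0 ↔ dt (σ u) (σ v) (σ w) = 0)) :
    ∃ M : Matrix (Fin 3) (Fin 3) (ZMod p), M.det ≠ 0 ∧ ∀ v, v ≠ 0 → ∃ c : ZMod p, c ≠ 0 ∧ σ v = c • M.mulVec v := by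
  have nz : ∀ {x y z : ZMod p}, (x ≠ 0 ∨ y ≠ 0 ∨ z ≠ 0) → (![x, y, z] : Fin 3 → ZMod p) ≠ 0 := by
    intro x y z h h'
    have e0 : x = 0 := congrFun h' 0
    have e1 : y = 0 := congrFun h' 1
    have e2 : z = 0 := congrFun h' 2
    rcases h with h | h | h
    · exact h e0
    · exact h e1
    · exact h e2
  have n1 : (![1, 0, 0] : Fin 3 → ZMod p) ≠ 0 := nz (Or.inl one_ne_zero)
  have n2 : (![0, 1, 0] : Fin 3 → ZMod p) ≠ 0 := nz (Or.inr (Or.inl one_ne_zero))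
  have n3 : (![0, 0, 1] : Fin 3 → ZMod p) ≠ 0 := nz (Or.inr (Or.inr one_ne_zero))
  have n4 : (![1, 1, 1] : Fin 3 → ZMod p) ≠ 0 := nz (Or.inl one_ne_zero)
  let N : Matrix (Fin 3) (Fin 3) (ZMod p) := (Matrix.of ![σ ![1, 0, 0], σ ![0, 1, 0], σ ![0, 0, 1]]).transpose
  have hN : N.det ≠ 0 := by
    intro h
    rw [Matrix.det_transpose, ← dt_det, ← hd _ _ _ n1 n2 n3] at h
    simp [dt] at h
  have e1 : N.mulVec ![1, 0, 0] = σ ![1, 0, 0] := by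
    ext i; simp [N, Matrix.mulVec, dotProduct, Fin.sum_univ_three]
  have e2 : N.mulVec ![0, 1, 0] = σ ![0, 1, 0] := by
    ext i; simp [N, Matrix.mulVec, dotProduct, Fin.sum_univ_three]
  have e3 : N.mulVec ![0, 0, 1] = σ ![0, 0, 1] := by
    ext i; simp [N, Matrix.mulVec, dotProduct, Fin.sum_univ_three]
  obtain ⟨c, hc⟩ : ∃ c, N.mulVec c = σ ![1, 1, 1] := by
    refine ⟨N⁻¹.mulVec (σ ![1, 1, 1]), ?_⟩
    rw [Matrix.mulVec_mulVec, Matrix.mul_nonsing_inv _ (isUnit_iff_ne_zero.2 hN), Matrix.one_mulVec]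
  have c0 : c 0 ≠ 0 := by
    intro h
    have h5 : dt (σ ![1, 1, 1]) (σ ![0, 1, 0]) (σ ![0, 0, 1]) = 0 := by
      rw [← hc, ← e2, ← e3, dt_mul]; simp [dt, h]
    rw [← hd _ _ _ n4 n2 n3] at h5
    simp [dt] at h5
  have c1 : c 1 ≠ 0 := by
    intro h
    have h5 : dt (σ ![1, 1, 1]) (σ ![1, 0, 0]) (σ ![0, 0, 1]) = 0 := by
      rw [← hc, ← e1, ← e3, dt_mul]; simp [dt, h]
    rw [← hd _ _ _ n4 n1 n3] at h5
    simp [dt] at h5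
  have c2 : c 2 ≠ 0 := by
    intro h
    have h5 : dt (σ ![1, 1, 1]) (σ ![1, 0, 0]) (σ ![0, 1, 0]) = 0 := by
      rw [← hc, ← e1, ← e2, dt_mul]; simp [dt, h]
    rw [← hd _ _ _ n4 n1 n2] at h5
    simp [dt] at h5
  let M := N * Matrix.diagonal c
  have hM : M.det ≠ 0 := by
    rw [Matrix.det_mul, Matrix.det_diagonal, Fin.prod_univ_three]
    exact mul_ne_zero hN (mul_ne_zero (mul_ne_zero c0 c1) c2)
  have hMu : IsUnit M.det := isUnit_iff_ne_zero.2 hM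
  have inv1 : ∀ x, M⁻¹.mulVec (M.mulVec x) = x := fun x => by
    rw [Matrix.mulVec_mulVec, Matrix.nonsing_inv_mul _ hMu, Matrix.one_mulVec]
  have inv2 : ∀ x, M.mulVec (M⁻¹.mulVec x) = x := fun x => by
    rw [Matrix.mulVec_mulVec, Matrix.mul_nonsing_inv _ hMu, Matrix.one_mulVec]
  have key : ∀ v x, M.mulVec x = v → M⁻¹.mulVec v = x := fun v x h => by rw [← h, inv1]
  have dg : ∀ x, M.mulVec x = N.mulVec (fun i => c i * x i) := by
    intro x
    rw [← Matrix.mulVec_mulVec]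
    congr 1
    ext i; rw [Matrix.mulVec_diagonal]
  have main := ftpg1 (ρ := fun v => M⁻¹.mulVec (σ v)) ?_ ?_ ?_ ?_ ?_ ?_
  · refine ⟨M, hM, fun v hv => ?_⟩
    obtain ⟨d, hd'⟩ := main v hv
    have h6 : σ v = d • M.mulVec v := by
      rw [← Matrix.mulVec_smul, ← hd', inv2]
    refine ⟨d, ?_, h6⟩
    rintro rfl
    exact h0 v hv (by rw [h6, zero_smul])
  · intro v hv h
    apply h0 v hv
    rw [← inv2 (σ v)]
    have : M⁻¹.mulVec (σ v) = 0 := h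
    rw [this, Matrix.mulVec_zero]
  · intro u v w hu hv hw h
    change dt (M⁻¹.mulVec (σ u)) (M⁻¹.mulVec (σ v)) (M⁻¹.mulVec (σ w)) = 0
    rw [dt_mul, (hd u v w hu hv hw).1 h, mul_zero]
  · refine ⟨(c 0)⁻¹, key _ _ ?_⟩
    rw [dg, ← e1]; congr 1
    ext i; fin_cases i <;> simp [c0]
  · refine ⟨(c 1)⁻¹, key _ _ ?_⟩
    rw [dg, ← e2]; congr 1
    ext i; fin_cases i <;> simp [c1]
  · refine ⟨(c 2)⁻¹, key _ _ ?_⟩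
    rw [dg, ← e3]; congr 1
    ext i; fin_cases i <;> simp [c2]
  · refine ⟨1, key _ _ ?_⟩
    rw [dg, ← hc]; congr 1
    ext i; fin_cases i <;> simp

end
end OD

set_option linter.all false
namespace OD
section
variable {G V : Type*} [Group G] [MulAction G V] [Finite V] [Finite G]

/-- cross product -/
def crs (u v : Fin 3 → ZMod 83) : Fin 3 → ZMod 83 :=
  ![u 1 * v 2 - u 2 * v 1, u 2 * v 0 - u 0 * v 2, u 0 * v 1 - u 1 * v 0]

theorem crs_zero {u v : Fin 3 → ZMod 83} (hu : u ≠ 0) (hv : v ≠ 0) (h : crs u v = 0) :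
    ∃ c : ZMod 83, c ≠ 0 ∧ u = c • v := by
  have e0 : u 1 * v 2 - u 2 * v 1 = 0 := congrFun h 0
  have e1 : u 2 * v 0 - u 0 * v 2 = 0 := congrFun h 1
  have e2 : u 0 * v 1 - u 1 * v 0 = 0 := congrFun h 2
  obtain ⟨c, hc⟩ : ∃ c : ZMod 83, u = c • v := by
    by_cases h0 : v 0 = 0
    · by_cases h1 : v 1 = 0
      · have h2 : v 2 ≠ 0 := by
          intro h2; apply hv; ext i; fin_cases i <;> simp [h0, h1, h2]
        refine ⟨u 2 / v 2, ?_⟩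
        ext i; fin_cases i
        · simp; field_simp; linear_combination - e1
        · simp; field_simp; linear_combination e0
        · simp; field_simp
      · refine ⟨u 1 / v 1, ?_⟩
        ext i; fin_cases i
        · simp; field_simp; linear_combination e2
        · simp; field_simp
        · simp; field_simp; linear_combination - e0
    · refine ⟨u 0 / v 0, ?_⟩
      ext i; fin_cases i
      · simp; field_simp
      · simp; field_simp; linear_combination - e2
      · simp; field_simp; linear_combination e1
  refine ⟨c, ?_, hc⟩
  rintro rfl
  exact hu (by rw [hc, zero_smul])

theorem dt_ex {u v w : Fin 3 → ZMod 83} : dt u v w = 0 ↔ ∃ φ : Fin 3 → ZMod 83, φ ≠ 0 ∧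
    φ 0 * u 0 + φ 1 * u 1 + φ 2 * u 2 = 0 ∧ φ 0 * v 0 + φ 1 * v 1 + φ 2 * v 2 = 0 ∧
    φ 0 * w 0 + φ 1 * w 1 + φ 2 * w 2 = 0 := by
  rw [dt_det, ← Matrix.exists_mulVec_eq_zero_iff]
  constructor
  · rintro ⟨φ, h0, h⟩
    have e0 := congrFun h 0
    have e1 := congrFun h 1
    have e2 := congrFun h 2
    simp [Matrix.mulVec, dotProduct, Fin.sum_univ_three] at e0 e1 e2
    exact ⟨φ, h0, by linear_combination e0, by linear_combination e1, by linear_combination e2⟩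
  · rintro ⟨φ, h0, e0, e1, e2⟩
    refine ⟨φ, h0, ?_⟩
    ext i; fin_cases i
    · simp [Matrix.mulVec, dotProduct, Fin.sum_univ_three]; linear_combination e0
    · simp [Matrix.mulVec, dotProduct, Fin.sum_univ_three]; linear_combination e1
    · simp [Matrix.mulVec, dotProduct, Fin.sum_univ_three]; linear_combination e2

theorem cube1 : ∀ x : ZMod 83, x ^ 3 = 1 → x = 1 := by
  intro x h
  have hx : x ≠ 0 := by rintro rfl; norm_num at h
  have h1 := ZMod.pow_card_sub_one_eq_one hx
  have h2 : x ^ 165 = 1 := by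
    rw [show 165 = 3 * 55 from rfl, pow_mul, h, one_pow]
  have h3 : x ^ 165 = x := by
    rw [show 165 = (83 - 1) * 2 + 1 from rfl, pow_succ, pow_mul, h1, one_pow, one_mul]
  rw [← h3, h2]

theorem cuberoot {x : ZMod 83} (hx : x ≠ 0) : ∃ t : ZMod 83, t ^ 3 * x = 1 := by
  refine ⟨(x⁻¹) ^ 55, ?_⟩
  have h1 := ZMod.pow_card_sub_one_eq_one (inv_ne_zero hx)
  have h3 : (x⁻¹ ^ 55) ^ 3 = x⁻¹ := by
    rw [← pow_mul, show 55 * 3 = (83 - 1) * 2 + 1 from rfl, pow_succ, pow_mul, h1, one_pow, one_mul]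
  rw [h3, inv_mul_cancel₀ hx]

theorem scal1 {M : Matrix (Fin 3) (Fin 3) (ZMod 83)} (hM : M.det = 1)
    (h : ∀ v, v ≠ 0 → crs (M.mulVec v) v = 0) : M = 1 := by
  have nz : ∀ {x y z : ZMod 83}, (x ≠ 0 ∨ y ≠ 0 ∨ z ≠ 0) → (![x, y, z] : Fin 3 → ZMod 83) ≠ 0 := by
    intro x y z h h'
    have e0 : x = 0 := congrFun h' 0
    have e1 : y = 0 := congrFun h' 1
    have e2 : z = 0 := congrFun h' 2
    rcases h with h | h | h
    · exact h e0
    · exact h e1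
    · exact h e2
  have h1 := h ![1, 0, 0] (nz (Or.inl one_ne_zero))
  have h2 := h ![0, 1, 0] (nz (Or.inr (Or.inl one_ne_zero)))
  have h3 := h ![0, 0, 1] (nz (Or.inr (Or.inr one_ne_zero)))
  have h4 := h ![1, 1, 1] (nz (Or.inl one_ne_zero))
  simp [crs, Matrix.mulVec, dotProduct, Fin.sum_univ_three] at h1 h2 h3
  have a1 := congrFun h4 0
  have a2 := congrFun h4 1
  simp [crs, Matrix.mulVec, dotProduct, Fin.sum_univ_three, h1, h2, h3] at a1 a2
  have b1 : M 1 1 = M 2 2 := sub_eq_zero.1 a1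
  have b2 : M 2 2 = M 0 0 := sub_eq_zero.1 a2
  rw [Matrix.det_fin_three] at hM
  simp [h1, h2, h3, b1, ← b2] at hM
  have b3 : M 2 2 = 1 := cube1 _ (by rw [← hM]; ring)
  ext i j
  fin_cases i <;> fin_cases j <;> simp [h1, h2, h3, b1, ← b2, b3]

theorem card_SL : Nat.card (Matrix.SpecialLinearGroup (Fin 3) (ZMod 83)) ≤ NN := by
  have h := Matrix.card_GL_field (𝔽 := ZMod 83) 3
  rw [ZMod.card, Fin.prod_univ_three] at h
  let F : Matrix.SpecialLinearGroup (Fin 3) (ZMod 83) × (ZMod 83)ˣ → GL (Fin 3) (ZMod 83) :=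
    fun x => Matrix.GeneralLinearGroup.mkOfDetNeZero ((x.2 : ZMod 83) • (x.1 : Matrix (Fin 3) (Fin 3) (ZMod 83))) (by
      rw [Matrix.det_smul, x.1.2, mul_one]; exact pow_ne_zero _ x.2.ne_zero)
  have hF : Function.Injective F := by
    rintro ⟨S, c⟩ ⟨T, d⟩ hST
    have h1 : (c : ZMod 83) • (S : Matrix (Fin 3) (Fin 3) (ZMod 83)) = (d : ZMod 83) • (T : Matrix (Fin 3) (Fin 3) (ZMod 83)) :=
      congrArg Units.val hST
    have h2 : (c : ZMod 83) ^ 3 = (d : ZMod 83) ^ 3 := by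
      have := congrArg Matrix.det h1
      rw [Matrix.det_smul, Matrix.det_smul, S.2, T.2] at this
      simpa using this
    have h3 : (c : ZMod 83) / d = 1 := by
      apply cube1
      rw [div_pow, h2, div_self (pow_ne_zero _ d.ne_zero)]
    have h4 : c = d := Units.ext ((div_eq_one_iff_eq d.ne_zero).1 h3)
    subst h4
    have h5 : S = T := Subtype.ext (smul_right_injective _ c.ne_zero h1)
    rw [h5]
  have h5 := Nat.card_le_card_of_injective F hF
  rw [Nat.card_prod, h, Nat.card_eq_fintype_card (α := (ZMod 83)ˣ), ZMod.card_units] at h5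
  norm_num at h5
  norm_num [NN]
  clear * - h5
  omega

theorem center_bot : Subgroup.center (Matrix.SpecialLinearGroup (Fin 3) (ZMod 83)) = ⊥ := by
  rw [eq_bot_iff]
  intro S hS
  obtain ⟨r, hr, h⟩ := Matrix.SpecialLinearGroup.mem_center_iff.1 hS
  have h1 : r = 1 := cube1 r hr
  rw [Subgroup.mem_bot]
  apply Subtype.ext
  rw [← h, h1, map_one]
  rfl

theorem final (A : PL G V) (hc : Nat.card G = NN) : Nonempty (G ≃* PSL(3, ZMod 83)) := by
  obtain ⟨f, f1, f2, f3, f4⟩ := coord A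
  -- lines come from covectors
  have lin : ∀ m, ¬ A.pt m → ∃ φ : Fin 3 → ZMod 83, φ ≠ 0 ∧ ∀ v, v ≠ 0 → (A.Adj (f v) m ↔ φ 0 * v 0 + φ 1 * v 1 + φ 2 * v 2 = 0) := by
    intro m hm
    obtain ⟨x, hx, -, -⟩ := A.exP (m := m) m m
    obtain ⟨y, hy, hyx, -⟩ := A.exP (m := m) x x
    obtain ⟨u, hu, rfl⟩ := f2 x ((A.bip hx).2 hm)
    obtain ⟨v, hv, rfl⟩ := f2 y ((A.bip hy).2 hm)
    have hn : crs u v ≠ 0 := by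
      intro h
      obtain ⟨c, hc, h6⟩ := crs_zero hu hv h
      apply hyx
      rw [h6, f3 v c hv hc]
    obtain ⟨n, hn1, hn2⟩ := f4 _ hn
    have e : m = n := by
      refine A.uniq hyx hy hx ((hn2 v hv).2 ?_) ((hn2 u hu).2 ?_)
      · simp [crs]; ring
      · simp [crs]; ring
    exact ⟨_, hn, fun w hw => by rw [e]; exact hn2 w hw⟩
  have col : ∀ u v w, u ≠ 0 → v ≠ 0 → w ≠ 0 → (dt u v w = 0 ↔ ∃ m, A.Adj (f u) m ∧ A.Adj (f v) m ∧ A.Adj (f w) m) := by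
    intro u v w hu hv hw
    rw [dt_ex]
    constructor
    · rintro ⟨φ, h0, a, b, c⟩
      obtain ⟨m, -, hm⟩ := f4 φ h0
      exact ⟨m, (hm u hu).2 a, (hm v hv).2 b, (hm w hw).2 c⟩
    · rintro ⟨m, a, b, c⟩
      obtain ⟨φ, h0, h⟩ := lin m ((A.bip a).1 (f1 u hu))
      exact ⟨φ, h0, (h u hu).1 a, (h v hv).1 b, (h w hw).1 c⟩
  have par : ∀ u v, u ≠ 0 → v ≠ 0 → f u = f v → crs u v = 0 := by
    intro u v hu hv huv
    have key : ∀ w : Fin 3 → ZMod 83, w ≠ 0 → dt u v w = 0 := by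
      intro w hw
      rw [col u v w hu hv hw]
      by_cases h : f u = f w
      · obtain ⟨x, hx, -, -⟩ := A.exP (m := f u) (f u) (f u)
        exact ⟨x, A.symm hx, huv ▸ A.symm hx, h ▸ A.symm hx⟩
      · obtain ⟨m, h1, h2⟩ := A.join h (by simp [f1 u hu, f1 w hw])
        exact ⟨m, h1, huv ▸ h1, h2⟩
    have k1 := key ![1, 0, 0] (fun h => one_ne_zero (congrFun h 0))
    have k2 := key ![0, 1, 0] (fun h => one_ne_zero (congrFun h 1))
    have k3 := key ![0, 0, 1] (fun h => one_ne_zero (congrFun h 2))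
    simp [dt] at k1 k2 k3
    ext i; fin_cases i
    · simp [crs]; linear_combination k1
    · simp [crs]; linear_combination k2
    · simp [crs]; linear_combination k3
  have ex : ∀ g : G, ∃ S : Matrix.SpecialLinearGroup (Fin 3) (ZMod 83), ∀ v, v ≠ 0 → f (S.1.mulVec v) = g • f v := by
    intro g
    have h1 : ∀ v : Fin 3 → ZMod 83, ∃ w : Fin 3 → ZMod 83, v ≠ 0 → w ≠ 0 ∧ f w = g • f v := by
      intro v
      by_cases hv : v = 0
      · exact ⟨0, fun h => absurd hv h⟩
      · obtain ⟨w, hw, h⟩ := f2 _ (A.pt_inv g (f1 v hv))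
        exact ⟨w, fun _ => ⟨hw, h⟩⟩
    choose σ hσ using h1
    obtain ⟨M, hM, h2⟩ := ftpg (σ := σ) (fun v hv => (hσ v hv).1) (by
      intro u v w hu hv hw
      rw [col u v w hu hv hw, col _ _ _ (hσ u hu).1 (hσ v hv).1 (hσ w hw).1, (hσ u hu).2, (hσ v hv).2, (hσ w hw).2]
      constructor
      · rintro ⟨m, a, b, c⟩
        exact ⟨g • m, A.inv g a, A.inv g b, A.inv g c⟩
      · rintro ⟨m, a, b, c⟩
        refine ⟨g⁻¹ • m, ?_, ?_, ?_⟩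
        · simpa using A.inv g⁻¹ a
        · simpa using A.inv g⁻¹ b
        · simpa using A.inv g⁻¹ c)
    obtain ⟨t, ht⟩ := cuberoot hM
    have ht0 : t ≠ 0 := by rintro rfl; norm_num at ht
    refine ⟨⟨t • M, by rw [Matrix.det_smul]; exact ht⟩, fun v hv => ?_⟩
    obtain ⟨c, hc0, h3⟩ := h2 v hv
    change f ((t • M).mulVec v) = _
    rw [← (hσ v hv).2]
    have h4 : (t • M).mulVec v = (t * c⁻¹) • σ v := by
      rw [h3, Matrix.smul_mulVec, smul_smul, mul_assoc, inv_mul_cancel₀ hc0, mul_one]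
    rw [h4, f3 _ _ (hσ v hv).1 (mul_ne_zero ht0 (inv_ne_zero hc0))]
  have nzS : ∀ (S : Matrix.SpecialLinearGroup (Fin 3) (ZMod 83)) v, v ≠ 0 → S.1.mulVec v ≠ 0 := by
    intro S v hv h
    have h1 : (S⁻¹).1.mulVec (S.1.mulVec v) = v := by
      rw [Matrix.mulVec_mulVec]
      have : (S⁻¹).1 * S.1 = 1 := congrArg Subtype.val (inv_mul_cancel S)
      rw [this, Matrix.one_mulVec]
    apply hv
    rw [← h1, h, Matrix.mulVec_zero]
  have uq1 : ∀ S : Matrix.SpecialLinearGroup (Fin 3) (ZMod 83), (∀ v, v ≠ 0 → f (S.1.mulVec v) = f v) → S = 1 := by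
    intro S h
    apply Subtype.ext
    exact scal1 S.2 (fun v hv => par _ _ (nzS S v hv) hv (h v hv))
  have uq : ∀ (g : G) (S T : Matrix.SpecialLinearGroup (Fin 3) (ZMod 83)), (∀ v, v ≠ 0 → f (S.1.mulVec v) = g • f v) →
      (∀ v, v ≠ 0 → f (T.1.mulVec v) = g • f v) → S = T := by
    intro g S T hS hT
    have h1 : T⁻¹ * S = 1 := by
      apply uq1
      intro v hv
      have h2 := hT _ (nzS (T⁻¹ * S) v hv)
      rw [Matrix.mulVec_mulVec] at h2
      have h3 : T.1 * (T⁻¹ * S).1 = S.1 := congrArg Subtype.val (mul_inv_cancel_left T S)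
      rw [h3, hS v hv] at h2
      exact (MulAction.injective g h2).symm
    exact (inv_mul_eq_one.1 h1).symm
  choose Φ hΦ using ex
  let φ : G →* Matrix.SpecialLinearGroup (Fin 3) (ZMod 83) := MonoidHom.mk' Φ (by
    intro g h
    refine uq (g * h) _ _ (hΦ _) ?_
    intro v hv
    change f ((((Φ g).1 * (Φ h).1)).mulVec v) = _
    rw [← Matrix.mulVec_mulVec, hΦ g _ (nzS _ v hv), hΦ h v hv, mul_smul])
  have inj : Function.Injective φ := by
    rw [injective_iff_map_eq_one]
    intro g hg
    have hg' : Φ g = 1 := hg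
    have hpt : ∀ x, A.pt x → g • x = x := by
      intro x hx
      obtain ⟨v, hv, rfl⟩ := f2 x hx
      rw [← hΦ g v hv, hg']
      change f ((1 : Matrix (Fin 3) (Fin 3) (ZMod 83)).mulVec v) = _
      rw [Matrix.one_mulVec]
    apply A.faithful
    intro m
    by_cases hm : A.pt m
    · exact hpt m hm
    · obtain ⟨x, hx, -, -⟩ := A.exP (m := m) m m
      obtain ⟨y, hy, hyx, -⟩ := A.exP (m := m) x x
      have hx' := A.inv g hx
      have hy' := A.inv g hy
      rw [hpt x ((A.bip hx).2 hm)] at hx'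
      rw [hpt y ((A.bip hy).2 hm)] at hy'
      exact A.uniq hyx hy' hx' hy hx
  have bij : Function.Bijective φ := by
    refine (Nat.bijective_iff_injective_and_card φ).2 ⟨inj, ?_⟩
    apply le_antisymm (Nat.card_le_card_of_injective φ inj)
    rw [hc]; exact card_SL
  exact ⟨(MulEquiv.ofBijective φ bij).trans (QuotientGroup.quotientBot.symm.trans (QuotientGroup.quotientMulEquivOfEq center_bot.symm))⟩

end
end OD

theorem L3_83_OD_characterizable (G : Type*) [Group G] [Finite G]
    (hcard : Nat.card G = 2 ^ 4 * 3 * 7 * 19 * 41 ^ 2 * 83 ^ 3 * 367)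
    (hdeg2 : primeGraphDeg G 2 = 4)
    (hdeg3 : primeGraphDeg G 3 = 3)
    (hdeg7 : primeGraphDeg G 7 = 3)
    (hdeg19 : primeGraphDeg G 19 = 1)
    (hdeg41 : primeGraphDeg G 41 = 4)
    (hdeg83 : primeGraphDeg G 83 = 2)
    (hdeg367 : primeGraphDeg G 367 = 1) :
    Nonempty (G ≃* PSL(3, ZMod 83)) := by
  have hG := OD.mkHyp hcard hdeg2 hdeg3 hdeg7 hdeg19 hdeg41 hdeg83 hdeg367
  exact OD.final (OD.mkGA hG).toPL hG.card
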